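/- Let (R,m) be an analytically unramified unmixed Noetherian local ring of positive dimension and let Q be a parameter ideal of R. If ē_1(Q) = e_1(Q), then R is a regular local ring and Q is a normal ideal, i.e., \overline{Q^n} = Q^n for all n ≥ 1. -/

import Mathlib

open Finset IsLocalRing

/-- The length of an `R`-module `M`: the Krull dimension of its lattice of submodules,
i.e. the supremum of the lengths of chains of submodules of `M`. -/
noncomputable def moduleLength (R M : Type*) [CommRing R] [AddCommGroup M] [Module R M] :
    WithBot ℕ∞ :=
  Order.krullDim (Submodule R M)

/-- A local Noetherian ring is Cohen-Macaulay if its depth equals its Krull dimension,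
equivalently, if it admits a regular sequence in the maximal ideal whose length is the
Krull dimension. -/
def IsCohenMacaulayLocalRing (R : Type*) [CommRing R] [IsLocalRing R] : Prop :=
  ∃ rs : List R, (∀ x ∈ rs, x ∈ maximalIdeal R) ∧
    RingTheory.Sequence.IsRegular R rs ∧ (rs.length : WithBot ℕ∞) = ringKrullDim R

/-- `e 0, …, e d` are the Hilbert coefficients of an ideal `I` in a ring of dimension `d`:
for all large `n`, `λ(R ⧸ I^(n+1)) = ∑_{i=0}^{d} (-1)^i (e i) C(n+d-i, d-i)`. -/
def HasHilbertCoeffs {R : Type*} [CommRing R] (I : Ideal R) (d : ℕ) (e : ℕ → ℤ) : Prop :=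
  ∃ N : ℕ, ∀ n ≥ N, ∃ l : ℕ,
    moduleLength R (R ⧸ I ^ (n + 1)) = (l : WithBot ℕ∞) ∧
    (l : ℤ) = ∑ i ∈ Finset.range (d + 1), (-1 : ℤ) ^ i * e i * ((n + d - i).choose (d - i))

/-- The set of elements integral over an ideal `I`: all `y` satisfying an equation
`y^m + a₁ y^(m-1) + ⋯ + a_m = 0` with `a_j ∈ I^j`. -/
def integralOverIdeal {R : Type*} [CommRing R] (I : Ideal R) : Set R :=
  {y | ∃ m : ℕ, 0 < m ∧ ∃ a : ℕ → R, (∀ j, 1 ≤ j → j ≤ m → a j ∈ I ^ j) ∧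
    y ^ m + ∑ j ∈ Finset.Icc 1 m, a j * y ^ (m - j) = 0}

/-- The integral closure of an ideal `I`, as an ideal (the set of elements integral over
`I` is an ideal, so it coincides with the ideal it generates). -/
noncomputable def idealIntegralClosure {R : Type*} [CommRing R] (I : Ideal R) : Ideal R :=
  Ideal.span (integralOverIdeal I)

/-- `ebar 0, …, ebar d` are the normal Hilbert coefficients of `I`: for all large `n`,
`λ(R ⧸ closure(I^(n+1))) = ∑_{i=0}^{d} (-1)^i (ebar i) C(n+d-i, d-i)`. -/
def HasNormalHilbertCoeffs {R : Type*} [CommRing R] (I : Ideal R) (d : ℕ) (ebar : ℕ → ℤ) :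
    Prop :=
  ∃ N : ℕ, ∀ n ≥ N, ∃ l : ℕ,
    moduleLength R (R ⧸ idealIntegralClosure (I ^ (n + 1))) = (l : WithBot ℕ∞) ∧
    (l : ℤ) = ∑ i ∈ Finset.range (d + 1), (-1 : ℤ) ^ i * ebar i * ((n + d - i).choose (d - i))

/-- A Noetherian local ring `R` is unmixed if `dim(R̂/p) = dim R̂` for every associated
prime `p` of the `m`-adic completion `R̂` of `R`. -/
def IsUnmixedLocalRing (R : Type*) [CommRing R] [IsLocalRing R] : Prop :=
  ∀ p ∈ associatedPrimes (AdicCompletion (maximalIdeal R) R)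
      (AdicCompletion (maximalIdeal R) R),
    ringKrullDim (AdicCompletion (maximalIdeal R) R ⧸ p) =
      ringKrullDim (AdicCompletion (maximalIdeal R) R)

/-- A parameter ideal of a `d`-dimensional Noetherian local ring: an ideal contained in the
maximal ideal, generated by `d` elements, with `λ(R/Q) < ∞`. -/
def IsParameterIdeal {R : Type*} [CommRing R] [IsLocalRing R] (d : ℕ) (Q : Ideal R) : Prop :=
  Q ≤ maximalIdeal R ∧ (∃ x : Fin d → R, Q = Ideal.span (Set.range x)) ∧
    ∃ l : ℕ, moduleLength R (R ⧸ Q) = (l : WithBot ℕ∞)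

namespace NormalChern

open Module

section RelLength

variable {R M N : Type*} [CommRing R] [AddCommGroup M] [Module R M] [AddCommGroup N] [Module R N]

/-- The length of `(I + J) / J`. -/
noncomputable def relLength (J I : Submodule R M) : ℕ∞ :=
  Module.length R (I ⧸ J.comap I.subtype)

theorem length_quotient_anti {p q : Submodule R M} (h : p ≤ q) :
    Module.length R (M ⧸ q) ≤ Module.length R (M ⧸ p) :=
  Module.length_le_of_surjective (Submodule.factor h) (Submodule.factor_surjective h)

theorem relLength_eq_of_range (f : N →ₗ[R] M) (J I : Submodule R M)
    (h : LinearMap.range f ⊔ J = I ⊔ J) :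
    relLength J I = Module.length R (N ⧸ J.comap f) := by
  have e1 : relLength J I = Module.length R (LinearMap.range (J.mkQ ∘ₗ I.subtype)) := by
    have hk : J.comap I.subtype = LinearMap.ker (J.mkQ ∘ₗ I.subtype) := by
      ext x; simp
    rw [relLength, hk]
    exact (LinearMap.quotKerEquivRange _).length_eq
  have e2 : Module.length R (N ⧸ J.comap f) = Module.length R (LinearMap.range (J.mkQ ∘ₗ f)) := by
    have hk : J.comap f = LinearMap.ker (J.mkQ ∘ₗ f) := by
      ext x; simp
    rw [hk]
    exact (LinearMap.quotKerEquivRange _).length_eq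
  rw [e1, e2]
  have : LinearMap.range (J.mkQ ∘ₗ I.subtype) = LinearMap.range (J.mkQ ∘ₗ f) := by
    rw [LinearMap.range_comp, LinearMap.range_comp, Submodule.range_subtype]
    have h2 := congrArg (Submodule.map J.mkQ) h
    rw [Submodule.map_sup, Submodule.map_sup, Submodule.mkQ_map_self] at h2
    simpa using h2.symm
  rw [this]

theorem relLength_top (J : Submodule R M) : relLength J ⊤ = Module.length R (M ⧸ J) := by
  rw [relLength_eq_of_range LinearMap.id J ⊤ (by simp), Submodule.comap_id]

theorem relLength_sup_left (J I : Submodule R M) : relLength J (I ⊔ J) = relLength J I := by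
  rw [relLength_eq_of_range I.subtype J (I ⊔ J) (by simp),
    relLength_eq_of_range I.subtype J I (by simp)]

theorem relLength_eq_zero_of_le {J I : Submodule R M} (h : I ≤ J) : relLength J I = 0 := by
  rw [relLength, Module.length_eq_zero_iff, Submodule.Quotient.subsingleton_iff]
  simpa using h

theorem relLength_add {K J I : Submodule R M} (hKJ : K ≤ J) (hJI : J ≤ I) :
    relLength K I = relLength K J + relLength J I := by
  let f : (J ⧸ K.comap J.subtype) →ₗ[R] (I ⧸ K.comap I.subtype) :=
    Submodule.mapQ _ _ (Submodule.inclusion hJI) (fun x hx => hx)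
  let g : (I ⧸ K.comap I.subtype) →ₗ[R] (I ⧸ J.comap I.subtype) :=
    Submodule.mapQ _ _ LinearMap.id (Submodule.comap_mono hKJ)
  apply Module.length_eq_add_of_exact f g
  · rw [← LinearMap.ker_eq_bot, LinearMap.ker_eq_bot']
    intro m hm
    induction m using Submodule.Quotient.induction_on with
    | H x =>
      change Submodule.Quotient.mk (Submodule.inclusion hJI x) = 0 at hm
      have h2 := (Submodule.Quotient.mk_eq_zero _).1 hm
      exact (Submodule.Quotient.mk_eq_zero _).2 h2
  · intro y
    induction y using Submodule.Quotient.induction_on with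
    | H x => exact ⟨Submodule.Quotient.mk x, by simp [g]⟩
  · intro y
    induction y using Submodule.Quotient.induction_on with
    | H x =>
      constructor
      · intro hx
        change Submodule.Quotient.mk (LinearMap.id x) = 0 at hx
        replace hx := (Submodule.Quotient.mk_eq_zero _).1 hx
        exact ⟨Submodule.Quotient.mk ⟨x.1, hx⟩, rfl⟩
      · rintro ⟨z, hz⟩
        induction z using Submodule.Quotient.induction_on with
        | H z =>
          rw [← hz]
          change Submodule.Quotient.mk (LinearMap.id (Submodule.inclusion hJI z)) = 0
          exact (Submodule.Quotient.mk_eq_zero _).2 z.2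

theorem relLength_mono_right (J : Submodule R M) {I I' : Submodule R M} (h : I ≤ I') :
    relLength J I ≤ relLength J I' := by
  rw [← relLength_sup_left J I, ← relLength_sup_left J I',
    relLength_add (K := J) (J := I ⊔ J) (I := I' ⊔ J) le_sup_right (sup_le_sup_right h _)]
  exact le_self_add

theorem relLength_anti_left {J J' : Submodule R M} (h : J ≤ J') (I : Submodule R M) :
    relLength J' I ≤ relLength J I :=
  length_quotient_anti (Submodule.comap_mono h)

theorem relLength_eq_zero_iff {J I : Submodule R M} : relLength J I = 0 ↔ I ≤ J := by
  refine ⟨fun h => ?_, relLength_eq_zero_of_le⟩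
  rw [relLength, Module.length_eq_zero_iff, Submodule.Quotient.subsingleton_iff] at h
  simpa using h

/-- The length of the sum of a chain of consecutive quotients. -/
theorem relLength_chain (F : ℕ → Submodule R M) (hF : Antitone F) (n : ℕ) :
    relLength (F n) (F 0) = ∑ i ∈ Finset.range n, relLength (F (i + 1)) (F i) := by
  induction n with
  | zero =>
    rw [Finset.sum_range_zero]
    exact relLength_eq_zero_of_le le_rfl
  | succ n ih =>
    rw [Finset.sum_range_succ, ← ih, add_comm (relLength (F n) (F 0))]
    exact relLength_add (K := F (n + 1)) (J := F n) (I := F 0) (hF (Nat.le_succ n))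
      (hF (Nat.zero_le n))

theorem length_quotient_eq_add {J I : Submodule R M} (h : J ≤ I) :
    Module.length R (M ⧸ J) = relLength J I + Module.length R (M ⧸ I) := by
  rw [← relLength_top, ← relLength_top]
  exact relLength_add h le_top

end RelLength

end NormalChern

namespace NormalChern

open Module IsLocalRing MvPolynomial

/-- The dimension of the space of forms of degree `m` in `c + 1` variables. -/
def formDim (c m : ℕ) : ℕ := (m + c).choose c

section Poly

variable {k : Type*} [Field k] {c : ℕ}

theorem homogeneousSubmodule_finite (m : ℕ) :
    Module.Finite k (homogeneousSubmodule (Fin (c + 1)) k m) :=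
  Module.Finite.iff_fg.2 (homogeneousSubmodule_fg _ _ m)

theorem finrank_homogeneousSubmodule (m : ℕ) :
    finrank k (homogeneousSubmodule (Fin (c + 1)) k m) = formDim c m := by
  classical
  rw [homogeneousSubmodule_eq_finsupp_supported]
  have e := AddMonoidAlgebra.supportedEquivFinsupp (R := k) (S := k)
    {d : Fin (c + 1) →₀ ℕ | d.degree = m}
  have hset : {d : Fin (c + 1) →₀ ℕ | d.degree = m} =
      ((Finset.univ : Finset (Fin (c + 1))).finsuppAntidiag m : Set _) := by
    ext d
    simp [Finsupp.degree_eq_sum]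
  rw [e.finrank_eq, hset]
  rw [finrank_finsupp_self]
  simp only [Finset.coe_sort_coe, Fintype.card_coe]
  rw [Finset.card_finsuppAntidiag_nat_eq_choose, formDim]
  simp only [Finset.card_univ, Fintype.card_fin]
  rw [show c + 1 + m - 1 = m + c by omega, ← Nat.choose_symm (by omega)]
  congr 1
  omega

theorem homogeneousComponent_mul_of_isHomogeneous {p : MvPolynomial (Fin (c + 1)) k} {b : ℕ}
    (hp : p.IsHomogeneous b) (q : MvPolynomial (Fin (c + 1)) k) (m : ℕ) :
    homogeneousComponent (b + m) (p * q) = p * homogeneousComponent m q := by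
  conv_lhs => rw [← sum_homogeneousComponent q, Finset.mul_sum, map_sum]
  have h1 : ∀ i, homogeneousComponent (b + m) (p * homogeneousComponent i q) =
      if i = m then p * homogeneousComponent i q else 0 := by
    intro i
    rw [homogeneousComponent_of_mem (hp.mul (homogeneousComponent_isHomogeneous i q))]
    simp [eq_comm]
  simp only [h1]
  rw [Finset.sum_ite_eq']
  split_ifs with h
  · rfl
  · rw [homogeneousComponent_eq_zero m q (by simpa using h), mul_zero]

theorem homogeneousComponent_mul_top {p q : MvPolynomial (Fin (c + 1)) k} {a b : ℕ}
    (hp : p.totalDegree ≤ a) (hq : q.totalDegree ≤ b) :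
    homogeneousComponent (a + b) (p * q) = homogeneousComponent a p * homogeneousComponent b q := by
  conv_lhs => rw [← sum_homogeneousComponent p, Finset.sum_mul, map_sum]
  have h1 : ∀ i ∈ Finset.range (p.totalDegree + 1),
      homogeneousComponent (a + b) (homogeneousComponent i p * q) =
      if i = a then homogeneousComponent a p * homogeneousComponent b q else 0 := by
    intro i hi
    have hi' : i ≤ p.totalDegree := by simpa [Nat.lt_succ_iff] using hi
    rw [show a + b = i + (a + b - i) by omega,
      homogeneousComponent_mul_of_isHomogeneous (homogeneousComponent_isHomogeneous i p)]
    split_ifs with h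
    · subst h
      rw [Nat.add_sub_cancel_left]
    · rw [homogeneousComponent_eq_zero _ q (by omega), mul_zero]
  rw [Finset.sum_congr rfl h1, Finset.sum_ite_eq']
  split_ifs with h
  · rfl
  · rw [homogeneousComponent_eq_zero a p (by simp at h; omega), zero_mul]

/-- The forms of degree `m` divisible by `p`. -/
noncomputable def multiples (p : MvPolynomial (Fin (c + 1)) k) (m : ℕ) :
    Submodule k (MvPolynomial (Fin (c + 1)) k) :=
  (Ideal.span {p}).restrictScalars k ⊓ homogeneousSubmodule _ k m

theorem mem_multiples {p f : MvPolynomial (Fin (c + 1)) k} {m : ℕ} :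
    f ∈ multiples p m ↔ p ∣ f ∧ f.IsHomogeneous m := by
  simp [multiples, Ideal.mem_span_singleton]

instance (p : MvPolynomial (Fin (c + 1)) k) (m : ℕ) : FiniteDimensional k (multiples p m) :=
  have := homogeneousSubmodule_finite (k := k) (c := c) m
  Submodule.finiteDimensional_of_le (inf_le_right : _ ≤ homogeneousSubmodule _ k m)

theorem finrank_multiples {p : MvPolynomial (Fin (c + 1)) k} {b : ℕ} (hp : p.IsHomogeneous b)
    (h0 : p ≠ 0) (m : ℕ) : finrank k (multiples p (b + m)) = formDim c m := by
  rw [← finrank_homogeneousSubmodule (k := k) (c := c) m]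
  have hinj : Function.Injective (LinearMap.mulLeft k p) := fun u v h =>
    mul_left_cancel₀ h0 (by simpa using h)
  rw [(Submodule.equivMapOfInjective _ hinj (homogeneousSubmodule _ k m)).finrank_eq]
  suffices multiples p (b + m) = (homogeneousSubmodule _ k m).map (LinearMap.mulLeft k p) by
    rw [this]
  ext f
  rw [mem_multiples, Submodule.mem_map]
  constructor
  · rintro ⟨⟨q, rfl⟩, hf⟩
    refine ⟨homogeneousComponent m q, homogeneousComponent_isHomogeneous m q, ?_⟩
    rw [LinearMap.mulLeft_apply, ← homogeneousComponent_mul_of_isHomogeneous hp,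
      homogeneousComponent_of_mem hf, if_pos rfl]
  · rintro ⟨q, hq, rfl⟩
    exact ⟨⟨q, rfl⟩, hp.mul hq⟩

theorem formDim_mono (c : ℕ) : Monotone (formDim c) := fun _ _ h =>
  Nat.choose_le_choose _ (Nat.add_le_add_right h c)

theorem finrank_multiples_succ_le {p : MvPolynomial (Fin (c + 1)) k} (h0 : p ≠ 0)
    (hu : ¬ IsUnit p) (m : ℕ) : finrank k (multiples p (m + 1)) ≤ formDim c m := by
  have hb : 1 ≤ p.totalDegree := by
    by_contra h
    have h' : p.totalDegree = 0 := by omega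
    rw [totalDegree_eq_zero_iff_eq_C] at h'
    apply hu
    rw [h']
    refine IsUnit.map C (IsUnit.mk0 _ fun h'' => h0 ?_)
    rw [h', h'', map_zero]
  set P := homogeneousComponent p.totalDegree p with hP
  have hP0 : P ≠ 0 := by
    intro h
    obtain ⟨e, he, hd⟩ := Finset.exists_mem_eq_sup p.support (support_nonempty.2 h0)
      (fun s => s.sum fun _ e => e)
    have h2 : coeff e P = coeff e p := by
      rw [hP, coeff_homogeneousComponent, if_pos]
      rw [Finsupp.degree_apply, totalDegree, hd]
      rfl
    rw [h, coeff_zero] at h2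
    exact (mem_support_iff.1 he) h2.symm
  have hle : multiples p (m + 1) ≤ multiples P (m + 1) := by
    intro f hf
    rw [mem_multiples] at hf ⊢
    refine ⟨?_, hf.2⟩
    obtain ⟨q, rfl⟩ := hf.1
    by_cases hq : q = 0
    · simp [hq]
    have hdeg : m + 1 = p.totalDegree + q.totalDegree := by
      rw [← hf.2.totalDegree (mul_ne_zero h0 hq), totalDegree_mul_of_isDomain h0 hq]
    refine ⟨homogeneousComponent q.totalDegree q, ?_⟩
    rw [← homogeneousComponent_mul_top le_rfl le_rfl, ← hdeg, homogeneousComponent_of_mem hf.2,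
      if_pos rfl]
  refine (Submodule.finrank_mono hle).trans ?_
  by_cases hm : p.totalDegree ≤ m + 1
  · obtain ⟨j, hj⟩ := Nat.exists_eq_add_of_le hm
    rw [hj, finrank_multiples (homogeneousComponent_isHomogeneous _ _) hP0]
    exact formDim_mono c (by omega)
  · have : multiples P (m + 1) = ⊥ := by
      rw [eq_bot_iff]
      intro f hf
      rw [mem_multiples] at hf
      obtain ⟨⟨q, rfl⟩, hf⟩ := hf
      rw [Submodule.mem_bot]
      by_contra h
      have h2 := hf.totalDegree h
      rw [totalDegree_mul_of_isDomain hP0 (right_ne_zero_of_mul h),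
        (homogeneousComponent_isHomogeneous _ _).totalDegree hP0] at h2
      omega
    rw [this, finrank_bot]
    exact Nat.zero_le _

end Poly

section Forms

variable {R : Type*} [CommRing R] [IsLocalRing R] {c : ℕ} (x : Fin (c + 1) → R)

theorem isHomogeneous_map_lift {m : ℕ} {g : MvPolynomial (Fin (c + 1)) (ResidueField R)}
    (hg : g.IsHomogeneous m) :
    ∃ p : MvPolynomial (Fin (c + 1)) R, p.IsHomogeneous m ∧ map (residue R) p = g := by
  obtain ⟨p, hp⟩ := map_surjective (residue R) residue_surjective g
  refine ⟨homogeneousComponent m p, homogeneousComponent_isHomogeneous m p, ?_⟩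
  ext e
  rw [coeff_map, coeff_homogeneousComponent, ← hp, coeff_map]
  split_ifs with h
  · rfl
  · rw [map_zero, ← coeff_map, hp, hg.coeff_eq_zero h]

theorem isHomogeneous_map {m : ℕ} {p : MvPolynomial (Fin (c + 1)) R} (hp : p.IsHomogeneous m) :
    (map (residue R) p).IsHomogeneous m := hp.map _

theorem length_restrictScalars_residue (M : Type*) [AddCommGroup M] [Module (ResidueField R) M]
    [Module R M] [IsScalarTower R (ResidueField R) M] [Module.Finite (ResidueField R) M] :
    Module.length R M = finrank (ResidueField R) M := by
  rw [← Module.length_eq_finrank]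
  exact Module.length_eq_of_surjective residue_surjective

/-- Reduction of forms modulo the maximal ideal. -/
noncomputable def redForm (m : ℕ) : homogeneousSubmodule (Fin (c + 1)) R m →ₗ[R]
    homogeneousSubmodule (Fin (c + 1)) (ResidueField R) m where
  toFun p := ⟨map (residue R) p.1, isHomogeneous_map p.2⟩
  map_add' p q := by ext1; simp
  map_smul' r p := by
    ext e
    simp [coeff_map, Algebra.smul_def, coeff_C_mul, MvPolynomial.algebraMap_eq]

theorem redForm_surjective (m : ℕ) : Function.Surjective (redForm (R := R) (c := c) m) := by
  rintro ⟨g, hg⟩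
  obtain ⟨p, hp, h⟩ := isHomogeneous_map_lift hg
  exact ⟨⟨p, hp⟩, Subtype.ext h⟩

/-- The map sending a form `p` of degree `m` to `r * p(x)`. -/
noncomputable def evalForm (r : R) (m : ℕ) : homogeneousSubmodule (Fin (c + 1)) R m →ₗ[R] R :=
  (LinearMap.mulLeft R r ∘ₗ (aeval x).toLinearMap) ∘ₗ Submodule.subtype _

omit [IsLocalRing R] in
theorem evalForm_apply (r : R) (m : ℕ) (p : homogeneousSubmodule (Fin (c + 1)) R m) :
    evalForm x r m p = r * eval x p.1 := by
  simp [evalForm, aeval_eq_eval]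

omit [IsLocalRing R] in
theorem range_evalForm (r : R) (m : ℕ) : LinearMap.range (evalForm x r m) =
    Ideal.span {r} * Ideal.span (Set.range x) ^ m := by
  ext y
  rw [Ideal.mem_span_singleton_mul, LinearMap.mem_range]
  constructor
  · rintro ⟨p, rfl⟩
    exact ⟨eval x p.1, (Ideal.mem_span_pow_iff_exists_isHomogeneous x _).2 ⟨p.1, p.2, rfl⟩,
      (evalForm_apply x r m p).symm⟩
  · rintro ⟨z, hz, rfl⟩
    obtain ⟨p, hp, rfl⟩ := (Ideal.mem_span_pow_iff_exists_isHomogeneous x _).1 hz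
    exact ⟨⟨p, hp⟩, evalForm_apply x r m _⟩

theorem length_quot_redForm (m : ℕ)
    (K : Submodule (ResidueField R) (MvPolynomial (Fin (c + 1)) (ResidueField R))) :
    Module.length R (homogeneousSubmodule (Fin (c + 1)) R m ⧸
      ((K.comap (Submodule.subtype _)).restrictScalars R).comap (redForm m)) +
      finrank (ResidueField R) (K ⊓ homogeneousSubmodule _ _ m : Submodule _ _) = formDim c m := by
  have := homogeneousSubmodule_finite (k := ResidueField R) (c := c) m
  set K' := K.comap (homogeneousSubmodule (Fin (c + 1)) (ResidueField R) m).subtype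
  have h1 : Module.length R (homogeneousSubmodule (Fin (c + 1)) R m ⧸
      (K'.restrictScalars R).comap (redForm m)) =
      Module.length R (homogeneousSubmodule (Fin (c + 1)) (ResidueField R) m ⧸ K') := by
    have hk : (K'.restrictScalars R).comap (redForm m) =
        LinearMap.ker ((K'.restrictScalars R).mkQ ∘ₗ redForm m) := by
      rw [LinearMap.ker_comp, Submodule.ker_mkQ]
    rw [hk]
    refine (LinearMap.quotKerEquivOfSurjective _ ?_).length_eq
    exact (Submodule.mkQ_surjective _).comp (redForm_surjective m)
  have h2 : finrank (ResidueField R) (K ⊓ homogeneousSubmodule _ _ m : Submodule _ _) =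
      finrank (ResidueField R) K' := by
    have := (Submodule.equivMapOfInjective
      (homogeneousSubmodule (Fin (c + 1)) (ResidueField R) m).subtype
      (Submodule.subtype_injective _) K').finrank_eq
    rw [this, Submodule.map_comap_subtype, inf_comm]
  rw [h1, length_restrictScalars_residue, h2, ← finrank_homogeneousSubmodule
    (k := ResidueField R) (c := c) m, ← Submodule.finrank_quotient_add_finrank K']
  push_cast
  rfl

/-- Lower bound for the length of `(r Q^m + W) / W`. -/
theorem formDim_le_relLength (r : R) (W : Ideal R) (m : ℕ)
    (K : Submodule (ResidueField R) (MvPolynomial (Fin (c + 1)) (ResidueField R)))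
    (h : ∀ p : MvPolynomial (Fin (c + 1)) R, p.IsHomogeneous m → r * eval x p ∈ W →
      map (residue R) p ∈ K) :
    (formDim c m : ℕ∞) ≤ relLength W (Ideal.span {r} * Ideal.span (Set.range x) ^ m) +
      finrank (ResidueField R) (K ⊓ homogeneousSubmodule _ _ m : Submodule _ _) := by
  rw [← length_quot_redForm (R := R) m K, relLength_eq_of_range (evalForm x r m) W _
    (by rw [range_evalForm])]
  gcongr
  apply length_quotient_anti
  intro p hp
  rw [Submodule.mem_comap, evalForm_apply] at hp
  exact h p.1 p.2 hp

/-- Upper bound for the length of `(r Q^m + W) / W`. -/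
theorem relLength_le_formDim (r : R) (W : Ideal R) (m : ℕ)
    (K : Submodule (ResidueField R) (MvPolynomial (Fin (c + 1)) (ResidueField R)))
    (h : ∀ p : MvPolynomial (Fin (c + 1)) R, p.IsHomogeneous m → map (residue R) p ∈ K →
      r * eval x p ∈ W) :
    relLength W (Ideal.span {r} * Ideal.span (Set.range x) ^ m) +
      finrank (ResidueField R) (K ⊓ homogeneousSubmodule _ _ m : Submodule _ _) ≤ formDim c m := by
  rw [← length_quot_redForm (R := R) m K, relLength_eq_of_range (evalForm x r m) W _
    (by rw [range_evalForm])]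
  gcongr
  apply length_quotient_anti
  intro p hp
  rw [Submodule.mem_comap, evalForm_apply]
  exact h p.1 p.2 hp

theorem eval_mem_of_map_residue_eq_zero {p : MvPolynomial (Fin (c + 1)) R} {m : ℕ}
    (hp : p.IsHomogeneous m) (h0 : map (residue R) p = 0) :
    eval x p ∈ maximalIdeal R * Ideal.span (Set.range x) ^ m := by
  rw [eval_eq]
  refine Ideal.sum_mem _ fun e he => Ideal.mul_mem_mul ?_ ?_
  · rw [← residue_eq_zero_iff, ← coeff_map, h0, coeff_zero]
  · have := hp (mem_support_iff.1 he)
    refine (Ideal.mem_span_pow_iff_exists_isHomogeneous x _).2 ⟨monomial e 1, ?_, ?_⟩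
    · apply isHomogeneous_monomial
      rw [← this, Finsupp.degree_eq_weight_one]
      rfl
    · rw [eval_monomial, one_mul, Finsupp.prod]

end Forms

end NormalChern

namespace NormalChern

open Module IsLocalRing

variable {R : Type*} [CommRing R]

theorem exists_artinRees [IsNoetherianRing R] (Q a : Ideal R) (x : R) :
    ∃ k : ℕ, ∀ n y, x * y ∈ a ⊔ Q ^ n → ∃ z ∈ Q ^ (n - k), x * (y - z) ∈ a := by
  obtain ⟨k, hk⟩ := Ideal.exists_pow_inf_eq_pow_smul (M := R ⧸ a) Q
    (Submodule.span R {(Submodule.Quotient.mk x : R ⧸ a)})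
  refine ⟨k, fun n y h => ?_⟩
  rcases lt_or_ge n k with hn | hn
  · exact ⟨y, by simp [Nat.sub_eq_zero_of_le hn.le], by simp⟩
  have h1 : (Submodule.Quotient.mk (x * y) : R ⧸ a) ∈ Q ^ n • (⊤ : Submodule R (R ⧸ a)) ⊓
      Submodule.span R {(Submodule.Quotient.mk x : R ⧸ a)} := by
    constructor
    · obtain ⟨u, hu, v, hv, huv⟩ := Submodule.mem_sup.1 h
      have : (Submodule.Quotient.mk (x * y) : R ⧸ a) = v • Submodule.Quotient.mk (1 : R) := by
        rw [← Submodule.Quotient.mk_smul, Submodule.Quotient.eq, ← huv, smul_eq_mul, mul_one,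
          add_sub_cancel_right]
        exact hu
      rw [this]
      exact Submodule.smul_mem_smul hv trivial
    · rw [mul_comm, ← smul_eq_mul, Submodule.Quotient.mk_smul]
      exact Submodule.smul_mem _ _ (Submodule.mem_span_singleton_self _)
  rw [hk n hn] at h1
  have h2 := Submodule.smul_mono (le_refl (Q ^ (n - k))) (inf_le_right : Q ^ k •
    (⊤ : Submodule R (R ⧸ a)) ⊓ Submodule.span R {(Submodule.Quotient.mk x : R ⧸ a)} ≤ _) h1
  rw [Submodule.mem_smul_span_singleton] at h2
  obtain ⟨z, hz, h3⟩ := h2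
  refine ⟨z, hz, ?_⟩
  rw [← Submodule.Quotient.mk_smul, Submodule.Quotient.eq] at h3
  rw [← neg_mem_iff]
  convert h3 using 1
  rw [smul_eq_mul]
  ring

theorem relLength_span_singleton (W : Ideal R) (x : R) :
    relLength W (Ideal.span {x}) = Module.length R (R ⧸ Submodule.comap (LinearMap.mulLeft R x) W) := by
  refine relLength_eq_of_range _ _ _ ?_
  congr 1
  ext y
  rw [Ideal.mem_span_singleton', LinearMap.mem_range]
  simp only [LinearMap.mulLeft_apply, mul_comm]

/-- Passing to a quotient by a non-zero-divisor drops the order of growth. -/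
theorem growth_drop [IsNoetherianRing R] (Q p : Ideal R) [p.IsPrime] {x : R} (hx : x ∉ p)
    {c C : ℕ} (h : ∀ n, Module.length R (R ⧸ (p ⊔ Q ^ n)) ≤ (C * (n + 1) ^ (c + 1) : ℕ)) :
    ∃ C' : ℕ, ∀ n, Module.length R (R ⧸ (p ⊔ Ideal.span {x} ⊔ Q ^ n)) ≤
      (C' * (n + 1) ^ c : ℕ) := by
  obtain ⟨k, hk⟩ := exists_artinRees Q p x
  set H := fun n => Module.length R (R ⧸ (p ⊔ Q ^ n)) with hH
  set g := fun n => Module.length R (R ⧸ (p ⊔ Ideal.span {x} ⊔ Q ^ n)) with hg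
  have hgm : Monotone g := fun a b hab => length_quotient_anti
    (sup_le_sup_left (Ideal.pow_le_pow_right hab) _)
  have hstep : ∀ n, H n + g (n + (k + 1)) ≤ H (n + (k + 1)) := by
    intro n
    have h1 : H (n + (k + 1)) = relLength (p ⊔ Q ^ (n + (k + 1)))
        (p ⊔ Ideal.span {x} ⊔ Q ^ (n + (k + 1))) + g (n + (k + 1)) :=
      length_quotient_eq_add (sup_le_sup_right le_sup_left _)
    rw [h1]
    gcongr
    have h2 : p ⊔ Ideal.span {x} ⊔ Q ^ (n + (k + 1)) =
        Ideal.span {x} ⊔ (p ⊔ Q ^ (n + (k + 1))) := by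
      rw [← sup_assoc, sup_comm p]
    rw [h2, relLength_sup_left, relLength_span_singleton]
    apply length_quotient_anti
    intro y hy
    obtain ⟨z, hz, hxz⟩ := hk _ _ hy
    have h3 := (Ideal.IsPrime.mem_or_mem ‹_› hxz).resolve_left hx
    rw [show y = (y - z) + z by ring]
    refine Submodule.add_mem_sup h3 (Ideal.pow_le_pow_right (by omega) hz)
  have hsum : ∀ N, ∑ j ∈ Finset.range N, g ((j + 1) * (k + 1)) ≤ H (N * (k + 1)) := by
    intro N
    induction N with
    | zero => simp
    | succ N ih =>
      rw [Finset.sum_range_succ]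
      refine (add_le_add_left ih _).trans ?_
      have := hstep (N * (k + 1))
      rwa [show N * (k + 1) + (k + 1) = (N + 1) * (k + 1) by ring] at this
  refine ⟨C * (2 * k + 3) ^ (c + 1), fun n => ?_⟩
  have h1 : (n + 1 : ℕ) * g n ≤ (C * (2 * (n + 1) * (k + 1) + 1) ^ (c + 1) : ℕ) := by
    refine le_trans ?_ ((hsum (2 * (n + 1))).trans (h _))
    rw [two_mul, Finset.sum_range_add]
    refine le_trans ?_ le_add_self
    rw [← nsmul_eq_mul]
    conv_lhs => rw [← Finset.card_range (n + 1)]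
    refine Finset.card_nsmul_le_sum _ _ _ fun j _ => hgm ?_
    nlinarith
  have hfin : g n ≠ ⊤ := ne_top_of_le_ne_top (ENat.natCast_ne_top _)
    (le_trans (length_quotient_anti (sup_le_sup_right le_sup_left _)) (h n))
  change g n ≤ _
  lift g n to ℕ using hfin with G hG
  norm_cast at h1 ⊢
  have h2 : (2 * (n + 1) * (k + 1) + 1) ^ (c + 1) ≤ ((2 * k + 3) * (n + 1)) ^ (c + 1) :=
    Nat.pow_le_pow_left (by nlinarith) _
  rw [mul_pow, pow_succ (n + 1)] at h2
  refine Nat.le_of_mul_le_mul_left (h1.trans ((Nat.mul_le_mul_left C h2).trans (le_of_eq ?_)))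
    (Nat.succ_pos n)
  ring

theorem growth_zero [IsNoetherianRing R] [IsLocalRing R] {Q p : Ideal R} [p.IsPrime]
    (hQ : Q ≤ maximalIdeal R) {N : ℕ} (hN : maximalIdeal R ^ N ≤ Q) {C : ℕ}
    (h : ∀ n, Module.length R (R ⧸ (p ⊔ Q ^ n)) ≤ C) : p = maximalIdeal R := by
  obtain ⟨n, hn⟩ : ∃ n, Q ^ n ≤ p ⊔ Q ^ (n + 1) := by
    by_contra! hc
    have h1 : ∀ n : ℕ, (n : ℕ∞) ≤ Module.length R (R ⧸ (p ⊔ Q ^ n)) := by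
      intro n
      induction n with
      | zero => simp
      | succ n ih =>
        rw [length_quotient_eq_add (sup_le_sup_left (Ideal.pow_le_pow_right (Nat.le_succ n)) p :
          p ⊔ Q ^ (n + 1) ≤ p ⊔ Q ^ n),
          Nat.add_comm n 1, Nat.cast_add, Nat.cast_one]
        refine add_le_add ?_ ih
        rw [Order.one_le_iff_ne_zero, Ne, relLength_eq_zero_iff]
        exact fun hle => hc n (le_sup_right.trans ((Nat.add_comm 1 n) ▸ hle))
    have := (h1 (C + 1)).trans (h _)
    norm_cast at this
    omega
  have h2 : Q ^ n ≤ p := by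
    refine Submodule.le_of_le_smul_of_le_jacobson_bot (I := Q) (IsNoetherian.noetherian (Q ^ n))
      ?_ (hn.trans (sup_le_sup_left (le_of_eq ?_) p))
    · exact hQ.trans (IsLocalRing.maximalIdeal_le_jacobson _)
    · rw [pow_succ', smul_eq_mul]
  have h3 : maximalIdeal R ≤ p := by
    rcases Nat.eq_zero_or_pos n with rfl | hn0
    · rw [pow_zero, Ideal.one_eq_top, top_le_iff] at h2
      exact absurd h2 (Ideal.IsPrime.ne_top ‹_›)
    · exact Ideal.IsPrime.le_of_pow_le (hN.trans (Ideal.IsPrime.le_of_pow_le h2))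
  exact le_antisymm (IsLocalRing.le_maximalIdeal (Ideal.IsPrime.ne_top ‹_›)) h3

/-- A bound on the growth of the Hilbert function of `R ⧸ p` bounds its dimension. -/
theorem coheight_le_of_growth [IsNoetherianRing R] [IsLocalRing R] {Q : Ideal R}
    (hQ : Q ≤ maximalIdeal R) {N : ℕ} (hN : maximalIdeal R ^ N ≤ Q) (c : ℕ) :
    ∀ (p : PrimeSpectrum R) (C : ℕ),
      (∀ n, Module.length R (R ⧸ (p.asIdeal ⊔ Q ^ n)) ≤ (C * (n + 1) ^ c : ℕ)) →
      Order.coheight p ≤ c := by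
  induction c with
  | zero =>
    intro p C h
    have hp := growth_zero hQ hN (p := p.asIdeal) (C := C) (by simpa using h)
    rw [Order.coheight_le_coe_iff]
    intro q hq
    exfalso
    have : q.asIdeal ≤ p.asIdeal := hp ▸ IsLocalRing.le_maximalIdeal q.2.ne_top
    exact absurd hq (not_lt_of_ge this)
  | succ c ih =>
    intro p C h
    rw [Order.coheight_le_coe_iff]
    intro q hq
    obtain ⟨x, hxq, hxp⟩ := Set.exists_of_ssubset (show (p.asIdeal : Set R) ⊂ q.asIdeal from hq)
    obtain ⟨C', hC'⟩ := growth_drop Q p.asIdeal hxp h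
    refine lt_of_le_of_lt (ih q C' fun n => le_trans (length_quotient_anti ?_) (hC' n)) ?_
    · refine sup_le_sup_right (sup_le hq.le ?_) _
      rwa [Ideal.span_le, Set.singleton_subset_iff]
    · exact_mod_cast Nat.lt_succ_self c

end NormalChern

namespace NormalChern

open Module IsLocalRing MvPolynomial

theorem relLength_double_chain {R M : Type*} [CommRing R] [AddCommGroup M] [Module R M]
    (F : ℕ → ℕ → Submodule R M) (l : ℕ) (hF : ∀ j, Antitone (F j))
    (hl : ∀ j, F j l = F (j + 1) 0) (n : ℕ) :
    relLength (F n 0) (F 0 0) =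
      ∑ j ∈ Finset.range n, ∑ i ∈ Finset.range l, relLength (F j (i + 1)) (F j i) := by
  have h : Antitone fun j => F j 0 := antitone_nat_of_succ_le fun j => by
    rw [← hl]
    exact hF j (Nat.zero_le l)
  rw [relLength_chain _ h]
  refine Finset.sum_congr rfl fun j _ => ?_
  rw [← hl, relLength_chain _ (hF j)]

theorem formDim_le (c n : ℕ) : formDim c n ≤ (c + 1) ^ c * (n + 1) ^ c := by
  rw [← mul_pow]
  refine (Nat.choose_le_pow _ _).trans (Nat.pow_le_pow_left ?_ c)
  nlinarith

theorem pow_le_formDim (c n : ℕ) : (n + 1) ^ c ≤ c.factorial * formDim c n := by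
  have h := Nat.pow_le_choose (α := ℚ) c (n + c)
  rw [show n + c + 1 - c = n + 1 by omega, div_le_iff₀ (by positivity)] at h
  rw [formDim, mul_comm]
  exact_mod_cast h

/-- The number of monomials of degree less than `n` in `c + 1` variables. -/
def formSum (c n : ℕ) : ℕ := ∑ j ∈ Finset.range n, formDim c j

theorem formSum_eq (c n : ℕ) : formSum c n = (n + c).choose (c + 1) := by
  induction n with
  | zero => simp [formSum]
  | succ n ih =>
    rw [formSum, Finset.sum_range_succ, ← formSum, ih, formDim, show n + 1 + c = n + c + 1 by ring,
      Nat.choose_succ_succ, add_comm]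

theorem formSum_le_add (c n s : ℕ) : formSum c n ≤ formSum c (n - s) + s * formDim c n := by
  rcases le_total s n with h | h
  · obtain ⟨m, rfl⟩ := Nat.exists_eq_add_of_le' h
    rw [Nat.add_sub_cancel, formSum, Finset.sum_range_add, ← formSum]
    gcongr
    have h := Finset.sum_le_card_nsmul (Finset.range s) (fun j => formDim c (m + j))
      (formDim c (m + s)) fun j hj => formDim_mono c (by have := Finset.mem_range.1 hj; omega)
    simpa using h
  · refine le_trans ?_ le_add_self
    refine le_trans ?_ (Nat.mul_le_mul_right _ h)
    have h := Finset.sum_le_card_nsmul (Finset.range n) (fun j => formDim c j)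
      (formDim c n) fun j hj => formDim_mono c (Finset.mem_range.1 hj).le
    simpa [formSum] using h

variable {R : Type*} [CommRing R] [IsLocalRing R] {c : ℕ}

/-- A filtration from the whole ring down to `Q` with simple or zero steps. -/
structure SimpleChain (Q : Ideal R) where
  /-- The number of steps. -/
  len : ℕ
  /-- The ideals of the filtration. -/
  I : ℕ → Ideal R
  /-- Generators of the steps. -/
  r : ℕ → R
  zero : I 0 = ⊤
  last : ∀ i, len ≤ i → I i = Q
  step : ∀ i, I i = Ideal.span {r i} ⊔ I (i + 1)
  mul_le : ∀ i, maximalIdeal R * I i ≤ I (i + 1)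

theorem exists_simpleChain [IsNoetherianRing R] {Q : Ideal R} {N : ℕ}
    (hN : maximalIdeal R ^ N ≤ Q) : Nonempty (SimpleChain Q) := by
  suffices h : ∀ J : Ideal R, Q ≤ J → Nonempty (SimpleChain J) from h Q le_rfl
  intro J
  induction J using IsNoetherian.induction (R := R) (M := R) with
  | hgt J ih =>
  intro hJ
  by_cases hJt : J = ⊤
  · subst hJt
    exact ⟨⟨0, fun _ => ⊤, fun _ => 0, rfl, fun _ _ => rfl, by simp, fun _ => le_top⟩⟩
  obtain ⟨n, hn1, hn2⟩ : ∃ n, ¬ maximalIdeal R ^ n ≤ J ∧ maximalIdeal R ^ (n + 1) ≤ J := by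
    by_contra! hc
    have : ∀ n, ¬ maximalIdeal R ^ n ≤ J := by
      intro n
      induction n with
      | zero => rwa [pow_zero, Ideal.one_eq_top, top_le_iff]
      | succ n ih => exact hc n ih
    exact this N (hN.trans hJ)
  obtain ⟨r, hr, hrJ⟩ := SetLike.not_le_iff_exists.1 hn1
  have hmr : maximalIdeal R * Ideal.span {r} ≤ J := by
    refine le_trans (Ideal.mul_mono_right ?_) (by rwa [pow_succ'] at hn2)
    rwa [Ideal.span_le, Set.singleton_subset_iff]
  obtain ⟨S⟩ := ih (Ideal.span {r} ⊔ J) (by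
    refine lt_of_le_of_ne le_sup_right fun h => hrJ ?_
    rw [h]
    exact Ideal.mem_sup_left (Ideal.mem_span_singleton_self r)) (hJ.trans le_sup_right)
  refine ⟨⟨S.len + 1, fun i => if i ≤ S.len then S.I i else J,
    fun i => if i < S.len then S.r i else if i = S.len then r else 0, ?_, ?_, ?_, ?_⟩⟩
  · simp [S.zero]
  · intro i hi
    rw [if_neg (by omega)]
  · intro i
    rcases lt_trichotomy i S.len with h | h | h
    · rw [if_pos h.le, if_pos h, if_pos (by omega)]
      exact S.step i
    · subst h
      rw [if_pos le_rfl, if_neg (lt_irrefl _), if_pos rfl, if_neg (by omega), S.last _ le_rfl]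
    · rw [if_neg (by omega), if_neg (by omega), if_neg (by omega), if_neg (by omega)]
      simp
  · intro i
    rcases lt_trichotomy i S.len with h | h | h
    · rw [if_pos h.le, if_pos (by omega)]
      exact S.mul_le i
    · subst h
      rw [if_pos le_rfl, if_neg (by omega), S.last _ le_rfl, Ideal.mul_sup]
      exact sup_le hmr Ideal.mul_le_right
    · rw [if_neg (by omega), if_neg (by omega)]
      exact Ideal.mul_le_right

namespace SimpleChain

variable {Q : Ideal R} (S : SimpleChain Q)

theorem antitone : Antitone S.I := antitone_nat_of_succ_le fun i => by
  rw [S.step i]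
  exact le_sup_right

theorem r_mem (i : ℕ) : S.r i ∈ S.I i := by
  rw [S.step i]
  exact Ideal.mem_sup_left (Ideal.mem_span_singleton_self _)

theorem r_mul_mem {i n : ℕ} {y : R} (hy : y ∈ maximalIdeal R * Q ^ n) :
    S.r i * y ∈ S.I (i + 1) * Q ^ n := by
  have h : Ideal.span {S.r i} * (maximalIdeal R * Q ^ n) ≤ S.I (i + 1) * Q ^ n := by
    rw [← mul_assoc, mul_comm (Ideal.span _)]
    refine Ideal.mul_mono_left ((Ideal.mul_mono_right ?_).trans (S.mul_le i))
    rw [Ideal.span_le, Set.singleton_subset_iff]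
    exact S.r_mem i
  exact h (Ideal.mul_mem_mul (Ideal.mem_span_singleton_self _) hy)

end SimpleChain

/-- A form of degree `s` over `R` with nonzero reduction modulo the maximal ideal. -/
def IsUnitForm (s : ℕ) (g : MvPolynomial (Fin (c + 1)) R) : Prop :=
  g.IsHomogeneous s ∧ map (residue R) g ≠ 0

theorem IsUnitForm.mul {s t : ℕ} {g h : MvPolynomial (Fin (c + 1)) R} (hg : IsUnitForm s g)
    (hh : IsUnitForm t h) : IsUnitForm (s + t) (g * h) :=
  ⟨hg.1.mul hh.1, by rw [map_mul]; exact mul_ne_zero hg.2 hh.2⟩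

theorem isUnitForm_one : IsUnitForm 0 (1 : MvPolynomial (Fin (c + 1)) R) :=
  ⟨isHomogeneous_one _ _, by rw [map_one]; exact one_ne_zero⟩

variable (x : Fin (c + 1) → R)

omit [IsLocalRing R] in
theorem eval_mem_pow {s : ℕ} {g : MvPolynomial (Fin (c + 1)) R} (hg : g.IsHomogeneous s) :
    eval x g ∈ Ideal.span (Set.range x) ^ s :=
  (Ideal.mem_span_pow_iff_exists_isHomogeneous x _).2 ⟨g, hg, rfl⟩

theorem sum_le_of_step_le {t : ℕ → ℕ∞} {s : ℕ}
    (h1 : ∀ j, t j ≤ formDim c j) (h2 : ∀ j, t (s + j) + formDim c j ≤ formDim c (s + j)) (n : ℕ) :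
    ∑ j ∈ Finset.range n, t j ≤ (s * formDim c n : ℕ) := by
  have h3 : ∑ j ∈ Finset.range n, t j + formSum c (n - s) ≤ formSum c n := by
    rcases le_total s n with h | h
    · obtain ⟨m, rfl⟩ := Nat.exists_eq_add_of_le h
      rw [Nat.add_sub_cancel_left, formSum, formSum, Finset.sum_range_add, Finset.sum_range_add]
      push_cast
      rw [add_assoc, ← Finset.sum_add_distrib]
      exact add_le_add (Finset.sum_le_sum fun j _ => h1 j) (Finset.sum_le_sum fun j _ => h2 j)
    · rw [Nat.sub_eq_zero_of_le h]
      simpa [formSum] using Finset.sum_le_sum fun j _ => h1 j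
  have h4 : ((formSum c n : ℕ) : ℕ∞) ≤ (formSum c (n - s) + s * formDim c n : ℕ) :=
    mod_cast formSum_le_add c n s
  have h5 := h3.trans h4
  rw [Nat.cast_add, add_comm] at h5
  exact (ENat.add_le_add_iff_left (ENat.natCast_ne_top _)).1 h5

theorem relLength_step_le (r : R) (W : Ideal R) (j : ℕ)
    (h : ∀ y ∈ maximalIdeal R * Ideal.span (Set.range x) ^ j, r * y ∈ W) :
    relLength W (Ideal.span {r} * Ideal.span (Set.range x) ^ j) ≤ formDim c j := by
  refine le_trans le_self_add (relLength_le_formDim x r W j ⊥ fun p hp h0 => h _ ?_)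
  exact eval_mem_of_map_residue_eq_zero x hp (by simpa using h0)

theorem relLength_step_le_of_form (r : R) (W : Ideal R) (s j : ℕ)
    (h : ∀ y ∈ maximalIdeal R * Ideal.span (Set.range x) ^ (s + j), r * y ∈ W)
    {g : MvPolynomial (Fin (c + 1)) R} (hg : IsUnitForm s g)
    (hW : ∀ y ∈ Ideal.span (Set.range x) ^ j, r * (eval x g * y) ∈ W) :
    relLength W (Ideal.span {r} * Ideal.span (Set.range x) ^ (s + j)) + formDim c j ≤
      formDim c (s + j) := by
  have hgh := isHomogeneous_map hg.1
  rw [← finrank_multiples hgh hg.2 j]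
  refine relLength_le_formDim x r W (s + j) _ fun p hp hK => ?_
  have hK' : map (residue R) p ∈ multiples (map (residue R) g) (s + j) :=
    ⟨hK, isHomogeneous_map hp⟩
  obtain ⟨⟨q, hq⟩, -⟩ := mem_multiples.1 hK'
  have hq' : map (residue R) p = map (residue R) g * homogeneousComponent j q := by
    rw [← homogeneousComponent_mul_of_isHomogeneous hgh, ← hq,
      homogeneousComponent_of_mem (isHomogeneous_map hp), if_pos rfl]
  obtain ⟨u, hu, huq⟩ := isHomogeneous_map_lift (R := R) (homogeneousComponent_isHomogeneous j q)
  have h1 : eval x (p - g * u) ∈ maximalIdeal R * Ideal.span (Set.range x) ^ (s + j) := by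
    refine eval_mem_of_map_residue_eq_zero x (hp.sub (hg.1.mul hu)) ?_
    rw [map_sub, map_mul, huq, hq', sub_self]
  have h2 := W.add_mem (h _ h1) (hW _ (eval_mem_pow x hu))
  rw [← map_mul, ← mul_add, ← map_add, sub_add_cancel] at h2
  exact h2

theorem growth_of_eval_mem {N : ℕ} [IsNoetherianRing R]
    (hN : maximalIdeal R ^ N ≤ Ideal.span (Set.range x)) (a : Ideal R) {s : ℕ}
    {g : MvPolynomial (Fin (c + 1)) R} (hg : IsUnitForm s g)
    (h : eval x g ∈ maximalIdeal R * Ideal.span (Set.range x) ^ s ⊔ a) :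
    ∃ C : ℕ, ∀ n, Module.length R (R ⧸ (a ⊔ Ideal.span (Set.range x) ^ n)) ≤
      (C * (n + 1) ^ c : ℕ) := by
  obtain ⟨S⟩ := exists_simpleChain hN
  set Q := Ideal.span (Set.range x) with hQ
  refine ⟨S.len * (s * (c + 1) ^ c), fun n => ?_⟩
  have h1 := relLength_double_chain (fun j i => a ⊔ S.I i * Q ^ j) S.len
    (fun j i i' hi => sup_le_sup_left (Ideal.mul_mono_left (S.antitone hi)) _)
    (fun j => by simp only [S.last _ le_rfl, S.zero, pow_succ', Ideal.top_mul]) n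
  simp only [S.zero, Ideal.top_mul, pow_zero, Ideal.one_eq_top, sup_top_eq, relLength_top] at h1
  rw [h1, Finset.sum_comm]
  have h2 : ∀ i ∈ Finset.range S.len, ∑ j ∈ Finset.range n,
      relLength (a ⊔ S.I (i + 1) * Q ^ j) (a ⊔ S.I i * Q ^ j) ≤ (s * formDim c n : ℕ) := by
    intro i _
    have h3 : ∀ j, relLength (a ⊔ S.I (i + 1) * Q ^ j) (a ⊔ S.I i * Q ^ j) =
        relLength (a ⊔ S.I (i + 1) * Q ^ j) (Ideal.span {S.r i} * Q ^ j) := by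
      intro j
      rw [← relLength_sup_left _ (Ideal.span {S.r i} * Q ^ j), S.step i, Ideal.sup_mul]
      congr 1
      ac_rfl
    have h5 : ∀ j, ∀ y ∈ maximalIdeal R * Q ^ j, S.r i * y ∈ a ⊔ S.I (i + 1) * Q ^ j :=
      fun j y hy => Ideal.mem_sup_right (S.r_mul_mem hy)
    refine sum_le_of_step_le (fun j => ?_) (fun j => ?_) n
    · rw [h3]
      exact relLength_step_le x _ _ _ (h5 j)
    · rw [h3]
      refine relLength_step_le_of_form x _ _ s j (h5 _) hg fun y hy => ?_
      have h4 : eval x g * y ∈ maximalIdeal R * Q ^ (s + j) ⊔ a := by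
        have := Ideal.mul_mem_mul h hy
        rw [Ideal.sup_mul, mul_assoc, ← pow_add] at this
        have hle : a * Q ^ j ≤ a := Ideal.mul_le_left
        exact (sup_le_sup_left hle (maximalIdeal R * Q ^ (s + j))) this
      obtain ⟨u, hu, v, hv, huv⟩ := Submodule.mem_sup.1 h4
      rw [← huv, mul_add]
      exact add_mem (h5 _ u hu) (Ideal.mem_sup_left (a.mul_mem_left _ hv))
  refine (Finset.sum_le_sum h2).trans ?_
  rw [Finset.sum_const, Finset.card_range, nsmul_eq_mul]
  norm_cast
  rw [mul_assoc, mul_assoc]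
  exact Nat.mul_le_mul_left _ (Nat.mul_le_mul_left _ (formDim_le c n))

/-- Every associated prime has the maximal possible order of growth. -/
def MaxGrowth : Prop := ∀ p ∈ associatedPrimes R R, ∀ C : ℕ, ∃ n : ℕ,
  ((C * (n + 1) ^ c : ℕ) : ℕ∞) <
    Module.length R (R ⧸ (p ⊔ Ideal.span (Set.range x) ^ n))

variable {x}

theorem MaxGrowth.eval_notMem [IsNoetherianRing R] (hx : MaxGrowth x) {N : ℕ}
    (hN : maximalIdeal R ^ N ≤ Ideal.span (Set.range x)) {p : Ideal R}
    (hp : p ∈ associatedPrimes R R) {s : ℕ}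
    {g : MvPolynomial (Fin (c + 1)) R} (hg : IsUnitForm s g) :
    eval x g ∉ maximalIdeal R * Ideal.span (Set.range x) ^ s ⊔ p := fun h => by
  obtain ⟨C, hC⟩ := growth_of_eval_mem x hN p hg h
  obtain ⟨n, hn⟩ := hx p hp C
  exact absurd (hC n) (not_le.2 hn)

theorem MaxGrowth.eq_zero_of_mul_eq_zero [IsNoetherianRing R] (hx : MaxGrowth x) {N : ℕ}
    (hN : maximalIdeal R ^ N ≤ Ideal.span (Set.range x)) {s : ℕ}
    {g : MvPolynomial (Fin (c + 1)) R} (hg : IsUnitForm s g) {y : R} (h : eval x g * y = 0) :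
    y = 0 := by
  by_contra hy
  obtain ⟨p, hp, hle⟩ := exists_le_isAssociatedPrime_of_isNoetherianRing R y hy
  refine hx.eval_notMem hN hp hg (Ideal.mem_sup_right (hle ?_))
  rw [Submodule.mem_colon_singleton]
  simpa using h

theorem MaxGrowth.map_residue_eq_zero [IsNoetherianRing R] (hx : MaxGrowth x) {N : ℕ}
    (hN : maximalIdeal R ^ N ≤ Ideal.span (Set.range x)) {s : ℕ}
    {g : MvPolynomial (Fin (c + 1)) R} (hg : g.IsHomogeneous s)
    (h : eval x g ∈ maximalIdeal R * Ideal.span (Set.range x) ^ s) : map (residue R) g = 0 := by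
  by_contra h0
  obtain ⟨p, hp⟩ := associatedPrimes.nonempty R R
  exact hx.eval_notMem hN hp ⟨hg, h0⟩ (Ideal.mem_sup_left h)

end NormalChern

namespace NormalChern

open Module IsLocalRing MvPolynomial

theorem formDim_le_relLength' {R : Type*} [CommRing R] [IsLocalRing R] {c : ℕ}
    (x : Fin (c + 1) → R) {r : R} {W : Ideal R} {m : ℕ}
    (h : ∀ p : MvPolynomial (Fin (c + 1)) R, p.IsHomogeneous m → r * eval x p ∈ W →
      map (residue R) p = 0) :
    (formDim c m : ℕ∞) ≤ relLength W (Ideal.span {r} * Ideal.span (Set.range x) ^ m) := by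
  have h1 := formDim_le_relLength x r W m ⊥ fun p hp hW => (Submodule.mem_bot _).2 (h p hp hW)
  have h2 : (⊥ ⊓ homogeneousSubmodule (Fin (c + 1)) (ResidueField R) m :
    Submodule (ResidueField R) _) = ⊥ := bot_inf_eq _
  rwa [h2, finrank_bot, Nat.cast_zero, add_zero] at h1

section Saturation

variable {R : Type*} [CommRing R] [IsLocalRing R] {c : ℕ} {x : Fin (c + 1) → R}
  (S : SimpleChain (Ideal.span (Set.range x)))

/-- The elements whose product with a unit form of some degree `s` lies in `I i * Q ^ (n + s)`. -/
def satFil (n i : ℕ) : Ideal R where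
  carrier := {y | ∃ s g, IsUnitForm (c := c) s g ∧
    eval x g * y ∈ S.I i * Ideal.span (Set.range x) ^ (n + s)}
  zero_mem' := ⟨0, 1, isUnitForm_one, by simp⟩
  add_mem' := by
    rintro y z ⟨s, g, hg, hy⟩ ⟨t, h, hh, hz⟩
    refine ⟨s + t, g * h, hg.mul hh, ?_⟩
    have h1 := Ideal.mul_mem_mul hy (eval_mem_pow x hh.1)
    have h2 := Ideal.mul_mem_mul hz (eval_mem_pow x hg.1)
    rw [mul_assoc, ← pow_add, add_assoc] at h1
    rw [mul_assoc, ← pow_add, add_assoc, add_comm t] at h2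
    convert add_mem h1 h2 using 1
    rw [map_mul]
    ring
  smul_mem' := by
    rintro a y ⟨s, g, hg, hy⟩
    refine ⟨s, g, hg, ?_⟩
    rw [smul_eq_mul, mul_left_comm]
    exact Ideal.mul_mem_left _ _ hy

variable {S}

theorem mem_satFil {n i : ℕ} {y : R} : y ∈ satFil S n i ↔ ∃ s g, IsUnitForm (c := c) s g ∧
    eval x g * y ∈ S.I i * Ideal.span (Set.range x) ^ (n + s) := Iff.rfl

theorem le_satFil (n i : ℕ) : S.I i * Ideal.span (Set.range x) ^ n ≤ satFil S n i :=
  fun y hy => ⟨0, 1, isUnitForm_one, by simpa using hy⟩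

theorem satFil_antitone_right (n : ℕ) : Antitone (satFil S n) := by
  rintro i j hij y ⟨s, g, hg, hy⟩
  exact ⟨s, g, hg, Ideal.mul_mono_left (S.antitone hij) hy⟩

theorem satFil_last (n : ℕ) : satFil S n S.len = satFil S (n + 1) 0 := by
  ext y
  simp only [mem_satFil, S.last _ le_rfl, S.zero, ← pow_succ', Ideal.top_mul, add_right_comm]

theorem satFil_zero_zero : satFil S 0 0 = ⊤ := by
  rw [eq_top_iff]
  refine le_trans ?_ (le_satFil 0 0)
  simp [S.zero]

theorem mul_mem_satFil {n i m : ℕ} {y z : R} (hy : y ∈ satFil S n i)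
    (hz : z ∈ Ideal.span (Set.range x) ^ m) : z * y ∈ satFil S (n + m) i := by
  obtain ⟨s, g, hg, hy⟩ := hy
  refine ⟨s, g, hg, ?_⟩
  have h1 := Ideal.mul_mem_mul hy hz
  rw [mul_assoc, ← pow_add, add_right_comm] at h1
  convert h1 using 1
  ring

theorem mem_satFil_of_mul {n i s : ℕ} {g : MvPolynomial (Fin (c + 1)) R} (hg : IsUnitForm s g)
    {y : R} (h : eval x g * y ∈ satFil S (n + s) i) : y ∈ satFil S n i := by
  obtain ⟨t, h, hh, hy⟩ := h
  refine ⟨s + t, g * h, hg.mul hh, ?_⟩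
  rw [← add_assoc]
  convert hy using 1
  rw [map_mul]
  ring

theorem r_mul_mem_satFil (i : ℕ) {n : ℕ} {y : R} (hy : y ∈ Ideal.span (Set.range x) ^ n) :
    S.r i * y ∈ satFil S n i :=
  le_satFil n i (Ideal.mul_mem_mul (S.r_mem i) hy)

variable (S) in
/-- The steps that survive in the saturated filtration. -/
def IsGood (i : ℕ) : Prop := S.r i ∉ satFil S 0 (i + 1)

theorem IsGood.map_residue_eq_zero {i : ℕ} (hi : IsGood S i) {n : ℕ}
    {p : MvPolynomial (Fin (c + 1)) R} (hp : p.IsHomogeneous n)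
    (h : S.r i * eval x p ∈ satFil S n (i + 1)) : map (residue R) p = 0 := by
  by_contra h0
  refine hi (mem_satFil_of_mul (n := 0) ⟨hp, h0⟩ ?_)
  rwa [zero_add, mul_comm]

theorem r_mul_eval_mem_satFil (i : ℕ) {n : ℕ}
    {p : MvPolynomial (Fin (c + 1)) R} (hp : p.IsHomogeneous n) (h : map (residue R) p = 0) :
    S.r i * eval x p ∈ satFil S n (i + 1) :=
  le_satFil _ _ (S.r_mul_mem (eval_mem_of_map_residue_eq_zero x hp h))

/-- Every element of a filtration step is generically a form times the generator. -/
theorem exists_unitForm_mul_sub_mem {n i : ℕ} {y : R} (hy : y ∈ satFil S n i) :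
    ∃ s f p, IsUnitForm (c := c) s f ∧ p.IsHomogeneous (n + s) ∧
      eval x f * y - S.r i * eval x p ∈ S.I (i + 1) * Ideal.span (Set.range x) ^ (n + s) := by
  obtain ⟨s, f, hf, hy⟩ := hy
  rw [S.step i, Ideal.sup_mul] at hy
  obtain ⟨u, hu, v, hv, huv⟩ := Submodule.mem_sup.1 hy
  obtain ⟨w, hw, rfl⟩ := Ideal.mem_span_singleton_mul.1 hu
  obtain ⟨p, hp, rfl⟩ := (Ideal.mem_span_pow_iff_exists_isHomogeneous x _).1 hw
  refine ⟨s, f, p, hf, hp, ?_⟩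
  rwa [← huv, add_sub_cancel_left]

theorem satFil_succ_of_not_isGood {i : ℕ} (hi : ¬ IsGood S i) (n : ℕ) :
    satFil S n (i + 1) = satFil S n i := by
  refine le_antisymm (satFil_antitone_right n (Nat.le_succ i)) fun y hy => ?_
  obtain ⟨s, f, p, hf, hp, h⟩ := exists_unitForm_mul_sub_mem hy
  refine mem_satFil_of_mul hf ?_
  rw [← sub_add_cancel (eval x f * y) (S.r i * eval x p)]
  refine add_mem (le_satFil _ _ h) ?_
  have := mul_mem_satFil (not_not.1 hi) (eval_mem_pow x hp)
  rwa [zero_add, mul_comm] at this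

variable (S) in
/-- The defect of the saturated filtration at a step. -/
noncomputable def defect (j i : ℕ) : ℕ∞ :=
  relLength (Ideal.span {S.r i} * Ideal.span (Set.range x) ^ j ⊔ satFil S j (i + 1)) (satFil S j i)

theorem IsGood.formDim_add_defect_le {i : ℕ} (hi : IsGood S i) (j : ℕ) :
    formDim c j + defect S j i ≤ relLength (satFil S j (i + 1)) (satFil S j i) := by
  have h1 : Ideal.span {S.r i} * Ideal.span (Set.range x) ^ j ≤ satFil S j i := by
    intro y hy
    obtain ⟨z, hz, rfl⟩ := Ideal.mem_span_singleton_mul.1 hy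
    exact r_mul_mem_satFil i hz
  rw [relLength_add (J := Ideal.span {S.r i} * Ideal.span (Set.range x) ^ j ⊔ satFil S j (i + 1))
    le_sup_right (sup_le h1 (satFil_antitone_right j (Nat.le_succ i))), relLength_sup_left]
  refine add_le_add ?_ le_rfl
  exact formDim_le_relLength' x fun p hp h => hi.map_residue_eq_zero hp h

open Classical in
variable (S) in
/-- The set of surviving steps. -/
noncomputable def goodSteps : Finset ℕ := {i ∈ Finset.range S.len | IsGood S i}

open Classical in
theorem mem_goodSteps {i : ℕ} : i ∈ goodSteps S ↔ i < S.len ∧ IsGood S i := by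
  simp [goodSteps]

theorem length_quotient_satFil_ge (n : ℕ) :
    ((goodSteps S).card * formSum c n : ℕ) +
      ∑ j ∈ Finset.range n, ∑ i ∈ goodSteps S, defect S j i ≤
      Module.length R (R ⧸ satFil S n 0) := by
  classical
  have h1 := relLength_double_chain (satFil S) S.len satFil_antitone_right satFil_last n
  rw [satFil_zero_zero, relLength_top] at h1
  have h2 : (((goodSteps S).card * formSum c n : ℕ) : ℕ∞) =
      ∑ j ∈ Finset.range n, ∑ i ∈ goodSteps S, (formDim c j : ℕ∞) := by
    simp [formSum, Finset.mul_sum]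
  rw [h1, h2, ← Finset.sum_add_distrib]
  refine Finset.sum_le_sum fun j _ => ?_
  rw [← Finset.sum_add_distrib]
  refine (Finset.sum_le_sum fun i hi => (mem_goodSteps.1 hi).2.formDim_add_defect_le j).trans ?_
  exact Finset.sum_le_sum_of_subset (Finset.filter_subset _ _)

variable (S) in
theorem exists_length_quotient_pow_le : ∃ C : ℕ, ∀ n,
    Module.length R (R ⧸ Ideal.span (Set.range x) ^ n) ≤
      ((goodSteps S).card * formSum c n + C * (n + 1) ^ c : ℕ) := by
  classical
  have hb : ∀ i, ∃ C : ℕ, ¬ IsGood S i → ∀ n, ∑ j ∈ Finset.range n,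
      relLength (S.I (i + 1) * Ideal.span (Set.range x) ^ j) (S.I i * Ideal.span (Set.range x) ^ j) ≤ (C * (n + 1) ^ c : ℕ) := by
    intro i
    by_cases hi : IsGood S i
    · exact ⟨0, fun h => absurd hi h⟩
    obtain ⟨s, g, hg, h⟩ := not_not.1 hi
    refine ⟨s * (c + 1) ^ c, fun _ n => ?_⟩
    refine (sum_le_of_step_le (fun j => ?_) (fun j => ?_) n).trans (b := ((s * formDim c n : ℕ) : ℕ∞))
      (by rw [mul_assoc]; exact_mod_cast Nat.mul_le_mul_left _ (formDim_le c n))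
    · rw [S.step i, Ideal.sup_mul, relLength_sup_left]
      exact relLength_step_le x _ _ _ fun y hy => S.r_mul_mem hy
    · rw [S.step i, Ideal.sup_mul, relLength_sup_left]
      refine relLength_step_le_of_form x _ _ s j (fun y hy => S.r_mul_mem hy) hg fun y hy => ?_
      have := Ideal.mul_mem_mul h hy
      rw [mul_assoc, ← pow_add, zero_add] at this
      convert this using 1
      ring
  choose C hC using hb
  refine ⟨∑ i ∈ Finset.range S.len, C i, fun n => ?_⟩
  have h1 := relLength_double_chain (fun j i => S.I i * Ideal.span (Set.range x) ^ j) S.len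
    (fun j i i' hi => Ideal.mul_mono_left (S.antitone hi))
    (fun j => by simp only [S.last _ le_rfl, S.zero, pow_succ', Ideal.top_mul]) n
  simp only [S.zero, Ideal.top_mul, pow_zero, Ideal.one_eq_top, relLength_top] at h1
  rw [h1, Finset.sum_comm, ← Finset.sum_filter_add_sum_filter_not _ (IsGood S), Nat.cast_add]
  refine add_le_add ?_ ?_
  · refine (Finset.sum_le_sum (g := fun _ => ((formSum c n : ℕ) : ℕ∞)) fun i _ => ?_).trans ?_
    · rw [formSum, Nat.cast_sum]
      refine Finset.sum_le_sum fun j _ => ?_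
      rw [S.step i, Ideal.sup_mul, relLength_sup_left]
      exact relLength_step_le x _ _ _ fun y hy => S.r_mul_mem hy
    · simp [goodSteps]
  · refine (Finset.sum_le_sum fun i hi => hC i (Finset.mem_filter.1 hi).2 n).trans ?_
    rw [Finset.sum_mul, ← Nat.cast_sum]
    exact_mod_cast Finset.sum_le_sum_of_subset (Finset.filter_subset _ _)

variable (S) in
theorem exists_defect_le : ∃ C : ℕ, ∀ n,
    ∑ j ∈ Finset.range n, ∑ i ∈ goodSteps S, defect S j i +
      relLength (Ideal.span (Set.range x) ^ n) (satFil S n 0) ≤ (C * (n + 1) ^ c : ℕ) := by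
  obtain ⟨C, hC⟩ := exists_length_quotient_pow_le S
  refine ⟨C, fun n => ?_⟩
  have h1 := hC n
  have h2 : Ideal.span (Set.range x) ^ n ≤ satFil S n 0 := by
    simpa [S.zero] using le_satFil (S := S) n 0
  rw [length_quotient_eq_add h2] at h1
  have h3 := (add_le_add_right (length_quotient_satFil_ge (S := S) n)
    (relLength (Ideal.span (Set.range x) ^ n) (satFil S n 0))).trans h1
  rw [Nat.cast_add, add_left_comm] at h3
  rw [add_comm]
  exact (ENat.add_le_add_iff_left (ENat.natCast_ne_top _)).1 h3

omit [IsLocalRing R] in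
theorem MaxGrowth.eq_zero_of_relLength_le [IsNoetherianRing R] (hx : MaxGrowth x) {C : ℕ} {y : R}
    (h : ∀ n, relLength (Ideal.span (Set.range x) ^ n) (Ideal.span {y}) ≤
      (C * (n + 1) ^ c : ℕ)) : y = 0 := by
  by_contra hy
  obtain ⟨p, hp, hle⟩ := exists_le_isAssociatedPrime_of_isNoetherianRing R y hy
  set Q := Ideal.span (Set.range x)
  obtain ⟨k, hk⟩ := exists_artinRees Q ⊥ y
  obtain ⟨n, hn⟩ := hx p hp (C * (k + 1) ^ c)
  refine absurd ?_ (not_le.2 hn)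
  have h1 := h (n + k)
  rw [relLength_span_singleton] at h1
  refine le_trans (length_quotient_anti ?_) (h1.trans ?_)
  · intro z hz
    obtain ⟨w, hw, hzw⟩ := hk (n + k) z (by simpa using hz)
    rw [Nat.add_sub_cancel] at hw
    rw [← sub_add_cancel z w]
    refine add_mem (Ideal.mem_sup_left (hle ?_)) (Ideal.mem_sup_right hw)
    rw [Submodule.mem_colon_singleton, smul_eq_mul, mul_comm]
    exact hzw
  · rw [mul_assoc, ← mul_pow]
    exact_mod_cast Nat.mul_le_mul_left _ (Nat.pow_le_pow_left (by nlinarith) _)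

variable (S) in
theorem MaxGrowth.eq_zero_of_forall_mem_satFil [IsNoetherianRing R] (hx : MaxGrowth x) {y : R}
    (h : ∀ n, y ∈ satFil S n 0) : y = 0 := by
  obtain ⟨C, hC⟩ := exists_defect_le S
  refine hx.eq_zero_of_relLength_le (C := C) fun n => le_trans ?_ ((hC n).trans' le_add_self)
  exact relLength_mono_right _ ((Ideal.span_singleton_le_iff_mem _).2 (h n))

end Saturation

end NormalChern

namespace NormalChern

open Module IsLocalRing MvPolynomial

theorem exists_dvd_of_dvd_mul {A : Type*} [CommRing A] [IsDomain A]
    [UniqueFactorizationMonoid A] {f g : A} (hf : f ≠ 0) (h : ¬ f ∣ g) :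
    ∃ q, q ≠ 0 ∧ ¬ IsUnit q ∧ ∀ φ, f ∣ g * φ → q ∣ φ := by
  obtain ⟨f', g', d, hrel, rfl, rfl⟩ := UniqueFactorizationMonoid.exists_reduced_factors f hf g
  have hd : d ≠ 0 := left_ne_zero_of_mul hf
  refine ⟨f', right_ne_zero_of_mul hf, fun hu => h (mul_dvd_mul_left d hu.dvd), fun φ hφ => ?_⟩
  rw [mul_assoc] at hφ
  exact hrel.dvd_of_dvd_mul_left ((mul_dvd_mul_iff_left hd).1 hφ)

theorem dvd_of_isHomogeneous_fin_one {k : Type*} [Field k] {s m : ℕ}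
    {f g : MvPolynomial (Fin (0 + 1)) k} (hf : f.IsHomogeneous s) (hf0 : f ≠ 0)
    (hg : g.IsHomogeneous (s + m)) : f ∣ g := by
  have h1 : multiples f (s + m) ≤ homogeneousSubmodule (Fin (0 + 1)) k (s + m) :=
    fun y hy => (mem_multiples.1 hy).2
  have := homogeneousSubmodule_finite (k := k) (c := 0) (s + m)
  have h2 := Submodule.eq_of_le_of_finrank_eq h1 (by
    rw [finrank_multiples hf hf0, finrank_homogeneousSubmodule]
    simp [formDim])
  have h3 : g ∈ multiples f (s + m) := by rw [h2]; exact hg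
  exact (mem_multiples.1 h3).1

section Saturation

variable {R : Type*} [CommRing R] [IsLocalRing R] {c : ℕ} {x : Fin (c + 1) → R}
  {S : SimpleChain (Ideal.span (Set.range x))}

omit [IsLocalRing R] in
theorem mem_span_mul_pow_sup {r y : R} {m : ℕ} {W : Ideal R} :
    y ∈ Ideal.span {r} * Ideal.span (Set.range x) ^ m ⊔ W ↔
      ∃ p : MvPolynomial (Fin (c + 1)) R, p.IsHomogeneous m ∧ y - r * eval x p ∈ W := by
  constructor
  · intro h
    obtain ⟨u, hu, v, hv, rfl⟩ := Submodule.mem_sup.1 h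
    obtain ⟨w, hw, rfl⟩ := Ideal.mem_span_singleton_mul.1 hu
    obtain ⟨p, hp, rfl⟩ := (Ideal.mem_span_pow_iff_exists_isHomogeneous x _).1 hw
    exact ⟨p, hp, by rwa [add_sub_cancel_left]⟩
  · rintro ⟨p, hp, h⟩
    rw [← sub_add_cancel y (r * eval x p)]
    exact add_mem (Ideal.mem_sup_right h) (Ideal.mem_sup_left
      (Ideal.mul_mem_mul (Ideal.mem_span_singleton_self r) (eval_mem_pow x hp)))

variable (S) in
/-- The elements of the `i`-th step which multiplication by `h` moves to multiples of the
generator of that step. -/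
noncomputable def linkFil (b : ℕ) (h : MvPolynomial (Fin (c + 1)) R) (i n : ℕ) : Ideal R :=
  satFil S n i ⊓ Submodule.comap (LinearMap.mulLeft R (eval x h))
    (Ideal.span {S.r i} * Ideal.span (Set.range x) ^ (n + b) ⊔ satFil S (n + b) (i + 1))

theorem mem_linkFil {b : ℕ} {h : MvPolynomial (Fin (c + 1)) R} {i n : ℕ} {y : R} :
    y ∈ linkFil S b h i n ↔ y ∈ satFil S n i ∧
      ∃ p : MvPolynomial (Fin (c + 1)) R, p.IsHomogeneous (n + b) ∧
        eval x h * y - S.r i * eval x p ∈ satFil S (n + b) (i + 1) := by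
  rw [linkFil, Submodule.mem_inf, Submodule.mem_comap, mem_span_mul_pow_sup]
  rfl

theorem linkFil_le_mul {b : ℕ} {h : MvPolynomial (Fin (c + 1)) R} {i s : ℕ}
    {f : MvPolynomial (Fin (c + 1)) R} (hf : IsUnitForm s f) (n : ℕ) :
    linkFil S b h i n ≤ linkFil S (b + s) (f * h) i n := by
  intro y hy
  obtain ⟨hy1, p, hp, h1⟩ := mem_linkFil.1 hy
  refine mem_linkFil.2 ⟨hy1, f * p, by rw [add_comm b, add_left_comm]; exact hf.1.mul hp, ?_⟩
  have := mul_mem_satFil h1 (eval_mem_pow x hf.1)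
  rw [add_assoc] at this
  convert this using 1
  simp only [map_mul]
  ring

/-- If linking fails, some multiple of the form links strictly more elements. -/
theorem exists_linkFil_gain {i b a : ℕ} (hi : IsGood S i)
    {h : MvPolynomial (Fin (c + 1)) R} (hh : h.IsHomogeneous b)
    (ha : ¬ satFil S a i ≤ linkFil S b h i a) :
    0 < c ∧ ∃ s f, IsUnitForm (c := c) s f ∧ ∀ m,
      relLength (linkFil S (b + s) (f * h) i (a + (m + 1))) (satFil S (a + (m + 1)) i) +
        formDim c (m + 1) ≤
      relLength (linkFil S b h i (a + (m + 1))) (satFil S (a + (m + 1)) i) + formDim c m := by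
  obtain ⟨y, hy, hyW⟩ := SetLike.not_le_iff_exists.1 ha
  have hhy := mul_mem_satFil hy (eval_mem_pow x hh)
  obtain ⟨s, f, g, hf, hg, hfg⟩ := exists_unitForm_mul_sub_mem hhy
  replace hfg := le_satFil _ _ hfg
  have hdvd : ¬ map (residue R) f ∣ map (residue R) g := by
    rintro ⟨u, hu⟩
    have hu' : map (residue R) g = map (residue R) f * homogeneousComponent (a + b) u := by
      rw [← homogeneousComponent_mul_of_isHomogeneous (isHomogeneous_map hf.1), ← hu,
        homogeneousComponent_of_mem (isHomogeneous_map hg), if_pos (add_comm _ _)]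
    obtain ⟨v, hv, hvu⟩ := isHomogeneous_map_lift (R := R)
      (homogeneousComponent_isHomogeneous (a + b) u)
    refine hyW (mem_linkFil.2 ⟨hy, v, hv, mem_satFil_of_mul hf ?_⟩)
    have h1 : S.r i * eval x (g - f * v) ∈ satFil S (a + b + s) (i + 1) := by
      refine r_mul_eval_mem_satFil i (hg.sub ?_) (by rw [map_sub, map_mul, hvu, hu', sub_self])
      rw [add_comm (a + b) s]
      exact hf.1.mul hv
    convert add_mem hfg h1 using 1
    simp only [map_sub, map_mul]
    ring
  refine ⟨?_, s, f, hf, fun m => ?_⟩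
  · rcases Nat.eq_zero_or_pos c with rfl | hc
    · refine absurd (dvd_of_isHomogeneous_fin_one (m := a + b) (isHomogeneous_map hf.1) hf.2 ?_) hdvd
      rw [add_comm s (a + b)]
      exact isHomogeneous_map hg
    · exact hc
  obtain ⟨q, hq0, hqu, hq⟩ := exists_dvd_of_dvd_mul hf.2 hdvd
  have hW' : linkFil S (b + s) (f * h) i (a + (m + 1)) ≤ satFil S (a + (m + 1)) i := inf_le_left
  have h1 : Ideal.span {y} * Ideal.span (Set.range x) ^ (m + 1) ≤
      linkFil S (b + s) (f * h) i (a + (m + 1)) := by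
    intro z hz
    obtain ⟨w, hw, rfl⟩ := Ideal.mem_span_singleton_mul.1 hz
    obtain ⟨φ, hφ, rfl⟩ := (Ideal.mem_span_pow_iff_exists_isHomogeneous x _).1 hw
    refine mem_linkFil.2 ⟨?_, g * φ, ?_, ?_⟩
    · rw [mul_comm]
      exact mul_mem_satFil hy hw
    · convert hg.mul hφ using 1
      ring
    · have := mul_mem_satFil hfg (eval_mem_pow x hφ)
      rw [show a + b + s + (m + 1) = a + (m + 1) + (b + s) by ring] at this
      convert this using 1
      simp only [map_mul]
      ring
  have h2 := formDim_le_relLength x y (linkFil S b h i (a + (m + 1))) (m + 1)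
    ((Ideal.span {q}).restrictScalars (ResidueField R)) fun φ hφ hyφ => by
      obtain ⟨-, ψ, hψ, h3⟩ := mem_linkFil.1 hyφ
      have h4 := mul_mem_satFil h3 (eval_mem_pow x hf.1)
      have h5 := mul_mem_satFil hfg (eval_mem_pow x hφ)
      rw [show a + b + s + (m + 1) = a + (m + 1) + b + s by ring] at h5
      have h6 : S.r i * eval x (g * φ - f * ψ) ∈ satFil S (a + (m + 1) + b + s) (i + 1) := by
        convert sub_mem h4 h5 using 1
        simp only [map_sub, map_mul]
        ring
      have h7 := hi.map_residue_eq_zero (((hg.mul hφ).sub (by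
        convert hf.1.mul hψ using 1
        ring)) : (g * φ - f * ψ).IsHomogeneous (a + b + s + (m + 1)))
          (by rwa [show a + b + s + (m + 1) = a + (m + 1) + b + s by ring])
      rw [map_sub, map_mul, map_mul, sub_eq_zero] at h7
      exact Ideal.mem_span_singleton.2 (hq _ ⟨_, h7⟩)
  have h3 : (formDim c (m + 1) : ℕ∞) ≤ relLength (linkFil S b h i (a + (m + 1)))
      (linkFil S (b + s) (f * h) i (a + (m + 1))) + formDim c m := by
    refine h2.trans (add_le_add (relLength_mono_right _ h1) ?_)
    exact_mod_cast finrank_multiples_succ_le hq0 hqu m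
  rw [relLength_add (linkFil_le_mul hf (a + (m + 1))) hW']
  refine (add_le_add_right h3 _).trans (le_of_eq ?_)
  ring

variable (S) in
/-- The total defect of linking, in degrees less than `n`. -/
noncomputable def linkDefect (b : ℕ) (h : MvPolynomial (Fin (c + 1)) R) (i n : ℕ) : ℕ∞ :=
  ∑ j ∈ Finset.range n, relLength (linkFil S b h i j) (satFil S j i)

theorem exists_linkDefect_gain {i b a : ℕ} (hi : IsGood S i)
    {h : MvPolynomial (Fin (c + 1)) R} (hh : h.IsHomogeneous b)
    (ha : ¬ satFil S a i ≤ linkFil S b h i a) :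
    0 < c ∧ ∃ s f, IsUnitForm (c := c) s f ∧ ∀ m,
      linkDefect S (b + s) (f * h) i (a + 1 + m) + formDim c m ≤
        linkDefect S b h i (a + 1 + m) + 1 := by
  obtain ⟨hc, s, f, hf, H⟩ := exists_linkFil_gain hi hh ha
  refine ⟨hc, s, f, hf, fun m => ?_⟩
  have hmono : ∀ j, relLength (linkFil S (b + s) (f * h) i j) (satFil S j i) ≤
      relLength (linkFil S b h i j) (satFil S j i) :=
    fun j => relLength_anti_left (linkFil_le_mul hf j) _
  induction m with
  | zero =>
    have : formDim c 0 = 1 := by simp [formDim]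
    rw [this, Nat.cast_one]
    exact add_le_add (Finset.sum_le_sum fun j _ => hmono j) le_rfl
  | succ m ih =>
    have h1 := H m
    rw [show a + (m + 1) = a + 1 + m by ring] at h1
    rw [← add_assoc, linkDefect, linkDefect, Finset.sum_range_succ, Finset.sum_range_succ,
      ← linkDefect, ← linkDefect]
    have h2 := add_le_add ih h1
    rw [add_add_add_comm, add_add_add_comm (linkDefect S b h i _)] at h2
    refine (ENat.add_le_add_iff_left (ENat.natCast_ne_top (formDim c m))).1 ?_
    refine le_trans (le_of_eq ?_) (h2.trans (le_of_eq ?_)) <;> ac_rfl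

theorem exists_linkDefect_bound {i : ℕ} (hi : IsGood S i)
    (H : ∀ b h, IsUnitForm (c := c) b h → ∃ a, ¬ satFil S a i ≤ linkFil S b h i a) (r : ℕ) :
    ∃ a b h, IsUnitForm (c := c) b h ∧ ∀ n,
      linkDefect S b h i (n + a) + (r * formDim c n : ℕ) ≤
        linkDefect S 0 (1 : MvPolynomial (Fin (c + 1)) R) i (n + a) + r := by
  induction r with
  | zero => exact ⟨0, 0, 1, isUnitForm_one, fun n => by simp⟩
  | succ r ih =>
    obtain ⟨a, b, h, hh, h1⟩ := ih
    obtain ⟨a', ha'⟩ := H b h hh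
    obtain ⟨-, s, f, hf, h2⟩ := exists_linkDefect_gain hi hh.1 ha'
    refine ⟨a + (a' + 1), b + s, f * h, by rw [add_comm]; exact hf.mul hh, fun n => ?_⟩
    have h3 := h1 (n + (a' + 1))
    have h4 := h2 (n + a)
    rw [show a' + 1 + (n + a) = n + (a + (a' + 1)) by ring] at h4
    rw [show n + (a' + 1) + a = n + (a + (a' + 1)) by ring] at h3
    have h5 : ((r * formDim c n : ℕ) : ℕ∞) ≤ (r * formDim c (n + (a' + 1)) : ℕ) := by
      exact_mod_cast Nat.mul_le_mul_left r (formDim_mono c (Nat.le_add_right _ _))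
    have h6 : ((formDim c n : ℕ) : ℕ∞) ≤ (formDim c (n + a) : ℕ) := by
      exact_mod_cast formDim_mono c (Nat.le_add_right _ _)
    calc linkDefect S (b + s) (f * h) i (n + (a + (a' + 1))) + ((r + 1) * formDim c n : ℕ)
        = linkDefect S (b + s) (f * h) i (n + (a + (a' + 1))) + formDim c n +
          (r * formDim c n : ℕ) := by push_cast; ring
      _ ≤ linkDefect S b h i (n + (a + (a' + 1))) + 1 + (r * formDim c n : ℕ) :=
        add_le_add ((add_le_add le_rfl h6).trans h4) le_rfl
      _ = linkDefect S b h i (n + (a + (a' + 1))) + (r * formDim c n : ℕ) + 1 := by ring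
      _ ≤ linkDefect S 0 1 i (n + (a + (a' + 1))) + r + 1 :=
        add_le_add ((add_le_add le_rfl h5).trans h3) le_rfl
      _ = _ := by push_cast; ring

/-- A single form links the whole surviving step of the saturated filtration to its generator. -/
theorem IsGood.exists_link {i : ℕ} (hi : i ∈ goodSteps S) :
    ∃ b h, IsUnitForm (c := c) b h ∧ ∀ n, satFil S n i ≤ linkFil S b h i n := by
  by_contra! H
  have hi' := (mem_goodSteps.1 hi).2
  obtain ⟨C, hC⟩ := exists_defect_le S
  have hc : 0 < c := by
    obtain ⟨a, ha⟩ := H 0 1 isUnitForm_one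
    exact (exists_linkDefect_gain hi' isUnitForm_one.1 ha).1
  have h0 : ∀ n, linkDefect S 0 (1 : MvPolynomial (Fin (c + 1)) R) i n ≤ (C * (n + 1) ^ c : ℕ) := by
    intro n
    refine le_trans (Finset.sum_le_sum fun j _ => ?_) ((hC n).trans' le_self_add)
    refine le_trans ?_ (Finset.single_le_sum (f := fun i => defect S j i)
      (fun _ _ => bot_le) hi)
    refine relLength_anti_left (fun y hy => ?_) _
    obtain ⟨p, hp, h⟩ := mem_span_mul_pow_sup.1 hy
    refine mem_linkFil.2 ⟨?_, p, hp, by simpa using h⟩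
    rw [← sub_add_cancel y (S.r i * eval x p)]
    exact add_mem (satFil_antitone_right j (Nat.le_succ i) h) (r_mul_mem_satFil i (eval_mem_pow x hp))
  set M := C * (2 ^ c * c.factorial) with hM
  obtain ⟨a, b, h, hh, h1⟩ := exists_linkDefect_bound hi' H (2 * M + 1)
  have h2 := (le_add_self.trans (h1 (a + 1))).trans (add_le_add (h0 _) le_rfl)
  norm_cast at h2
  have h3 : (a + 1 + a + 1) ^ c ≤ 2 ^ c * (c.factorial * formDim c (a + 1)) := by
    calc (a + 1 + a + 1) ^ c ≤ (2 * (a + 1 + 1)) ^ c := Nat.pow_le_pow_left (by omega) _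
      _ = 2 ^ c * (a + 1 + 1) ^ c := mul_pow _ _ _
      _ ≤ _ := Nat.mul_le_mul_left _ (pow_le_formDim c (a + 1))
  have h4 : C * (a + 1 + a + 1) ^ c ≤ M * formDim c (a + 1) := by
    calc _ ≤ C * (2 ^ c * (c.factorial * formDim c (a + 1))) := Nat.mul_le_mul_left _ h3
      _ = _ := by rw [hM]; ring
  have h5 : 2 ≤ formDim c (a + 1) := by
    refine le_trans ?_ (formDim_mono c (show 1 ≤ a + 1 by omega))
    rw [formDim, add_comm, Nat.choose_succ_self_right]
    omega
  nlinarith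

end Saturation

end NormalChern

namespace NormalChern

open Module IsLocalRing MvPolynomial

section Chevalley

variable {R : Type*} [CommRing R] [IsLocalRing R] [IsNoetherianRing R]

theorem mem_of_forall_mem_sup_pow {I J : Ideal R} (hJ : J ≤ maximalIdeal R) {y : R}
    (h : ∀ n, y ∈ I ⊔ J ^ n) : y ∈ I := by
  have hJ' : J ≠ ⊤ := fun h => (maximalIdeal.isMaximal R).ne_top (top_le_iff.1 (h ▸ hJ))
  have h0 := Ideal.iInf_pow_smul_eq_bot_of_isLocalRing (M := R ⧸ I) J hJ'
  rw [← Submodule.Quotient.mk_eq_zero, ← Submodule.mem_bot R, ← h0, Submodule.mem_iInf]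
  intro n
  obtain ⟨u, hu, v, hv, rfl⟩ := Submodule.mem_sup.1 (h n)
  rw [Submodule.Quotient.mk_add, (Submodule.Quotient.mk_eq_zero I).2 hu, zero_add,
    show (Submodule.Quotient.mk v : R ⧸ I) = v • Submodule.Quotient.mk 1 by
      rw [← Submodule.Quotient.mk_smul, smul_eq_mul, mul_one]]
  exact Submodule.smul_mem_smul hv Submodule.mem_top

theorem exists_stable_mod_pow {a : ℕ → Ideal R} (ha : Antitone a) (M : ℕ) :
    ∃ n, ∀ m, n ≤ m → a n ≤ a m ⊔ maximalIdeal R ^ M := by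
  have : IsArtinianRing (R ⧸ maximalIdeal R ^ M) := by
    by_cases hM : Nontrivial (R ⧸ maximalIdeal R ^ M)
    · have := IsLocalRing.of_surjective' (Ideal.Quotient.mk (maximalIdeal R ^ M))
        Ideal.Quotient.mk_surjective
      rw [isArtinianRing_iff_isNilpotent_maximalIdeal]
      refine ⟨M, ?_⟩
      rw [← IsLocalRing.map_maximalIdeal_of_surjective (Ideal.Quotient.mk (maximalIdeal R ^ M))
        Ideal.Quotient.mk_surjective, ← Ideal.map_pow, Ideal.map_quotient_self, Ideal.zero_eq_bot]
    · rw [not_nontrivial_iff_subsingleton] at hM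
      infer_instance
  obtain ⟨n, hn⟩ := IsArtinian.monotone_stabilizes (R := R ⧸ maximalIdeal R ^ M)
    (M := R ⧸ maximalIdeal R ^ M)
    ⟨fun n => OrderDual.toDual ((a n).map (Ideal.Quotient.mk (maximalIdeal R ^ M))),
      fun _ _ h => OrderDual.toDual_le_toDual.2 (Ideal.map_mono (ha h))⟩
  refine ⟨n, fun m hm y hy => ?_⟩
  have h1 := Ideal.mem_map_of_mem (Ideal.Quotient.mk (maximalIdeal R ^ M)) hy
  have h2 : (a n).map (Ideal.Quotient.mk (maximalIdeal R ^ M)) =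
    (a m).map (Ideal.Quotient.mk (maximalIdeal R ^ M)) := hn m hm
  rw [h2, ← Ideal.mem_comap, Ideal.comap_map_of_surjective _ Ideal.Quotient.mk_surjective,
    ← RingHom.ker_eq_comap_bot, Ideal.mk_ker] at h1
  exact h1

/-- Chevalley's theorem. -/
theorem exists_le_maximalIdeal_pow [IsAdicComplete (maximalIdeal R) R] {a : ℕ → Ideal R}
    (ha : Antitone a) (h0 : ∀ y, (∀ n, y ∈ a n) → y = 0) (M : ℕ) :
    ∃ n, a n ≤ maximalIdeal R ^ M := by
  set m := maximalIdeal R with hm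
  by_contra! H
  let L : ℕ → Ideal R := fun M => ⨅ n, a n ⊔ m ^ M
  have hL : ∀ {M y}, y ∈ L M ↔ ∀ n, y ∈ a n ⊔ m ^ M := Submodule.mem_iInf _
  have hstep : ∀ M, ∀ n, ∃ N, n ≤ N ∧ a N ≤ L M := by
    intro M n
    obtain ⟨N, hN⟩ := exists_stable_mod_pow ha M
    refine ⟨max n N, le_max_left _ _, fun y hy => hL.2 fun i => ?_⟩
    rcases le_total i N with hi | hi
    · exact Ideal.mem_sup_left (ha (hi.trans (le_max_right _ _)) hy)
    · exact hN i hi (ha (le_max_right _ _) hy)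
  have hnext : ∀ M y, y ∈ L M → ∃ z ∈ L (M + 1), z - y ∈ m ^ M := by
    intro M y hy
    obtain ⟨N, -, hN⟩ := hstep (M + 1) 0
    obtain ⟨u, hu, v, hv, rfl⟩ := Submodule.mem_sup.1 (hL.1 hy N)
    refine ⟨u, hN hu, ?_⟩
    rw [sub_add_cancel_left]
    exact neg_mem hv
  obtain ⟨N, -, hN⟩ := hstep M 0
  obtain ⟨y0, hy0, hy0M⟩ := SetLike.not_le_iff_exists.1 (H N)
  choose! g hg1 hg2 using hnext
  let f : ℕ → R := fun k => Nat.rec y0 (fun k y => g (M + k) y) k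
  have hf1 : ∀ k, f k ∈ L (M + k) := by
    intro k
    induction k with
    | zero => exact hN hy0
    | succ k ih => exact hg1 _ _ ih
  have hf2 : ∀ k, f (k + 1) - f k ∈ m ^ (M + k) := fun k => hg2 _ _ (hf1 k)
  have hf3 : ∀ k l, k ≤ l → f l - f k ∈ m ^ (M + k) := by
    intro k l hkl
    induction l, hkl using Nat.le_induction with
    | base => simp
    | succ l hkl ih =>
      rw [← sub_add_sub_cancel _ (f l)]
      exact add_mem (Ideal.pow_le_pow_right (by omega) (hf2 l)) ih
  obtain ⟨l, hl⟩ := IsPrecomplete.prec (I := m) (M := R) inferInstance (f := f) (by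
    intro i j hij
    rw [SModEq.sub_mem, ← neg_sub]
    have := Ideal.pow_le_pow_right (I := m) (Nat.le_add_left i M) (hf3 i j hij)
    simpa only [smul_eq_mul, Ideal.mul_top, neg_sub] using neg_mem this)
  have hl' : ∀ n, f n - l ∈ m ^ n := fun n => by
    have := SModEq.sub_mem.1 (hl n)
    simpa using this
  have hl0 : l = 0 := by
    refine h0 l fun n => mem_of_forall_mem_sup_pow (J := m) le_rfl fun k => ?_
    rw [← sub_sub_cancel (f k) l]
    refine sub_mem ?_ (Ideal.mem_sup_right (hl' k))
    exact (sup_le_sup_left (Ideal.pow_le_pow_right (Nat.le_add_left k M)) (a n) :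
      a n ⊔ m ^ (M + k) ≤ a n ⊔ m ^ k) (hL.1 (hf1 k) n)
  refine hy0M ?_
  have h1 := hl' M
  rw [hl0, sub_zero] at h1
  have h2 : f M - y0 ∈ m ^ M := hf3 0 M (Nat.zero_le _)
  have := sub_mem h1 h2
  rwa [sub_sub_cancel] at this

end Chevalley

section Forms

variable {k : Type*} [Field k] {c : ℕ} {b : ℕ} {P : ℕ → Submodule k (MvPolynomial (Fin (c + 1)) k)}

theorem exists_eq_single_add {s : Fin (c + 1) →₀ ℕ} (hs : s.degree ≠ 0) :
    ∃ i t, s = Finsupp.single i 1 + t := by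
  obtain ⟨i, hi⟩ : ∃ i, s i ≠ 0 := by
    by_contra! h
    exact hs (by rw [Finsupp.degree_eq_zero_iff]; exact Finsupp.ext h)
  refine ⟨i, s - Finsupp.single i 1, ?_⟩
  rw [add_tsub_cancel_of_le]
  rw [Finsupp.single_le_iff]
  omega

theorem monomial_mul_mem (hX : ∀ j i, ∀ p ∈ P j, X i * p ∈ P (j + 1)) (a : k)
    {s : Fin (c + 1) →₀ ℕ} {j : ℕ} {p : MvPolynomial (Fin (c + 1)) k} (hp : p ∈ P j) : monomial s a * p ∈ P (j + s.degree) := by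
  induction hn : s.degree generalizing s with
  | zero =>
    rw [Finsupp.degree_eq_zero_iff] at hn
    rw [hn, ← C_apply, ← smul_eq_C_mul]
    exact Submodule.smul_mem _ _ hp
  | succ n ih =>
    obtain ⟨i, t, rfl⟩ := exists_eq_single_add (by rw [hn]; omega)
    rw [map_add, Finsupp.degree_single] at hn
    have h := hX _ i _ (ih (s := t) (by omega))
    rwa [← mul_assoc, X, monomial_mul, one_mul, add_assoc] at h

theorem homogeneous_mul_mem_iSup (hX : ∀ j i, ∀ p ∈ P j, X i * p ∈ P (j + 1))
    {q : MvPolynomial (Fin (c + 1)) k} {m : ℕ} (hq : q.IsHomogeneous (m + 1)) {j : ℕ} {p : MvPolynomial (Fin (c + 1)) k}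
    (hp : p ∈ P j) : q * p ∈ ⨆ i, (P (j + m)).map (LinearMap.mulLeft k (X i)) := by
  rw [q.as_sum, Finset.sum_mul]
  refine sum_mem fun s hs => ?_
  have hs1 : s.degree = m + 1 := by
    have := hq (mem_support_iff.1 hs)
    rwa [Finsupp.degree_eq_weight_one]
  obtain ⟨i, t, rfl⟩ := exists_eq_single_add (s := s) (by omega)
  refine Submodule.mem_iSup_of_mem i ⟨monomial t (coeff (Finsupp.single i 1 + t) q) * p, ?_, ?_⟩
  · have : m = t.degree := by
      simp at hs1; omega
    rw [this]
    exact monomial_mul_mem hX _ hp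
  · rw [LinearMap.mulLeft_apply, ← mul_assoc]
    congr 1
    rw [X, monomial_mul, one_mul]

theorem exists_le_iSup_map_X (hP : ∀ j, ∀ p ∈ P j, p.IsHomogeneous (j + b))
    (hX : ∀ j i, ∀ p ∈ P j, X i * p ∈ P (j + 1)) :
    ∃ n0, ∀ j, n0 ≤ j → P (j + 1) ≤ ⨆ i, (P j).map (LinearMap.mulLeft k (X i)) := by
  let I : ℕ →o Ideal (MvPolynomial (Fin (c + 1)) k) :=
    ⟨fun j => Ideal.span (⋃ j' ≤ j, (P j' : Set (MvPolynomial (Fin (c + 1)) k))), fun i j hij =>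
      Ideal.span_mono (Set.biUnion_subset_biUnion_left fun a (ha : a ≤ i) => ha.trans hij)⟩
  obtain ⟨n0, hn0⟩ := monotone_stabilizes_iff_noetherian.2
    (inferInstance : IsNoetherian (MvPolynomial (Fin (c + 1)) k) (MvPolynomial (Fin (c + 1)) k)) I
  refine ⟨n0, fun j hj p hp => ?_⟩
  have hpI : p ∈ I j := by
    rw [← hn0 j hj, hn0 (j + 1) (by omega)]
    exact Ideal.subset_span (Set.mem_biUnion (show j + 1 ≤ j + 1 from le_rfl) hp)
  have key : ∀ z ∈ I j, ∀ a, homogeneousComponent (j + 1 + b) (a * z) ∈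
      ⨆ i, (P j).map (LinearMap.mulLeft k (X i)) := by
    intro z hz
    induction hz using Submodule.span_induction with
    | mem z hz =>
      intro a
      obtain ⟨j', hj', hz'⟩ := Set.mem_iUnion₂.1 hz
      obtain ⟨m, rfl⟩ := Nat.exists_eq_add_of_le (show j' ≤ j from hj')
      replace hz' : z ∈ P j' := hz'
      have h := homogeneousComponent_mul_of_isHomogeneous (hP j' z hz') a (m + 1)
      rw [show j' + m + 1 + b = j' + b + (m + 1) by ring, mul_comm, h, mul_comm]
      exact homogeneous_mul_mem_iSup hX (homogeneousComponent_isHomogeneous _ _) hz'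
    | zero => simp
    | add y z _ _ hy hz =>
      intro a
      rw [mul_add, map_add]
      exact add_mem (hy a) (hz a)
    | smul t z _ hz =>
      intro a
      rw [smul_eq_mul, ← mul_assoc]
      exact hz _
  have := key p hpI 1
  rwa [one_mul, homogeneousComponent_of_mem (hP _ p hp), if_pos rfl] at this

end Forms

section Saturation

variable {R : Type*} [CommRing R] [IsLocalRing R] {c : ℕ} {x : Fin (c + 1) → R}
  {S : SimpleChain (Ideal.span (Set.range x))}

variable (S) in
/-- The leading forms of the elements of a filtration step linked by `h`. -/
def symb (b : ℕ) (h : MvPolynomial (Fin (c + 1)) R) (i n : ℕ) :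
    Submodule (ResidueField R) (MvPolynomial (Fin (c + 1)) (ResidueField R)) where
  carrier := {q | ∃ p : MvPolynomial (Fin (c + 1)) R, p.IsHomogeneous (n + b) ∧
    map (residue R) p = q ∧ ∃ y ∈ satFil S n i,
      eval x h * y - S.r i * eval x p ∈ satFil S (n + b) (i + 1)}
  zero_mem' := ⟨0, isHomogeneous_zero _ _ _, map_zero _, 0, zero_mem _, by simp⟩
  add_mem' := by
    rintro _ _ ⟨p, hp, rfl, y, hy, h1⟩ ⟨q, hq, rfl, z, hz, h2⟩
    refine ⟨p + q, hp.add hq, map_add _ _ _, y + z, add_mem hy hz, ?_⟩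
    convert add_mem h1 h2 using 1
    rw [map_add]
    ring
  smul_mem' := by
    rintro a _ ⟨p, hp, rfl, y, hy, h1⟩
    obtain ⟨a, rfl⟩ := residue_surjective a
    refine ⟨a • p, (homogeneousSubmodule _ _ _).smul_mem a hp, ?_, a * y,
      Ideal.mul_mem_left _ _ hy, ?_⟩
    · rw [smul_eq_C_mul, map_mul, map_C, smul_eq_C_mul]
    · convert Ideal.mul_mem_left _ a h1 using 1
      rw [smul_eval]
      ring

theorem X_mul_mem_symb {b : ℕ} {h : MvPolynomial (Fin (c + 1)) R} {i n : ℕ} (j : Fin (c + 1))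
    {q : MvPolynomial (Fin (c + 1)) (ResidueField R)} (hq : q ∈ symb S b h i n) :
    X j * q ∈ symb S b h i (n + 1) := by
  obtain ⟨p, hp, rfl, y, hy, h1⟩ := hq
  have hx : x j ∈ Ideal.span (Set.range x) ^ 1 := by
    rw [pow_one]
    exact Ideal.subset_span ⟨j, rfl⟩
  refine ⟨X j * p, ?_, by rw [map_mul, map_X], x j * y, mul_mem_satFil hy hx, ?_⟩
  · rw [show n + 1 + b = 1 + (n + b) by ring]
    exact (isHomogeneous_X _ _).mul hp
  · have := mul_mem_satFil h1 hx
    rw [show n + b + 1 = n + 1 + b by ring] at this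
    convert this using 1
    rw [map_mul, eval_X]
    ring

theorem exists_satFil_succ_le {i : ℕ} (hi : i < S.len) : ∃ n0, ∀ n, n0 ≤ n →
    satFil S (n + 1) i ≤ Ideal.span (Set.range x) * satFil S n i ⊔ satFil S (n + 1) (i + 1) := by
  by_cases hg : IsGood S i
  swap
  · exact ⟨0, fun n _ => by rw [satFil_succ_of_not_isGood hg]; exact le_sup_right⟩
  obtain ⟨b, h, hh, hl⟩ := IsGood.exists_link (mem_goodSteps.2 ⟨hi, hg⟩)
  obtain ⟨n0, hn0⟩ := exists_le_iSup_map_X (b := b) (P := symb S b h i)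
    (by rintro j _ ⟨p, hp, rfl, -⟩; exact isHomogeneous_map hp)
    fun j i q hq => X_mul_mem_symb i hq
  refine ⟨n0, fun n hn y hy => ?_⟩
  obtain ⟨-, p, hp, h1⟩ := mem_linkFil.1 (hl _ hy)
  have h2 := hn0 n hn (show map (residue R) p ∈ symb S b h i (n + 1) from ⟨p, hp, rfl, y, hy, h1⟩)
  have h3 : ∀ q ∈ ⨆ j, (symb S b h i n).map (LinearMap.mulLeft (ResidueField R) (X j)),
      ∃ p : MvPolynomial (Fin (c + 1)) R, p.IsHomogeneous (n + 1 + b) ∧ map (residue R) p = q ∧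
        ∃ y ∈ Ideal.span (Set.range x) * satFil S n i,
          eval x h * y - S.r i * eval x p ∈ satFil S (n + 1 + b) (i + 1) := by
    intro q hq
    induction hq using Submodule.iSup_induction' with
    | mem j q hq =>
      obtain ⟨_, ⟨p, hp, rfl, y, hy, h1⟩, rfl⟩ := hq
      refine ⟨X j * p, ?_, by rw [map_mul, map_X]; rfl, x j * y,
        Ideal.mul_mem_mul (Ideal.subset_span ⟨j, rfl⟩) hy, ?_⟩
      · rw [show n + 1 + b = 1 + (n + b) by ring]
        exact (isHomogeneous_X _ _).mul hp
      · have := mul_mem_satFil h1 (show x j ∈ Ideal.span (Set.range x) ^ 1 by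
          rw [pow_one]
          exact Ideal.subset_span ⟨j, rfl⟩)
        rw [show n + b + 1 = n + 1 + b by ring] at this
        convert this using 1
        rw [map_mul, eval_X]
        ring
    | zero => exact ⟨0, isHomogeneous_zero _ _ _, map_zero _, 0, zero_mem _, by simp⟩
    | add q q' _ _ hq hq' =>
      obtain ⟨p, hp, rfl, y, hy, h1⟩ := hq
      obtain ⟨p', hp', rfl, y', hy', h1'⟩ := hq'
      refine ⟨p + p', hp.add hp', map_add _ _ _, y + y', add_mem hy hy', ?_⟩
      convert add_mem h1 h1' using 1
      rw [map_add]
      ring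
  obtain ⟨p', hp', hpp, y', hy', h1'⟩ := h3 _ h2
  rw [← add_sub_cancel y' y]
  refine add_mem (Ideal.mem_sup_left hy') (Ideal.mem_sup_right (mem_satFil_of_mul hh ?_))
  have h4 := r_mul_eval_mem_satFil (S := S) i (hp.sub hp') (by rw [map_sub, hpp, sub_self])
  convert add_mem (sub_mem h1 h1') h4 using 1
  rw [map_sub]
  ring

theorem exists_satFil_le_mul_sup : ∃ n0, ∀ n, n0 ≤ n →
    satFil S (n + 1) 0 ≤ Ideal.span (Set.range x) * satFil S n 0 ⊔ satFil S (n + 2) 0 := by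
  have h : ∀ i, i ≤ S.len → ∃ n0, ∀ n, n0 ≤ n →
      satFil S (n + 1) 0 ≤ Ideal.span (Set.range x) * satFil S n 0 ⊔ satFil S (n + 1) i := by
    intro i
    induction i with
    | zero => exact fun _ => ⟨0, fun n _ => le_sup_right⟩
    | succ i ih =>
      intro hi
      obtain ⟨n0, h0⟩ := ih (Nat.le_of_succ_le hi)
      obtain ⟨n1, h1⟩ := exists_satFil_succ_le (S := S) hi
      refine ⟨max n0 n1, fun n hn => (h0 n (le_of_max_le_left hn)).trans (sup_le le_sup_left
        ((h1 n (le_of_max_le_right hn)).trans (sup_le_sup_right ?_ _)))⟩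
      exact Ideal.mul_mono_right (satFil_antitone_right n (Nat.zero_le i))
  obtain ⟨n0, h0⟩ := h S.len le_rfl
  exact ⟨n0, fun n hn => by simpa only [satFil_last] using h0 n hn⟩

theorem satFil_zero_antitone : Antitone fun n => satFil S n 0 :=
  antitone_nat_of_succ_le fun n => by
    rw [← satFil_last]
    exact satFil_antitone_right n (Nat.zero_le _)

variable [IsNoetherianRing R] [IsAdicComplete (maximalIdeal R) R]

/-- The saturated filtration is linearly equivalent to the adic one. -/
theorem MaxGrowth.exists_satFil_le (hx : MaxGrowth x) :
    ∃ k, ∀ n, satFil S (n + k) 0 ≤ Ideal.span (Set.range x) ^ n := by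
  obtain ⟨k, hk⟩ := exists_satFil_le_mul_sup (S := S)
  have h1 : ∀ n, k ≤ n → ∀ M,
      satFil S (n + 1) 0 ≤ Ideal.span (Set.range x) * satFil S n 0 ⊔ satFil S (n + 1 + M) 0 := by
    intro n hn M
    induction M with
    | zero => exact le_sup_right
    | succ M ih =>
      refine ih.trans (sup_le le_sup_left ?_)
      have := hk (n + M) (by omega)
      rw [show n + 1 + (M + 1) = n + M + 2 by ring, show n + 1 + M = n + M + 1 by ring]
      refine this.trans (sup_le_sup_right (Ideal.mul_mono_right ?_) _)
      exact satFil_zero_antitone (Nat.le_add_right n M)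
  have h2 : ∀ n, k ≤ n → satFil S (n + 1) 0 ≤ Ideal.span (Set.range x) * satFil S n 0 := by
    intro n hn y hy
    refine mem_of_forall_mem_sup_pow (J := maximalIdeal R) le_rfl fun M => ?_
    obtain ⟨l, hl⟩ := exists_le_maximalIdeal_pow (a := fun n => satFil S n 0)
      satFil_zero_antitone (fun y hy => hx.eq_zero_of_forall_mem_satFil S hy) M
    refine (sup_le_sup_left ((satFil_zero_antitone (Nat.le_add_left l (n + 1))).trans hl)
      (Ideal.span (Set.range x) * satFil S n 0)) (h1 n hn l hy)
  refine ⟨k, fun n => ?_⟩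
  induction n with
  | zero => simp
  | succ n ih =>
    rw [show n + 1 + k = n + k + 1 by ring, pow_succ']
    exact (h2 _ (Nat.le_add_left k n)).trans (Ideal.mul_mono_right ih)

/-- Unit forms of the parameters are uniformly superficial. -/
theorem MaxGrowth.exists_mem_pow_of_mul_mem (hx : MaxGrowth x) {N : ℕ}
    (hN : maximalIdeal R ^ N ≤ Ideal.span (Set.range x)) :
    ∃ k, ∀ n s g y, IsUnitForm (c := c) s g →
      eval x g * y ∈ Ideal.span (Set.range x) ^ (n + k + s) →
      y ∈ Ideal.span (Set.range x) ^ n := by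
  obtain ⟨S⟩ := exists_simpleChain hN
  obtain ⟨k, hk⟩ := hx.exists_satFil_le (S := S)
  refine ⟨k, fun n s g y hg h => hk n ⟨s, g, hg, ?_⟩⟩
  rwa [S.zero, Ideal.top_mul]

end Saturation

end NormalChern

namespace NormalChern

open Module IsLocalRing MvPolynomial

section OrdNorm

variable {R : Type*} [CommRing R] [IsLocalRing R] {c : ℕ} (x : Fin (c + 1) → R)

/-- The saturation of the `I`-adic filtration, `I = (x)`, with respect to values of unit forms. -/
def formFil (n : ℕ) : Ideal R where
  carrier := {y | ∃ s g, IsUnitForm (c := c) s g ∧ eval x g * y ∈ Ideal.span (Set.range x) ^ (n + s)}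
  zero_mem' := ⟨0, 1, isUnitForm_one, by simp⟩
  add_mem' := by
    rintro y z ⟨s, g, hg, h⟩ ⟨t, f, hf, h'⟩
    refine ⟨s + t, g * f, hg.mul hf, ?_⟩
    have e : eval x (g * f) * (y + z) = eval x f * (eval x g * y) + eval x g * (eval x f * z) := by
      rw [map_mul]; ring
    rw [e]
    refine add_mem ?_ ?_
    · rw [show n + (s + t) = t + (n + s) by ring, pow_add]
      exact Ideal.mul_mem_mul (eval_mem_pow x hf.1) h
    · rw [show n + (s + t) = s + (n + t) by ring, pow_add]
      exact Ideal.mul_mem_mul (eval_mem_pow x hg.1) h'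
  smul_mem' := by
    rintro r y ⟨s, g, hg, h⟩
    refine ⟨s, g, hg, ?_⟩
    rw [smul_eq_mul, mul_left_comm]
    exact Ideal.mul_mem_left _ _ h

variable {x}

theorem pow_le_formFil (n : ℕ) : Ideal.span (Set.range x) ^ n ≤ formFil x n := fun y hy =>
  ⟨0, 1, isUnitForm_one, by simpa using hy⟩

theorem formFil_zero : formFil x 0 = ⊤ := top_le_iff.1 (by simpa using pow_le_formFil (x := x) 0)

theorem formFil_antitone : Antitone (formFil x) := by
  rintro m n h y ⟨s, g, hg, hy⟩
  exact ⟨s, g, hg, Ideal.pow_le_pow_right (by omega) hy⟩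

theorem mul_mem_formFil {m n : ℕ} {y z : R} (hy : y ∈ formFil x m) (hz : z ∈ formFil x n) :
    y * z ∈ formFil x (m + n) := by
  obtain ⟨s, g, hg, h⟩ := hy
  obtain ⟨t, f, hf, h'⟩ := hz
  refine ⟨s + t, g * f, hg.mul hf, ?_⟩
  rw [map_mul, mul_mul_mul_comm, show m + n + (s + t) = (m + s) + (n + t) by ring, pow_add]
  exact Ideal.mul_mem_mul h h'

theorem mem_formFil_of_mul {n s : ℕ} {g : MvPolynomial (Fin (c + 1)) R} (hg : IsUnitForm s g)
    {y : R} (h : eval x g * y ∈ formFil x (n + s)) : y ∈ formFil x n := by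
  obtain ⟨t, f, hf, h⟩ := h
  refine ⟨t + s, f * g, hf.mul hg, ?_⟩
  rwa [map_mul, mul_assoc, show n + (t + s) = n + s + t by ring]

theorem MaxGrowth.eq_zero_of_forall_mem_formFil [IsNoetherianRing R] (hx : MaxGrowth x) {N : ℕ}
    (hN : maximalIdeal R ^ N ≤ Ideal.span (Set.range x)) {y : R} (h : ∀ n, y ∈ formFil x n) :
    y = 0 := by
  obtain ⟨S⟩ := exists_simpleChain hN
  refine hx.eq_zero_of_forall_mem_satFil S fun n => ?_
  obtain ⟨s, g, hg, h⟩ := h n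
  refine ⟨s, g, hg, ?_⟩
  rwa [S.zero, Ideal.top_mul]

open Classical in
variable (x) in
/-- The exponential of the order with respect to `formFil`. -/
noncomputable def ordFun (y : R) : ℝ :=
  if h : ∃ n, y ∉ formFil x (n + 1) then (1 / 2) ^ Nat.find h else 0

theorem ordFun_cases (y : R) : (ordFun x y = 0 ∧ ∀ n, y ∈ formFil x n) ∨
    ∃ n, ordFun x y = (1 / 2) ^ n ∧ y ∈ formFil x n ∧ y ∉ formFil x (n + 1) := by
  classical
  by_cases h : ∃ n, y ∉ formFil x (n + 1)
  · right
    refine ⟨Nat.find h, by rw [ordFun, dif_pos h], ?_, Nat.find_spec h⟩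
    rcases h0 : Nat.find h with _ | m
    · rw [formFil_zero]; trivial
    · have := Nat.find_min h (m := m) (by omega)
      simpa using this
  · left
    refine ⟨by rw [ordFun, dif_neg h], fun n => ?_⟩
    push Not at h
    exact formFil_antitone (Nat.le_succ n) (h n)

theorem ordFun_nonneg (y : R) : 0 ≤ ordFun x y := by
  rcases ordFun_cases (x := x) y with ⟨h, -⟩ | ⟨n, h, -⟩
  · rw [h]
  · rw [h]; positivity

theorem ordFun_le_iff {y : R} {n : ℕ} : ordFun x y ≤ (1 / 2) ^ n ↔ y ∈ formFil x n := by
  rcases ordFun_cases (x := x) y with ⟨h, h'⟩ | ⟨m, h, h1, h2⟩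
  · rw [h]; exact ⟨fun _ => h' n, fun _ => by positivity⟩
  · rw [h, pow_le_pow_iff_right_of_lt_one₀ (by norm_num) (by norm_num)]
    refine ⟨fun hn => formFil_antitone hn h1, fun hy => ?_⟩
    by_contra! hn
    exact h2 (formFil_antitone hn hy)

theorem ordFun_le_of_forall {y : R} {r : ℝ} (hr : 0 ≤ r)
    (h : ∀ n, ordFun x y = (1 / 2) ^ n → (1 / 2) ^ n ≤ r) : ordFun x y ≤ r := by
  rcases ordFun_cases (x := x) y with ⟨h', -⟩ | ⟨m, h', -⟩
  · rwa [h']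
  · rw [h']; exact h m h'

theorem ordFun_mul_le (y z : R) : ordFun x (y * z) ≤ ordFun x y * ordFun x z := by
  rcases ordFun_cases (x := x) y with ⟨h, h'⟩ | ⟨m, h, h1, h2⟩
  · have : ordFun x (y * z) = 0 := by
      rcases ordFun_cases (x := x) (y * z) with ⟨h, -⟩ | ⟨m, -, -, h2⟩
      · exact h
      · exact absurd (Ideal.mul_mem_right _ _ (h' _)) h2
    rw [this, h, zero_mul]
  rcases ordFun_cases (x := x) z with ⟨h3, h'⟩ | ⟨m', h3, h1', h2'⟩
  · have : ordFun x (y * z) = 0 := by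
      rcases ordFun_cases (x := x) (y * z) with ⟨h, -⟩ | ⟨m, -, -, h2⟩
      · exact h
      · exact absurd (Ideal.mul_mem_left _ _ (h' _)) h2
    rw [this, h3, mul_zero]
  rw [h, h3, ← pow_add]
  exact ordFun_le_iff.2 (mul_mem_formFil h1 h1')

theorem ordFun_add_le (y z : R) : ordFun x (y + z) ≤ max (ordFun x y) (ordFun x z) := by
  refine ordFun_le_of_forall (le_max_of_le_left (ordFun_nonneg _)) fun n hn => ?_
  by_contra! hlt
  rw [max_lt_iff] at hlt
  have key : ∀ w : R, ordFun x w < (1 / 2) ^ n → w ∈ formFil x (n + 1) := by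
    intro w hw
    rcases ordFun_cases (x := x) w with ⟨-, h'⟩ | ⟨m, h, h1, -⟩
    · exact h' _
    · rw [h, pow_lt_pow_iff_right_of_lt_one₀ (by norm_num) (by norm_num)] at hw
      exact formFil_antitone hw h1
  have h := ordFun_le_iff.2 (add_mem (key y hlt.1) (key z hlt.2))
  rw [hn, pow_le_pow_iff_right_of_lt_one₀ (by norm_num) (by norm_num)] at h
  omega

theorem ordFun_le_one (y : R) : ordFun x y ≤ 1 := by
  have := ordFun_le_iff (x := x) (y := y) (n := 0)
  rw [pow_zero, formFil_zero] at this
  exact this.2 trivial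

theorem ordFun_neg (y : R) : ordFun x (-y) = ordFun x y := by
  have key : ∀ y : R, ordFun x (-y) ≤ ordFun x y := fun y => by
    have := (ordFun_mul_le (x := x) (-1) y).trans
      (mul_le_mul_of_nonneg_right (ordFun_le_one _) (ordFun_nonneg _))
    rwa [neg_one_mul, one_mul] at this
  refine le_antisymm (key y) ?_
  have := key (-y)
  rwa [neg_neg] at this

theorem ordFun_eval_mul {s : ℕ} {g : MvPolynomial (Fin (c + 1)) R} (hg : IsUnitForm s g) (y : R) :
    ordFun x (eval x g * y) = (1 / 2) ^ s * ordFun x y := by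
  apply le_antisymm
  · refine (ordFun_mul_le _ _).trans (mul_le_mul_of_nonneg_right ?_ (ordFun_nonneg _))
    exact ordFun_le_iff.2 (pow_le_formFil s (eval_mem_pow x hg.1))
  · rcases ordFun_cases (x := x) (eval x g * y) with ⟨h, h'⟩ | ⟨m, h, h1, h2⟩
    · rcases ordFun_cases (x := x) y with ⟨h3, -⟩ | ⟨m', h3, h1', h2'⟩
      · rw [h3, mul_zero]; exact ordFun_nonneg _
      · exact absurd (mem_formFil_of_mul hg (h' _)) h2'
    · rcases ordFun_cases (x := x) y with ⟨h3, -⟩ | ⟨m', h3, h1', h2'⟩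
      · rw [h3, mul_zero]; exact ordFun_nonneg _
      · rw [h, h3, ← pow_add, pow_le_pow_iff_right_of_lt_one₀ (by norm_num) (by norm_num)]
        by_contra! hlt
        refine h2' (mem_formFil_of_mul hg (formFil_antitone ?_ h1))
        omega

variable (x) in
/-- `ordFun` as a ring seminorm. -/
noncomputable def ordNorm : RingSeminorm R where
  toFun := ordFun x
  map_zero' := by
    rcases ordFun_cases (x := x) (0 : R) with ⟨h, -⟩ | ⟨m, -, -, h2⟩
    · exact h
    · exact absurd (zero_mem _) h2
  add_le' y z := (ordFun_add_le y z).trans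
    (max_le_add_of_nonneg (ordFun_nonneg _) (ordFun_nonneg _))
  neg' := ordFun_neg
  mul_le' := ordFun_mul_le

theorem ordNorm_one_le : ordNorm x 1 ≤ 1 := ordFun_le_one 1

theorem isNonarchimedean_ordNorm : IsNonarchimedean (ordNorm x) := ordFun_add_le

variable (x) in
/-- The power-multiplicative seminorm associated with the `(x)`-adic filtration. -/
noncomputable def nu : RingSeminorm R :=
  smoothingSeminorm (ordNorm x) ordNorm_one_le isNonarchimedean_ordNorm

theorem nu_le_ordFun (y : R) : nu x y ≤ ordFun x y := smoothingFun_le_self _ y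

theorem nu_nonneg (y : R) : 0 ≤ nu x y := apply_nonneg _ _

theorem nu_le_one (y : R) : nu x y ≤ 1 := (nu_le_ordFun y).trans (ordFun_le_one y)

theorem nu_add_le (y z : R) : nu x (y + z) ≤ max (nu x y) (nu x z) :=
  isNonarchimedean_smoothingFun _ ordNorm_one_le isNonarchimedean_ordNorm y z

theorem nu_mul_le (y z : R) : nu x (y * z) ≤ nu x y * nu x z := map_mul_le_mul _ _ _

theorem nu_eval_mul {s : ℕ} {g : MvPolynomial (Fin (c + 1)) R} (hg : IsUnitForm s g) (y : R) :
    nu x (eval x g * y) = (1 / 2) ^ s * nu x y := by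
  have h1 : ordNorm x (eval x g) = (1 / 2) ^ s * ordNorm x 1 := by
    have := ordFun_eval_mul (x := x) hg 1
    rwa [mul_one] at this
  have key : ∀ y, ordNorm x (eval x g * y) = (1 / 2) ^ s * ordNorm x y := ordFun_eval_mul hg
  by_cases h0 : ordNorm x 1 = 0
  · have h2 : ∀ y, nu x y = 0 := fun y => le_antisymm ((nu_le_ordFun y).trans (by
      have := map_mul_le_mul (ordNorm x) y 1
      rw [h0, mul_zero, mul_one] at this
      exact this)) (nu_nonneg y)
    rw [h2, h2, mul_zero]
  have h3 : ordNorm x 1 = 1 := le_antisymm ordNorm_one_le (by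
    have := map_mul_le_mul (ordNorm x) 1 1
    rw [mul_one] at this
    nlinarith [lt_of_le_of_ne (apply_nonneg (ordNorm x) 1) (Ne.symm h0)])
  rw [h3, mul_one] at h1
  have key' : ∀ y, ordNorm x (eval x g * y) = ordNorm x (eval x g) * ordNorm x y := fun y => by
    rw [key, h1]
  rw [nu, smoothingSeminorm_of_mul _ _ _ key', smoothingSeminorm_apply_of_map_mul_eq_mul _ _ _ key',
    h1]

theorem nu_pow (y : R) {n : ℕ} (hn : 1 ≤ n) : nu x (y ^ n) = nu x y ^ n :=
  isPowMul_smoothingFun _ ordNorm_one_le y hn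

theorem nu_pow_le (y : R) (n : ℕ) : nu x (y ^ n) ≤ nu x y ^ n := by
  rcases Nat.eq_zero_or_pos n with rfl | hn
  · rw [pow_zero, pow_zero]; exact nu_le_one 1
  · exact (nu_pow y hn).le

theorem eventually_ordFun_pow_le {y : R} {r : ℝ} (h : nu x y < r) :
    ∀ᶠ n : ℕ in Filter.atTop, ordFun x (y ^ n) ≤ r ^ n := by
  have := tendsto_smoothingFun_of_map_one_le_one (ordNorm x) ordNorm_one_le y
  filter_upwards [this.eventually_lt_const h, Filter.eventually_ge_atTop 1] with n hn h1
  have hn' : ordFun x (y ^ n) ^ (1 / n : ℝ) < r := hn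
  have h2 := pow_le_pow_left₀ (Real.rpow_nonneg (ordFun_nonneg _) _) hn'.le n
  rwa [one_div, Real.rpow_inv_natCast_pow (ordFun_nonneg _) (by omega)] at h2

theorem nu_le_of_mem_pow {n : ℕ} {y : R} (h : y ∈ Ideal.span (Set.range x) ^ n) :
    nu x y ≤ (1 / 2) ^ n := (nu_le_ordFun y).trans (ordFun_le_iff.2 (pow_le_formFil n h))

theorem nu_lt_one {N : ℕ} (hN : maximalIdeal R ^ N ≤ Ideal.span (Set.range x)) {y : R}
    (hy : y ∈ maximalIdeal R) : nu x y < 1 := by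
  by_contra! h
  have h1 : nu x y = 1 := le_antisymm (nu_le_one y) h
  have h2 : nu x (y ^ (N + 1)) ≤ (1 / 2) ^ 1 := nu_le_of_mem_pow (by
    rw [pow_one]
    exact hN (Ideal.pow_le_pow_right (Nat.le_succ N) (Ideal.pow_mem_pow hy _)))
  rw [nu_pow y (by omega), h1] at h2
  norm_num at h2

theorem nu_sum_lt {ι : Type*} (s : Finset ι) (f : ι → R) {r : ℝ} (hr : 0 < r)
    (h : ∀ i ∈ s, nu x (f i) < r) : nu x (∑ i ∈ s, f i) < r := by
  classical
  induction s using Finset.induction_on with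
  | empty => simpa using hr
  | insert a s ha ih =>
    rw [Finset.sum_insert ha]
    exact (nu_add_le _ _).trans_lt (max_lt (h a (Finset.mem_insert_self a s))
      (ih fun i hi => h i (Finset.mem_insert_of_mem hi)))

/-- Elements integral over `(x) ^ n` have order at least `n`. -/
theorem nu_le_of_integral {n m : ℕ} (hm : 0 < m) {y : R} (a : ℕ → R)
    (ha : ∀ j, 1 ≤ j → j ≤ m → a j ∈ (Ideal.span (Set.range x) ^ n) ^ j)
    (h : y ^ m + ∑ j ∈ Finset.Icc 1 m, a j * y ^ (m - j) = 0) : nu x y ≤ (1 / 2) ^ n := by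
  by_contra! hlt
  have hpos : 0 < nu x y := lt_trans (by positivity) hlt
  have h1 : nu x (∑ j ∈ Finset.Icc 1 m, a j * y ^ (m - j)) < nu x y ^ m := by
    refine nu_sum_lt _ _ (by positivity) fun j hj => ?_
    rw [Finset.mem_Icc] at hj
    have haj := ha j hj.1 hj.2
    rw [← pow_mul] at haj
    have h2 := nu_le_of_mem_pow haj
    calc nu x (a j * y ^ (m - j)) ≤ nu x (a j) * nu x (y ^ (m - j)) := nu_mul_le _ _
      _ ≤ ((1 / 2) ^ n) ^ j * nu x y ^ (m - j) := by
        rw [← pow_mul]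
        exact mul_le_mul h2 (nu_pow_le _ _) (nu_nonneg _) (by positivity)
      _ < nu x y ^ j * nu x y ^ (m - j) := by
        refine mul_lt_mul_of_pos_right ?_ (by positivity)
        exact pow_lt_pow_left₀ hlt (by positivity) (by omega)
      _ = nu x y ^ m := by rw [← pow_add]; congr 1; omega
  rw [eq_neg_of_add_eq_zero_right h, map_neg_eq_map, nu_pow y hm] at h1
  exact lt_irrefl _ h1

end OrdNorm

end NormalChern

namespace NormalChern

open Module IsLocalRing MvPolynomial

theorem exists_lt_formSum (c C : ℕ) : ∃ n, C * (n + 1) ^ c < formSum c n := by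
  set n := C * 2 ^ c * (c + 1).factorial with hn
  refine ⟨n + 1, ?_⟩
  have h1 : formSum c (n + 1) = formDim (c + 1) n := by
    rw [formSum_eq, formDim]
    congr 1
    ring
  have h2 := pow_le_formDim (c + 1) n
  rw [← h1] at h2
  have h3 : (n + 1 + 1) ^ c ≤ 2 ^ c * (n + 1) ^ c := by
    rw [← mul_pow]
    exact Nat.pow_le_pow_left (by omega) _
  have h4 : 0 < (c + 1).factorial := Nat.factorial_pos _
  refine lt_of_mul_lt_mul_left (a := (c + 1).factorial) ?_ (Nat.zero_le _)
  refine lt_of_lt_of_le ?_ h2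
  calc (c + 1).factorial * (C * (n + 1 + 1) ^ c) ≤ (c + 1).factorial * (C * (2 ^ c * (n + 1) ^ c)) := by
        gcongr
    _ = n * (n + 1) ^ c := by rw [hn]; ring
    _ < (n + 1) * (n + 1) ^ c := Nat.mul_lt_mul_of_pos_right (Nat.lt_succ_self _) (by positivity)
    _ = (n + 1) ^ (c + 1) := by ring

section

variable {R : Type*} [CommRing R] [IsLocalRing R] {c : ℕ} {x : Fin (c + 1) → R}

theorem exists_isHomogeneous_of_mem_maximalIdeal_mul {m : ℕ} {y : R}
    (h : y ∈ maximalIdeal R * Ideal.span (Set.range x) ^ m) :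
    ∃ q : MvPolynomial (Fin (c + 1)) R, q.IsHomogeneous m ∧ map (residue R) q = 0 ∧
      eval x q = y := by
  refine Submodule.mul_induction_on h ?_ ?_
  · intro r hr z hz
    obtain ⟨q, hq, rfl⟩ := (Ideal.mem_span_pow_iff_exists_isHomogeneous x _).1 hz
    refine ⟨C r * q, by simpa using (isHomogeneous_C _ r).mul hq, ?_, by simp⟩
    rw [map_mul, map_C, (residue_eq_zero_iff r).2 hr, C_0, zero_mul]
  · rintro y z ⟨q, hq, h0, rfl⟩ ⟨r, hr, h1, rfl⟩
    exact ⟨q + r, hq.add hr, by rw [map_add, h0, h1, add_zero], map_add _ _ _⟩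

theorem formSum_le_length (hQ : Ideal.span (Set.range x) ≤ maximalIdeal R) {a : Ideal R}
    (ha : ∀ s g, IsUnitForm (c := c) s g → eval x g ∉ a) (n : ℕ) :
    (formSum c n : ℕ∞) ≤ Module.length R (R ⧸ (a ⊔ Ideal.span (Set.range x) ^ n)) := by
  set Q := Ideal.span (Set.range x) with hQdef
  have h1 := relLength_chain (fun m => a ⊔ Q ^ m)
    (fun m n h => sup_le_sup_left (Ideal.pow_le_pow_right h) a) n
  simp only [pow_zero, Ideal.one_eq_top, sup_top_eq, relLength_top] at h1
  rw [h1, formSum, Nat.cast_sum]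
  refine Finset.sum_le_sum fun m _ => ?_
  have h2 : relLength (a ⊔ Q ^ (m + 1)) (a ⊔ Q ^ m) =
      relLength (a ⊔ Q ^ (m + 1)) (Ideal.span {1} * Q ^ m) := by
    rw [← relLength_sup_left _ (Ideal.span {1} * Q ^ m)]
    congr 1
    have h3 : Q ^ (m + 1) ≤ Q ^ m := Ideal.pow_le_pow_right m.le_succ
    rw [Ideal.span_singleton_one, Ideal.top_mul, sup_left_comm, sup_of_le_left h3]
  rw [h2]
  refine formDim_le_relLength' x fun p hp hpa => ?_
  rw [one_mul] at hpa
  obtain ⟨u, hu, v, hv, huv⟩ := Submodule.mem_sup.1 hpa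
  obtain ⟨q, hq, hq0, rfl⟩ := exists_isHomogeneous_of_mem_maximalIdeal_mul
    ((pow_succ' Q m ▸ Ideal.mul_mono_left hQ : Q ^ (m + 1) ≤ _) hv)
  by_contra hp0
  refine ha m (p - q) ⟨hp.sub hq, by rwa [map_sub, hq0, sub_zero]⟩ ?_
  rwa [map_sub, ← huv, add_sub_cancel_right]

theorem exists_unitForm_mem [IsNoetherianRing R] (hQ : Ideal.span (Set.range x) ≤ maximalIdeal R)
    {N : ℕ} (hN : maximalIdeal R ^ N ≤ Ideal.span (Set.range x)) (p : Ideal R) [p.IsPrime]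
    {y : R} (hy : y ∉ p) : ∃ s g, IsUnitForm (c := c) s g ∧ eval x g ∈ p ⊔ Ideal.span {y} := by
  by_contra! H
  obtain ⟨S⟩ := exists_simpleChain hN
  obtain ⟨C, hC⟩ := exists_length_quotient_pow_le S
  obtain ⟨C', hC'⟩ := growth_drop (Ideal.span (Set.range x)) p hy (c := c)
    (C := (goodSteps S).card * (c + 1) ^ c + C) fun n => by
      refine (length_quotient_anti le_sup_right).trans ((hC n).trans ?_)
      have h1 : formSum c n ≤ (n + 1) * ((c + 1) ^ c * (n + 1) ^ c) := by
        refine (Finset.sum_le_card_nsmul _ _ ((c + 1) ^ c * (n + 1) ^ c) fun j hj => ?_).trans ?_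
        · exact (formDim_mono c (Finset.mem_range.1 hj).le).trans (formDim_le c n)
        · rw [Finset.card_range, smul_eq_mul]
          exact Nat.mul_le_mul_right _ n.le_succ
      norm_cast
      calc _ ≤ (goodSteps S).card * ((n + 1) * ((c + 1) ^ c * (n + 1) ^ c)) +
            C * ((n + 1) ^ c * (n + 1)) := by
              gcongr
              exact Nat.le_mul_of_pos_right _ n.succ_pos
        _ = _ := by ring
  obtain ⟨n, hn⟩ := exists_lt_formSum c C'
  have h := (formSum_le_length hQ H n).trans (hC' n)
  exact absurd (ENat.natCast_le_natCast.1 h) (not_le.2 hn)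

theorem MaxGrowth.eq_zero_of_nu_eq_zero [IsNoetherianRing R] [IsReduced R] (hx : MaxGrowth x)
    (hQ : Ideal.span (Set.range x) ≤ maximalIdeal R)
    {N : ℕ} (hN : maximalIdeal R ^ N ≤ Ideal.span (Set.range x)) {y : R} (h : nu x y = 0) :
    y = 0 := by
  by_contra hy
  have hp : ∃ p ∈ associatedPrimes R (Ideal.span {y}), True := by
    have : Nontrivial (Ideal.span {y}) := by
      rw [Submodule.nontrivial_iff_ne_bot]
      simpa using hy
    obtain ⟨p, hp⟩ := associatedPrimes.nonempty R (Ideal.span {y})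
    exact ⟨p, hp, trivial⟩
  obtain ⟨p, ⟨hpp, ⟨q, hq⟩, hpq⟩, -⟩ := hp
  have hpq' : ∀ a, a ∈ p ↔ a * q = 0 := by
    intro a
    have h1 : ∀ n : ℕ, a ^ n ∈ (⊥ : Submodule R (Ideal.span {y})).colon {⟨q, hq⟩} ↔
        a ^ n * q = 0 := by
      intro n
      rw [Submodule.mem_colon_singleton, Submodule.mem_bot, ← Subtype.coe_inj]
      simp
    rw [hpq]
    constructor
    · rintro ⟨n, hn⟩
      rw [h1] at hn
      refine eq_zero_of_pow_eq_zero (n := n + 1) ?_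
      linear_combination a * q ^ n * hn
    · intro h
      exact ⟨1, (h1 1).2 (by rwa [pow_one])⟩
  have hq0 : q ≠ 0 := by
    rintro rfl
    exact hpp.ne_top ((Ideal.eq_top_iff_one _).2 ((hpq' 1).2 (by simp)))
  have hyp : y ∉ p := by
    intro hyp
    obtain ⟨r, hr⟩ := Ideal.mem_span_singleton'.1 hq
    refine hq0 (pow_eq_zero_iff (two_ne_zero) |>.1 (?_ : q ^ 2 = 0))
    rw [pow_two]
    nth_rw 1 [← hr]
    rw [mul_assoc, (hpq' y).1 hyp, mul_zero]
  obtain ⟨s, g, hg, hgm⟩ := exists_unitForm_mem hQ hN p hyp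
  obtain ⟨u, hu, v, hv, huv⟩ := Submodule.mem_sup.1 hgm
  obtain ⟨z, rfl⟩ := Ideal.mem_span_singleton'.1 hv
  have hpow : ∀ i, eval x g ^ i * q = (z * y) ^ i * q := by
    intro i
    induction i with
    | zero => simp
    | succ i ih =>
      have h0 : eval x g * q = (z * y) * q := by rw [← huv, add_mul, (hpq' u).1 hu, zero_add]
      rw [pow_succ, mul_assoc, h0, mul_left_comm, ih, pow_succ]
      ring
  have hord : ∀ i, ordFun x (eval x g ^ i * q) = ((1 / 2) ^ s) ^ i * ordFun x q := by
    intro i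
    induction i with
    | zero => simp
    | succ i ih => rw [pow_succ', mul_assoc, ordFun_eval_mul hg, ih]; ring
  have hev := eventually_ordFun_pow_le (x := x) (y := y) (r := (1 / 2) ^ (s + 1))
    (by rw [h]; positivity)
  have hq1 : ordFun x q ≠ 0 := by
    intro h0
    refine hq0 (hx.eq_zero_of_forall_mem_formFil hN fun n => ordFun_le_iff.1 ?_)
    rw [h0]; positivity
  have hqpos : 0 < ordFun x q := lt_of_le_of_ne (ordFun_nonneg q) hq1.symm
  obtain ⟨i, hi, hi1⟩ := (hev.and (Filter.eventually_ge_atTop 1)).exists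
  have h1 : ((1 / 2 : ℝ) ^ s) ^ i * ordFun x q ≤ ((1 / 2) ^ (s + 1)) ^ i * ordFun x q := by
    rw [← hord, hpow, mul_pow, mul_assoc, mul_comm (z ^ i)]
    refine (ordFun_mul_le _ _).trans ?_
    refine (mul_le_of_le_one_right (ordFun_nonneg _) (ordFun_le_one _)).trans ?_
    refine (ordFun_mul_le _ _).trans (mul_le_mul_of_nonneg_right hi hqpos.le)
  have h2 := le_of_mul_le_mul_right h1 hqpos
  have h3 : ((1 / 2 : ℝ) ^ (s + 1)) ^ i < ((1 / 2) ^ s) ^ i :=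
    pow_lt_pow_left₀ (pow_lt_pow_right_of_lt_one₀ (by norm_num) (by norm_num) s.lt_succ_self)
      (by positivity) (by omega)
  exact absurd h2 (not_le.2 h3)

theorem MaxGrowth.exists_formFil_le [IsNoetherianRing R] [IsAdicComplete (maximalIdeal R) R]
    (hx : MaxGrowth x) {N : ℕ} (hN : maximalIdeal R ^ N ≤ Ideal.span (Set.range x)) :
    ∃ k, ∀ n, formFil x (n + k) ≤ Ideal.span (Set.range x) ^ n := by
  obtain ⟨k, hk⟩ := hx.exists_mem_pow_of_mul_mem hN
  exact ⟨k, fun n y ⟨s, g, hg, h⟩ => hk n s g y hg h⟩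

end

end NormalChern

namespace NormalChern

open Module IsLocalRing MvPolynomial

section Graded

variable {R : Type*} [CommRing R] [IsLocalRing R] {c : ℕ} (x : Fin (c + 1) → R)

/-- The ideal of elements of value at least `t`. -/
noncomputable def valLe (t : ℝ) : Ideal R where
  carrier := {y | nu x y ≤ (1 / 2 : ℝ) ^ t}
  zero_mem' := by
    change nu x 0 ≤ _
    rw [map_zero]; positivity
  add_mem' := fun {y z} hy hz => (nu_add_le y z).trans (max_le hy hz)
  smul_mem' := fun a y hy => (nu_mul_le a y).trans
    ((mul_le_of_le_one_left (nu_nonneg y) (nu_le_one a)).trans hy)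

/-- The ideal of elements of value greater than `t`. -/
noncomputable def valLt (t : ℝ) : Ideal R where
  carrier := {y | nu x y < (1 / 2 : ℝ) ^ t}
  zero_mem' := by
    change nu x 0 < _
    rw [map_zero]; positivity
  add_mem' := fun {y z} hy hz => (nu_add_le y z).trans_lt (max_lt hy hz)
  smul_mem' := fun a y hy => (nu_mul_le a y).trans_lt
    ((mul_le_of_le_one_left (nu_nonneg y) (nu_le_one a)).trans_lt hy)

variable {x}

theorem mem_valLe {t : ℝ} {y : R} : y ∈ valLe x t ↔ nu x y ≤ (1 / 2 : ℝ) ^ t := Iff.rfl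

theorem mem_valLt {t : ℝ} {y : R} : y ∈ valLt x t ↔ nu x y < (1 / 2 : ℝ) ^ t := Iff.rfl

theorem valLt_le_valLe (t : ℝ) : valLt x t ≤ valLe x t := fun _ h =>
  le_of_lt (mem_valLt.1 h)

theorem valLe_antitone : Antitone (valLe x) := fun _ _ h _ hy =>
  le_trans hy (Real.rpow_le_rpow_of_exponent_ge (by norm_num) (by norm_num) h)

theorem valLe_le_valLt {s t : ℝ} (h : s < t) : valLe x t ≤ valLt x s := fun _ hy =>
  lt_of_le_of_lt hy (Real.rpow_lt_rpow_of_exponent_gt (by norm_num) (by norm_num) h)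

theorem valLe_zero : valLe x 0 = ⊤ := by
  refine top_le_iff.1 fun y _ => ?_
  rw [mem_valLe, Real.rpow_zero]
  exact nu_le_one y

theorem mul_mem_valLe {s t : ℝ} {y z : R} (hy : y ∈ valLe x s) (hz : z ∈ valLe x t) :
    y * z ∈ valLe x (s + t) := by
  rw [mem_valLe, Real.rpow_add (by norm_num)]
  exact (nu_mul_le y z).trans (mul_le_mul hy hz (nu_nonneg z) (by positivity))

theorem mul_mem_valLt_right {s t : ℝ} {y z : R} (hy : y ∈ valLe x s) (hz : z ∈ valLt x t) :
    y * z ∈ valLt x (s + t) := by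
  rw [mem_valLt, Real.rpow_add (by norm_num)]
  exact (nu_mul_le y z).trans_lt (mul_lt_mul' hy hz (nu_nonneg z) (by positivity))

theorem mul_mem_valLt_left {s t : ℝ} {y z : R} (hy : y ∈ valLt x s) (hz : z ∈ valLe x t) :
    y * z ∈ valLt x (s + t) := by
  rw [mul_comm, add_comm s]
  exact mul_mem_valLt_right hz hy

theorem pow_mem_valLe {t : ℝ} {y : R} (hy : y ∈ valLe x t) (n : ℕ) : y ^ n ∈ valLe x (n * t) := by
  rw [mem_valLe, mul_comm, Real.rpow_mul_natCast (by norm_num)]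
  exact (nu_pow_le y n).trans (pow_le_pow_left₀ (nu_nonneg y) hy n)

theorem pow_mem_valLt_iff {t : ℝ} {y : R} {n : ℕ} (hn : 1 ≤ n) :
    y ^ n ∈ valLt x (n * t) ↔ y ∈ valLt x t := by
  rw [mem_valLt, mul_comm, Real.rpow_mul_natCast (by norm_num), nu_pow y hn,
    pow_lt_pow_iff_left₀ (nu_nonneg y) (by positivity) (by omega)]
  rfl

theorem eval_mul_mem_valLe_iff {s : ℕ} {t : ℝ} {g : MvPolynomial (Fin (c + 1)) R}
    (hg : IsUnitForm s g) {y : R} : eval x g * y ∈ valLe x (s + t) ↔ y ∈ valLe x t := by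
  rw [mem_valLe, Real.rpow_add (by norm_num), nu_eval_mul hg, Real.rpow_natCast,
    mul_le_mul_iff_right₀ (by positivity)]
  rfl

theorem eval_mul_mem_valLt_iff {s : ℕ} {t : ℝ} {g : MvPolynomial (Fin (c + 1)) R}
    (hg : IsUnitForm s g) {y : R} : eval x g * y ∈ valLt x (s + t) ↔ y ∈ valLt x t := by
  rw [mem_valLt, Real.rpow_add (by norm_num), nu_eval_mul hg, Real.rpow_natCast,
    mul_lt_mul_iff_right₀ (by positivity)]
  rfl

theorem pow_le_valLe (n : ℕ) : Ideal.span (Set.range x) ^ n ≤ valLe x n := fun y hy => by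
  rw [mem_valLe, Real.rpow_natCast]
  exact nu_le_of_mem_pow hy

theorem eval_mem_valLe {s : ℕ} {g : MvPolynomial (Fin (c + 1)) R} (hg : g.IsHomogeneous s) :
    eval x g ∈ valLe x s := pow_le_valLe s (eval_mem_pow x hg)

theorem maximalIdeal_mul_pow_le_valLt {N : ℕ}
    (hN : maximalIdeal R ^ N ≤ Ideal.span (Set.range x)) (n : ℕ) :
    maximalIdeal R * Ideal.span (Set.range x) ^ n ≤ valLt x n := by
  refine Ideal.mul_le.2 fun a ha y hy => ?_
  rw [mem_valLt, Real.rpow_natCast]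
  refine (nu_mul_le a y).trans_lt ?_
  calc nu x a * nu x y ≤ nu x a * (1 / 2) ^ n :=
        mul_le_mul_of_nonneg_left (nu_le_of_mem_pow hy) (nu_nonneg a)
    _ < 1 * (1 / 2) ^ n := mul_lt_mul_of_pos_right (nu_lt_one hN ha) (by positivity)
    _ = _ := one_mul _

theorem exists_value {y : R} (hy : nu x y ≠ 0) : ∃ t : ℝ, 0 ≤ t ∧ nu x y = (1 / 2 : ℝ) ^ t := by
  have hpos : 0 < nu x y := lt_of_le_of_ne (nu_nonneg y) hy.symm
  have h : nu x y = (1 / 2 : ℝ) ^ (Real.logb (1 / 2) (nu x y)) :=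
    (Real.rpow_logb (by norm_num) (by norm_num) hpos).symm
  refine ⟨Real.logb (1 / 2) (nu x y), ?_, h⟩
  by_contra! hlt
  have h1 := Real.rpow_lt_rpow_of_exponent_gt (x := 1 / 2) (by norm_num) (by norm_num) hlt
  rw [← h, Real.rpow_zero] at h1
  exact absurd h1 (not_lt.2 (nu_le_one y))

variable (x) in
/-- The extended Rees algebra of the filtration by values. -/
noncomputable def valRees : Subring (AddMonoidAlgebra R ℝ) where
  carrier := {p | ∀ t, p.coeff t ∈ valLe x t}
  zero_mem' := fun t => zero_mem _
  add_mem' := fun hp hq t => add_mem (hp t) (hq t)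
  neg_mem' := fun hp t => neg_mem (hp t)
  one_mem' := fun t => by
    rw [AddMonoidAlgebra.one_def, AddMonoidAlgebra.coeff_single, Finsupp.single_apply]
    split_ifs with h
    · rw [← h, valLe_zero]; trivial
    · exact zero_mem _
  mul_mem' := fun {p q} hp hq t => by
    rw [AddMonoidAlgebra.coeff_mul_apply_left]
    refine Ideal.sum_mem _ fun a _ => ?_
    have := mul_mem_valLe (hp a) (hq (-a + t))
    rwa [add_neg_cancel_left] at this

variable (x) in
/-- The kernel of the projection to the associated graded ring. -/
noncomputable def valReesPos : Ideal (valRees x) where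
  carrier := {p | ∀ t, p.1.coeff t ∈ valLt x t}
  zero_mem' := fun t => zero_mem _
  add_mem' := fun hp hq t => add_mem (hp t) (hq t)
  smul_mem' := fun p q hq t => by
    change (p.1 * q.1).coeff t ∈ _
    rw [AddMonoidAlgebra.coeff_mul_apply_left]
    refine Ideal.sum_mem _ fun a _ => ?_
    have := mul_mem_valLt_right (p.2 a) (hq (-a + t))
    rwa [add_neg_cancel_left] at this

theorem mem_valReesPos {p : valRees x} : p ∈ valReesPos x ↔ ∀ t, p.1.coeff t ∈ valLt x t := Iff.rfl

theorem mul_leading {p q : valRees x} {a b : ℝ} (hp : ∀ t, a < t → p.1.coeff t ∈ valLt x t)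
    (hq : ∀ t, b < t → q.1.coeff t ∈ valLt x t) :
    (p * q).1.coeff (a + b) - p.1.coeff a * q.1.coeff b ∈ valLt x (a + b) := by
  change (p.1 * q.1).coeff (a + b) - _ ∈ _
  rw [AddMonoidAlgebra.coeff_mul_apply_left, ← Ideal.Quotient.mk_eq_mk_iff_sub_mem,
    Finsupp.sum, map_sum, Finset.sum_eq_single a]
  · rw [neg_add_cancel_left]
  · intro d _ hd
    rw [Ideal.Quotient.eq_zero_iff_mem]
    have he : d + (-d + (a + b)) = a + b := by ring
    rcases lt_or_gt_of_ne hd with h | h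
    · have := mul_mem_valLt_right (p.2 d) (hq (-d + (a + b)) (by linarith))
      rwa [he] at this
    · have := mul_mem_valLt_left (hp d h) (q.2 (-d + (a + b)))
      rwa [he] at this
  · intro h
    rw [Finsupp.notMem_support_iff.1 h, zero_mul, map_zero]

theorem exists_leading {p : valRees x} (hp : p ∉ valReesPos x) :
    ∃ a, p.1.coeff a ∉ valLt x a ∧ ∀ t, a < t → p.1.coeff t ∈ valLt x t := by
  classical
  set s := p.1.coeff.support.filter (fun a => p.1.coeff a ∉ valLt x a) with hs
  have hne : s.Nonempty := by
    by_contra h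
    refine hp fun t => ?_
    by_contra ht
    refine h ⟨t, Finset.mem_filter.2 ⟨Finsupp.mem_support_iff.2 fun h0 => ht ?_, ht⟩⟩
    rw [h0]; exact zero_mem _
  refine ⟨s.max' hne, (Finset.mem_filter.1 (s.max'_mem hne)).2, fun t ht => ?_⟩
  by_contra h
  refine absurd (s.le_max' t (Finset.mem_filter.2 ⟨Finsupp.mem_support_iff.2 fun h0 => h ?_, h⟩))
    (not_le.2 ht)
  rw [h0]; exact zero_mem _

variable (x) in
/-- The associated graded ring of the filtration by values. -/
abbrev ValGr : Type _ := valRees x ⧸ valReesPos x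

instance : IsReduced (ValGr x) := by
  refine (isReduced_iff_pow_one_lt 2 one_lt_two).2 fun g hg => ?_
  obtain ⟨p, rfl⟩ := Ideal.Quotient.mk_surjective g
  by_contra h
  rw [Ideal.Quotient.eq_zero_iff_mem] at h
  obtain ⟨a, ha, hlt⟩ := exists_leading h
  rw [← map_pow, Ideal.Quotient.eq_zero_iff_mem, pow_two] at hg
  have h1 := sub_mem (hg (a + a)) (mul_leading hlt hlt)
  rw [sub_sub_cancel, ← pow_two, ← two_mul] at h1
  exact ha ((pow_mem_valLt_iff (n := 2) one_le_two).1 (by exact_mod_cast h1))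

/-- The class of an element `y` of value at least `t` in degree `t`. -/
noncomputable def cls (t : ℝ) (y : R) (hy : y ∈ valLe x t) : ValGr x :=
  Ideal.Quotient.mk _ ⟨AddMonoidAlgebra.single t y, fun s => by
    rw [AddMonoidAlgebra.coeff_single, Finsupp.single_apply]
    split_ifs with h
    · exact h ▸ hy
    · exact zero_mem _⟩

theorem cls_congr {s t : ℝ} {y z : R} (hst : s = t) (hyz : y = z) (hy : y ∈ valLe x s) :
    cls s y hy = cls t z (hst ▸ hyz ▸ hy) := by
  subst hst hyz; rfl

theorem cls_eq_zero_iff {t : ℝ} {y : R} {hy : y ∈ valLe x t} : cls t y hy = 0 ↔ y ∈ valLt x t := by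
  rw [cls, Ideal.Quotient.eq_zero_iff_mem, mem_valReesPos]
  constructor
  · intro h
    simpa [AddMonoidAlgebra.coeff_single] using h t
  · intro h s
    rw [AddMonoidAlgebra.coeff_single, Finsupp.single_apply]
    split_ifs with h'
    · exact h' ▸ h
    · exact zero_mem _

theorem cls_add {t : ℝ} {y z : R} (hy : y ∈ valLe x t) (hz : z ∈ valLe x t) :
    cls t (y + z) (add_mem hy hz) = cls t y hy + cls t z hz := by
  rw [cls, cls, cls, ← map_add]
  congr 1
  exact Subtype.ext (AddMonoidAlgebra.single_add _ _ _)

theorem cls_sub {t : ℝ} {y z : R} (hy : y ∈ valLe x t) (hz : z ∈ valLe x t) :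
    cls t (y - z) (sub_mem hy hz) = cls t y hy - cls t z hz := by
  rw [eq_sub_iff_add_eq, ← cls_add]
  exact cls_congr rfl (sub_add_cancel _ _) _

theorem cls_eq_iff {t : ℝ} {y z : R} {hy : y ∈ valLe x t} {hz : z ∈ valLe x t} :
    cls t y hy = cls t z hz ↔ y - z ∈ valLt x t := by
  rw [← sub_eq_zero, ← cls_sub, cls_eq_zero_iff]

theorem cls_mul {s t : ℝ} {y z : R} (hy : y ∈ valLe x s) (hz : z ∈ valLe x t) :
    cls s y hy * cls t z hz = cls (s + t) (y * z) (mul_mem_valLe hy hz) := by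
  rw [cls, cls, cls, ← map_mul]
  congr 1
  exact Subtype.ext (AddMonoidAlgebra.single_mul_single _ _ _ _)

theorem cls_zero {t : ℝ} : cls (x := x) t 0 (zero_mem _) = 0 := cls_eq_zero_iff.2 (zero_mem _)

theorem cls_one : cls (x := x) 0 1 (valLe_zero (x := x) ▸ trivial) = 1 := by
  rw [cls, ← map_one (Ideal.Quotient.mk (valReesPos x))]
  rfl

theorem cls_pow {t : ℝ} {y : R} (hy : y ∈ valLe x t) (n : ℕ) :
    cls t y hy ^ n = cls (n * t) (y ^ n) (pow_mem_valLe hy n) := by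
  induction n with
  | zero => rw [pow_zero, ← cls_one]; exact cls_congr (by simp) (by simp) _
  | succ n ih =>
    rw [pow_succ, ih, cls_mul]
    exact cls_congr (by push_cast; ring) (pow_succ _ _).symm _

theorem cls_sum {ι : Type*} {t : ℝ} (s : Finset ι) (y : ι → R) (hy : ∀ i, y i ∈ valLe x t) :
    cls t (∑ i ∈ s, y i) (sum_mem fun i _ => hy i) = ∑ i ∈ s, cls t (y i) (hy i) := by
  classical
  induction s using Finset.induction_on with
  | empty => exact cls_zero
  | insert a s ha ih =>
    rw [cls_congr rfl (Finset.sum_insert ha), cls_add (hy a) (sum_mem fun i _ => hy i), ih,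
      Finset.sum_insert ha]

theorem closure_cls : AddSubmonoid.closure
    {g : ValGr x | ∃ t y, ∃ hy : y ∈ valLe x t, g = cls t y hy} = ⊤ := by
  refine top_le_iff.1 fun g _ => ?_
  obtain ⟨p, rfl⟩ := Ideal.Quotient.mk_surjective g
  have h : p = ∑ t ∈ p.1.coeff.support, ⟨AddMonoidAlgebra.single t (p.1.coeff t), fun s => by
      rw [AddMonoidAlgebra.coeff_single, Finsupp.single_apply]
      split_ifs with h
      · exact h ▸ p.2 t
      · exact zero_mem _⟩ := by
    refine Subtype.ext ?_
    rw [AddSubmonoidClass.coe_finsetSum]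
    exact (AddMonoidAlgebra.sum_coeff_single p.1).symm
  rw [h, map_sum]
  exact sum_mem fun t _ => AddSubmonoid.subset_closure ⟨t, _, p.2 t, rfl⟩

variable (x) in
/-- The evaluation of polynomials into the Rees algebra. -/
noncomputable def reesEvalAux : MvPolynomial (Fin (c + 1)) R →ₐ[R] AddMonoidAlgebra R ℝ :=
  aeval fun i => AddMonoidAlgebra.single 1 (x i)

omit [IsLocalRing R] in
theorem reesEvalAux_of_isHomogeneous {s : ℕ} {P : MvPolynomial (Fin (c + 1)) R}
    (hP : P.IsHomogeneous s) :
    reesEvalAux x P = AddMonoidAlgebra.single (s : ℝ) (eval x P) := by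
  have h1 : ∀ e : Fin (c + 1) →₀ ℕ, e.prod (fun i k => (AddMonoidAlgebra.single (1 : ℝ) (x i)) ^ k) =
      AddMonoidAlgebra.single (e.degree : ℝ) (∏ i ∈ e.support, x i ^ e i) := by
    intro e
    rw [Finsupp.prod, Finsupp.degree_apply]
    simp_rw [AddMonoidAlgebra.single_pow]
    rw [AddMonoidAlgebra.prod_single]
    simp
  rw [eval_eq, ← AddMonoidAlgebra.singleAddHom_apply, map_sum]
  conv_lhs => rw [P.as_sum, map_sum]
  refine Finset.sum_congr rfl fun e he => ?_
  rw [reesEvalAux, aeval_monomial, h1]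
  have h2 : e.degree = s := by
    rw [Finsupp.degree_eq_weight_one]
    exact hP (mem_support_iff.1 he)
  rw [h2]
  change AddMonoidAlgebra.single 0 _ * _ = _
  rw [AddMonoidAlgebra.single_mul_single, zero_add]
  rfl

theorem reesEvalAux_mem (P : MvPolynomial (Fin (c + 1)) R) : reesEvalAux x P ∈ valRees x := by
  rw [← P.sum_homogeneousComponent, map_sum]
  refine sum_mem fun n _ => ?_
  rw [reesEvalAux_of_isHomogeneous (homogeneousComponent_isHomogeneous n P)]
  intro t
  rw [AddMonoidAlgebra.coeff_single, Finsupp.single_apply]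
  split_ifs with h
  · rw [← h]; exact eval_mem_valLe (homogeneousComponent_isHomogeneous n P)
  · exact zero_mem _

omit [IsLocalRing R] in
theorem coeff_reesEvalAux_natCast (P : MvPolynomial (Fin (c + 1)) R) (n : ℕ) :
    (reesEvalAux x P).coeff n = eval x (homogeneousComponent n P) := by
  conv_lhs => rw [← P.sum_homogeneousComponent, map_sum]
  rw [AddMonoidAlgebra.coeff_sum, Finsupp.finsetSum_apply, Finset.sum_eq_single n]
  · rw [reesEvalAux_of_isHomogeneous (homogeneousComponent_isHomogeneous n P),
      AddMonoidAlgebra.coeff_single, Finsupp.single_eq_same]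
  · intro m _ hm
    rw [reesEvalAux_of_isHomogeneous (homogeneousComponent_isHomogeneous m P),
      AddMonoidAlgebra.coeff_single, Finsupp.single_eq_of_ne]
    exact_mod_cast hm.symm
  · intro h
    rw [homogeneousComponent_eq_zero n P (by simpa using h), map_zero]
    rfl

omit [IsLocalRing R] in
theorem coeff_reesEvalAux_of_forall_ne (P : MvPolynomial (Fin (c + 1)) R) {t : ℝ}
    (ht : ∀ n : ℕ, (n : ℝ) ≠ t) : (reesEvalAux x P).coeff t = 0 := by
  conv_lhs => rw [← P.sum_homogeneousComponent, map_sum]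
  rw [AddMonoidAlgebra.coeff_sum, Finsupp.finsetSum_apply, Finset.sum_eq_zero]
  intro n _
  rw [reesEvalAux_of_isHomogeneous (homogeneousComponent_isHomogeneous n P),
    AddMonoidAlgebra.coeff_single, Finsupp.single_eq_of_ne (ht n).symm]

variable (x) in
/-- The evaluation of polynomials into the Rees algebra. -/
noncomputable def reesEval : MvPolynomial (Fin (c + 1)) R →+* valRees x :=
  (reesEvalAux x).toRingHom.codRestrict _ reesEvalAux_mem

theorem coe_reesEval (P : MvPolynomial (Fin (c + 1)) R) : (reesEval x P).1 = reesEvalAux x P := rfl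

theorem mk_reesEval {s : ℕ} {P : MvPolynomial (Fin (c + 1)) R} (hP : P.IsHomogeneous s) :
    Ideal.Quotient.mk (valReesPos x) (reesEval x P) = cls s (eval x P) (eval_mem_valLe hP) := by
  rw [cls]
  congr 1
  exact Subtype.ext (reesEvalAux_of_isHomogeneous hP)

variable [hN : Fact (∃ N, maximalIdeal R ^ N ≤ Ideal.span (Set.range x))]

theorem cls_maximalIdeal {a : R} (ha : a ∈ maximalIdeal R) (h : a ∈ valLe x 0) :
    cls 0 a h = 0 := by
  obtain ⟨N, hN⟩ := hN.out
  have h1 := maximalIdeal_mul_pow_le_valLt (x := x) hN 0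
  rw [pow_zero, mul_one, Nat.cast_zero] at h1
  exact cls_eq_zero_iff.2 (h1 ha)

variable (x) in
/-- The map from the residue field to the associated graded ring. -/
noncomputable def residueMap : ResidueField R →+* ValGr x :=
  Ideal.Quotient.lift (maximalIdeal R)
    (((Ideal.Quotient.mk (valReesPos x)).comp (reesEval x)).comp C) fun a ha => by
      have h := mk_reesEval (x := x) (isHomogeneous_C (Fin (c + 1)) a)
      refine h.trans ?_
      have h1 : a ∈ valLe x 0 := by rw [valLe_zero]; trivial
      exact (cls_congr (by simp) (eval_C a) _).trans (cls_maximalIdeal ha h1)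

variable (x) in
/-- The structure map of the associated graded ring as an algebra over the polynomial ring. -/
noncomputable def valGrMap : MvPolynomial (Fin (c + 1)) (ResidueField R) →+* ValGr x :=
  eval₂Hom (residueMap x) fun i => Ideal.Quotient.mk (valReesPos x) (reesEval x (X i))

noncomputable instance : Algebra (MvPolynomial (Fin (c + 1)) (ResidueField R)) (ValGr x) :=
  (valGrMap x).toAlgebra

theorem algebraMap_map_residue (P : MvPolynomial (Fin (c + 1)) R) :
    algebraMap (MvPolynomial (Fin (c + 1)) (ResidueField R)) (ValGr x) (map (residue R) P) =
      Ideal.Quotient.mk (valReesPos x) (reesEval x P) := by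
  have h : (valGrMap x).comp (map (residue R)) =
      (Ideal.Quotient.mk (valReesPos x)).comp (reesEval x) := by
    refine ringHom_ext (fun r => ?_) fun i => ?_
    · rw [RingHom.comp_apply, map_C, valGrMap, eval₂Hom_C]
      rfl
    · rw [RingHom.comp_apply, map_X, valGrMap, eval₂Hom_X']
      rfl
  exact RingHom.congr_fun h P

theorem algebraMap_form {s : ℕ} {P : MvPolynomial (Fin (c + 1)) R} (hP : P.IsHomogeneous s) :
    algebraMap (MvPolynomial (Fin (c + 1)) (ResidueField R)) (ValGr x) (map (residue R) P) =
      cls s (eval x P) (eval_mem_valLe hP) :=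
  (algebraMap_map_residue P).trans (mk_reesEval hP)

theorem form_smul_cls {s : ℕ} {P : MvPolynomial (Fin (c + 1)) R} (hP : P.IsHomogeneous s) {t : ℝ}
    {y : R} (hy : y ∈ valLe x t) :
    (map (residue R) P) • cls t y hy =
      cls (s + t) (eval x P * y) (mul_mem_valLe (eval_mem_valLe hP) hy) := by
  rw [Algebra.smul_def, algebraMap_form hP, cls_mul]

theorem eval_homogeneousComponent_mem_valLt {P : MvPolynomial (Fin (c + 1)) R} {n : ℕ}
    (h : homogeneousComponent n (map (residue R) P) = 0) :
    eval x (homogeneousComponent n P) ∈ valLt x n := by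
  obtain ⟨N, hN⟩ := hN.out
  refine maximalIdeal_mul_pow_le_valLt hN n
    (eval_mem_of_map_residue_eq_zero x (homogeneousComponent_isHomogeneous n P) ?_)
  rw [← h]
  ext e
  rw [coeff_map, coeff_homogeneousComponent, coeff_homogeneousComponent, coeff_map]
  split_ifs <;> simp

theorem map_homogeneousComponent (P : MvPolynomial (Fin (c + 1)) R) (n : ℕ) :
    map (residue R) (homogeneousComponent n P) = homogeneousComponent n (map (residue R) P) := by
  ext e
  rw [coeff_map, coeff_homogeneousComponent, coeff_homogeneousComponent, coeff_map]
  split_ifs <;> simp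

omit hN in
theorem homogeneousComponent_totalDegree_ne_zero {σ k : Type*} [CommRing k] {p : MvPolynomial σ k}
    (h0 : p ≠ 0) : homogeneousComponent p.totalDegree p ≠ 0 := by
  intro h
  obtain ⟨e, he, hd⟩ := Finset.exists_mem_eq_sup p.support (support_nonempty.2 h0)
    (fun s => s.sum fun _ e => e)
  have h2 : coeff e (homogeneousComponent p.totalDegree p) = coeff e p := by
    rw [coeff_homogeneousComponent, if_pos]
    rw [Finsupp.degree_apply, totalDegree, hd]
    rfl
  rw [h, coeff_zero] at h2
  exact (mem_support_iff.1 he) h2.symm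

instance : IsTorsionFree (MvPolynomial (Fin (c + 1)) (ResidueField R)) (ValGr x) := by
  refine IsTorsionFree.of_smul_eq_zero fun s g h => ?_
  by_contra! H
  obtain ⟨hs, hg⟩ := H
  obtain ⟨p, rfl⟩ := Ideal.Quotient.mk_surjective g
  obtain ⟨P, rfl⟩ := map_surjective (residue R) residue_surjective s
  rw [Ne, Ideal.Quotient.eq_zero_iff_mem] at hg
  obtain ⟨a, ha, hlt⟩ := exists_leading hg
  set d := (map (residue R) P).totalDegree with hd
  have hP : ∀ t, (d : ℝ) < t → (reesEval x P).1.coeff t ∈ valLt x t := by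
    intro t ht
    rw [coe_reesEval]
    by_cases hn : ∃ n : ℕ, (n : ℝ) = t
    · obtain ⟨n, rfl⟩ := hn
      rw [coeff_reesEvalAux_natCast]
      refine eval_homogeneousComponent_mem_valLt (homogeneousComponent_eq_zero _ _ ?_)
      exact_mod_cast ht
    · push Not at hn
      rw [coeff_reesEvalAux_of_forall_ne P hn]
      exact zero_mem _
  rw [Algebra.smul_def, algebraMap_map_residue, ← map_mul, Ideal.Quotient.eq_zero_iff_mem] at h
  have h1 := sub_mem (h (d + a)) (mul_leading hP hlt)
  rw [sub_sub_cancel, coe_reesEval, coeff_reesEvalAux_natCast] at h1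
  refine ha ((eval_mul_mem_valLt_iff ⟨homogeneousComponent_isHomogeneous d P, ?_⟩).1 h1)
  rw [map_homogeneousComponent]
  exact homogeneousComponent_totalDegree_ne_zero hs

/-- Extraction of the degree `D` part of a linear combination of homogeneous elements. -/
theorem exists_forms_of_smul_cls {ι : Type*} (s : Finset ι)
    (a : ι → MvPolynomial (Fin (c + 1)) (ResidueField R)) (τ : ι → ℝ) (y : ι → R)
    (hy : ∀ i, y i ∈ valLe x (τ i)) (D : ℝ) :
    ∃ f : ι → MvPolynomial (Fin (c + 1)) R,
      (∀ i, f i = 0 ∨ ∃ n : ℕ, n + τ i = D ∧ IsUnitForm n (f i)) ∧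
      (∀ i, ∀ n : ℕ, n + τ i = D → map (residue R) (f i) = homogeneousComponent n (a i)) ∧
      ∀ (w : R) (hw : w ∈ valLe x D), ∑ i ∈ s, a i • cls (τ i) (y i) (hy i) = cls D w hw →
        ∑ i ∈ s, eval x (f i) * y i - w ∈ valLt x D := by
  classical
  choose P hP using fun i => map_surjective (residue R) residue_surjective (a i)
  have key : ∀ i, ∃ f : MvPolynomial (Fin (c + 1)) R,
      (f = 0 ∨ ∃ n : ℕ, n + τ i = D ∧ IsUnitForm n f) ∧
      (∀ n : ℕ, n + τ i = D → map (residue R) f = homogeneousComponent n (a i)) ∧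
      (reesEvalAux x (P i) * AddMonoidAlgebra.single (τ i) (y i)).coeff D -
        eval x f * y i ∈ valLt x D := by
    intro i
    rw [AddMonoidAlgebra.coeff_mul_single_apply]
    by_cases hn : ∃ n : ℕ, (n : ℝ) + τ i = D
    · obtain ⟨n, hn⟩ := hn
      have hn' : D + -τ i = n := by rw [← hn]; ring
      have huniq : ∀ m : ℕ, (m : ℝ) + τ i = D → m = n := by
        intro m hm
        have : (m : ℝ) = n := by linarith
        exact_mod_cast this
      rw [hn', coeff_reesEvalAux_natCast]
      by_cases h0 : homogeneousComponent n (a i) = 0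
      · refine ⟨0, Or.inl rfl, fun m hm => by rw [huniq m hm, h0, map_zero], ?_⟩
        rw [map_zero, zero_mul, sub_zero, ← hn]
        exact mul_mem_valLt_left (eval_homogeneousComponent_mem_valLt (by rw [hP, h0])) (hy i)
      · refine ⟨homogeneousComponent n (P i), Or.inr ⟨n, hn,
          homogeneousComponent_isHomogeneous n _, ?_⟩, fun m hm => ?_, ?_⟩
        · rwa [map_homogeneousComponent, hP]
        · rw [huniq m hm, map_homogeneousComponent, hP]
        · rw [sub_self]; exact zero_mem _
    · push Not at hn
      refine ⟨0, Or.inl rfl, fun m hm => absurd hm (hn m), ?_⟩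
      rw [coeff_reesEvalAux_of_forall_ne, zero_mul, map_zero, zero_mul, sub_zero]
      · exact zero_mem _
      · intro n h
        exact hn n (by rw [h]; ring)
  choose f h1 h2 h3 using key
  refine ⟨f, h1, h2, fun w hw h => ?_⟩
  set z : ι → valRees x := fun i => ⟨AddMonoidAlgebra.single (τ i) (y i), fun t => by
    rw [AddMonoidAlgebra.coeff_single, Finsupp.single_apply]
    split_ifs with h
    · exact h ▸ hy i
    · exact zero_mem _⟩ with hz
  have h4 : Ideal.Quotient.mk (valReesPos x) (∑ i ∈ s, reesEval x (P i) * z i) = cls D w hw := by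
    rw [← h, map_sum]
    refine Finset.sum_congr rfl fun i _ => ?_
    rw [map_mul, Algebra.smul_def, ← hP i, algebraMap_map_residue]
    rfl
  rw [cls, Ideal.Quotient.eq] at h4
  have h5 : ∑ i ∈ s, (reesEvalAux x (P i) * AddMonoidAlgebra.single (τ i) (y i)).coeff D - w ∈
      valLt x D := by
    convert h4 D using 1
    rw [AddSubgroupClass.coe_sub, AddSubmonoidClass.coe_finsetSum, AddMonoidAlgebra.coeff_sub,
      AddMonoidAlgebra.coeff_sum, Finsupp.sub_apply, Finsupp.finsetSum_apply,
      AddMonoidAlgebra.coeff_single, Finsupp.single_eq_same]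
    rfl
  have h6 := sub_mem h5 (sum_mem fun i (_ : i ∈ s) => h3 i)
  rw [Finset.sum_sub_distrib] at h6
  convert h6 using 1
  ring

end Graded

end NormalChern

namespace NormalChern

open Module IsLocalRing MvPolynomial

section Rank

variable {R : Type*} [CommRing R] [IsLocalRing R] {c : ℕ} {x : Fin (c + 1) → R}
  [hN : Fact (∃ N, maximalIdeal R ^ N ≤ Ideal.span (Set.range x))]

theorem sum_formDim_le_relLength {ι : Type*} {τ : ι → ℝ} {y : ι → R}
    (hy : ∀ i, y i ∈ valLe x (τ i))
    (hli : LinearIndependent (MvPolynomial (Fin (c + 1)) (ResidueField R))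
      fun i => cls (τ i) (y i) (hy i)) {m : ℕ} {n : ι → ℕ}
    (hn : ∀ i, (n i : ℝ) + τ i = m + Int.fract (τ i)) (s : Finset ι) :
    ((∑ i ∈ s, formDim c (n i) : ℕ) : ℕ∞) ≤ relLength (valLe x ((m + 1 : ℕ) : ℝ))
      (⨆ i ∈ s, Ideal.span {y i} * Ideal.span (Set.range x) ^ n i) := by
  classical
  induction s using Finset.induction_on_min_value (fun i => Int.fract (τ i)) with
  | empty => simp
  | insert a s ha hmin ih =>
    set I : ι → Ideal R := fun i => Ideal.span {y i} * Ideal.span (Set.range x) ^ n i with hI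
    set W := (⨆ i ∈ s, I i) ⊔ valLe x ((m + 1 : ℕ) : ℝ) with hW
    have key : (formDim c (n a) : ℕ∞) ≤ relLength W (I a) := by
      refine formDim_le_relLength' x fun p hp hpW => ?_
      obtain ⟨v, hv, u, hu, huv⟩ := Submodule.mem_sup.1 hpW
      obtain ⟨μ, rfl⟩ := (Submodule.mem_iSup_finset_iff_exists_sum I v).1 hv
      have h1 : ∀ i, ∃ f : MvPolynomial (Fin (c + 1)) R, f.IsHomogeneous (n i) ∧
          y i * eval x f = μ i := by
        intro i
        obtain ⟨q, hq, hq'⟩ := Ideal.mem_span_singleton_mul.1 (μ i).2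
        obtain ⟨f, hf, rfl⟩ := (Ideal.mem_span_pow_iff_exists_isHomogeneous x _).1 hq
        exact ⟨f, hf, hq'⟩
      choose f hf hfμ using h1
      set D : ℝ := n a + τ a with hD
      have hfr : ∀ i, Int.fract (τ a) = Int.fract (τ i) → (n i : ℝ) + τ i = D := by
        intro i hi
        rw [hn, hD, hn, hi]
      set g : ι → MvPolynomial (Fin (c + 1)) (ResidueField R) := fun i =>
        if i = a then map (residue R) p else
          if Int.fract (τ a) = Int.fract (τ i) then - map (residue R) (f i) else 0 with hg
      have h2 : ∑ i ∈ insert a s, g i • cls (τ i) (y i) (hy i) = 0 := by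
        set w : ι → R := fun i => if i = a then eval x p * y a else
          if Int.fract (τ a) = Int.fract (τ i) then - (eval x (f i) * y i) else 0 with hw
        have hwD : ∀ i, w i ∈ valLe x D := by
          intro i
          simp only [hw]
          split_ifs with h1 h2
          · exact mul_mem_valLe (eval_mem_valLe hp) (hy a)
          · rw [← hfr i h2]
            exact neg_mem (mul_mem_valLe (eval_mem_valLe (hf i)) (hy i))
          · exact zero_mem _
        have hgw : ∀ i, g i • cls (τ i) (y i) (hy i) = cls D (w i) (hwD i) := by
          intro i
          by_cases h1 : i = a
          · subst h1
            simp only [hg, if_true]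
            rw [form_smul_cls hp]
            exact cls_congr rfl (by simp [hw]) _
          by_cases h2 : Int.fract (τ a) = Int.fract (τ i)
          · simp only [hg, if_neg h1, if_pos h2]
            rw [← map_neg, form_smul_cls ((homogeneousSubmodule (Fin (c + 1)) R (n i)).neg_mem (hf i))]
            exact cls_congr (hfr i h2) (by simp [hw, h1, h2]) _
          · simp only [hg, if_neg h1, if_neg h2, zero_smul]
            rw [← cls_zero (x := x) (t := D)]
            exact cls_congr rfl (by simp [hw, h1, h2]) _
        rw [Finset.sum_congr rfl fun i _ => hgw i, ← cls_sum, cls_eq_zero_iff,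
          Finset.sum_insert ha]
        have hu' : u ∈ valLt x D := by
          refine valLe_le_valLt ?_ hu
          rw [hD, hn a]
          push_cast
          linarith [Int.fract_lt_one (τ a)]
        have h3 : ∀ i ∈ s, w i + μ i ∈ valLt x D := by
          intro i hi
          have h1 : i ≠ a := fun h => ha (h ▸ hi)
          by_cases h2 : Int.fract (τ a) = Int.fract (τ i)
          · simp only [hw, if_neg h1, if_pos h2]
            rw [← hfμ i, mul_comm, neg_add_cancel]
            exact zero_mem _
          · simp only [hw, if_neg h1, if_neg h2, zero_add]
            rw [← hfμ i, mul_comm]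
            refine valLe_le_valLt ?_ (mul_mem_valLe (eval_mem_valLe (hf i)) (hy i))
            rw [hD, hn, hn]
            have := lt_of_le_of_ne (hmin i hi) h2
            linarith
        have h4 : w a = ∑ i ∈ s, (μ i : R) + u := by
          rw [huv]
          simp only [hw, if_true]
          ring
        have h5 := add_mem hu' (sum_mem fun i hi => h3 i hi)
        rw [Finset.sum_add_distrib] at h5
        convert h5 using 1
        rw [h4]
        ring
      have h3 := linearIndependent_iff'.1 hli (insert a s) g h2 a (Finset.mem_insert_self a s)
      simpa [hg] using h3
    rw [Finset.sum_insert ha, Finset.iSup_insert, Nat.cast_add,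
      ← relLength_sup_left, sup_assoc, relLength_add (J := W) le_sup_right le_sup_right, add_comm]
    refine add_le_add ?_ ?_
    · rw [hW, relLength_sup_left]; exact ih
    · rw [relLength_sup_left]; exact key

theorem card_mul_formSum_le {ι : Type*} [Fintype ι] {τ : ι → ℝ} {y : ι → R}
    (hy : ∀ i, y i ∈ valLe x (τ i))
    (hli : LinearIndependent (MvPolynomial (Fin (c + 1)) (ResidueField R))
      fun i => cls (τ i) (y i) (hy i)) : ∃ a : ℕ, ∀ n : ℕ,
    ((Fintype.card ι * formSum c (n - a) : ℕ) : ℕ∞) ≤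
      Module.length R (R ⧸ Ideal.span (Set.range x) ^ n) := by
  obtain ⟨a, ha⟩ : ∃ a : ℕ, ∀ i, ⌊τ i⌋.natAbs ≤ a :=
    ⟨∑ i, ⌊τ i⌋.natAbs, fun i => Finset.single_le_sum (f := fun i => ⌊τ i⌋.natAbs)
      (fun _ _ => Nat.zero_le _) (Finset.mem_univ i)⟩
  refine ⟨a, fun N => ?_⟩
  rcases le_total N a with h | h
  · rw [Nat.sub_eq_zero_of_le h]
    simp [formSum]
  obtain ⟨n, rfl⟩ := Nat.exists_eq_add_of_le' h
  rw [Nat.add_sub_cancel]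
  set F : ℕ → Ideal R := fun m => valLe x ((m + a : ℕ) : ℝ) with hF
  have hFa : Antitone F := fun i j hij => valLe_antitone (by exact_mod_cast Nat.add_le_add_right hij a)
  have h1 := relLength_chain F hFa n
  have h2 : ∀ m, ((Fintype.card ι * formDim c m : ℕ) : ℕ∞) ≤ relLength (F (m + 1)) (F m) := by
    intro m
    set k : ι → ℕ := fun i => ((m + a : ℕ) - ⌊τ i⌋ : ℤ).toNat with hk
    have hk' : ∀ i, (k i : ℤ) = (m + a : ℕ) - ⌊τ i⌋ := by
      intro i
      have := ha i
      rw [hk, Int.toNat_of_nonneg]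
      push_cast
      omega
    have hkτ : ∀ i, (k i : ℝ) + τ i = (m + a : ℕ) + Int.fract (τ i) := by
      intro i
      have h : (k i : ℝ) = (m + a : ℕ) - (⌊τ i⌋ : ℝ) := by exact_mod_cast hk' i
      rw [h, Int.fract]
      ring
    have h3 := sum_formDim_le_relLength hy hli hkτ Finset.univ
    have h4 : (⨆ i ∈ Finset.univ, Ideal.span {y i} * Ideal.span (Set.range x) ^ k i) ≤ F m := by
      refine iSup₂_le fun i _ => ?_
      rw [Ideal.span_singleton_mul_le_iff]
      intro z hz
      rw [mul_comm]
      refine valLe_antitone ?_ (mul_mem_valLe (pow_le_valLe (k i) hz) (hy i))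
      rw [hkτ]
      linarith [Int.fract_nonneg (τ i)]
    have h5 : F (m + 1) = valLe x ((m + a + 1 : ℕ) : ℝ) := by
      rw [hF]
      simp only
      rw [Nat.add_right_comm]
    rw [h5]
    refine le_trans ?_ (h3.trans (relLength_mono_right _ h4))
    rw [ENat.natCast_le_natCast, Fintype.card, ← smul_eq_mul]
    refine Finset.card_nsmul_le_sum _ _ _ fun i _ => formDim_mono c ?_
    have := ha i
    have := hk' i
    omega
  rw [formSum, Finset.mul_sum, Nat.cast_sum]
  refine (Finset.sum_le_sum fun m _ => h2 m).trans ?_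
  rw [← h1, ← relLength_top]
  exact (relLength_mono_right _ le_top).trans (relLength_anti_left (pow_le_valLe (n + a)) _)

theorem card_le_of_linearIndependent {S : SimpleChain (Ideal.span (Set.range x))} {ι : Type*}
    [Fintype ι] {τ : ι → ℝ} {y : ι → R} (hy : ∀ i, y i ∈ valLe x (τ i))
    (hli : LinearIndependent (MvPolynomial (Fin (c + 1)) (ResidueField R))
      fun i => cls (τ i) (y i) (hy i)) : Fintype.card ι ≤ (goodSteps S).card := by
  by_contra! hlt
  obtain ⟨a, ha⟩ := card_mul_formSum_le hy hli
  obtain ⟨C, hC⟩ := exists_length_quotient_pow_le S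
  set g := (goodSteps S).card
  obtain ⟨n, hn⟩ := exists_lt_formSum c (C + (g + 1) * (a * (c + 1) ^ c))
  have h1 : (g + 1) * formSum c (n - a) ≤ g * formSum c n + C * (n + 1) ^ c := by
    refine (Nat.mul_le_mul_right _ hlt).trans ?_
    exact_mod_cast (ha n).trans (hC n)
  have h2 := formSum_le_add c n a
  have h3 := formDim_le c n
  have h4 : a * formDim c n ≤ a * ((c + 1) ^ c * (n + 1) ^ c) := Nat.mul_le_mul_left a h3
  have h5 : (g + 1) * formSum c n ≤ (g + 1) * (formSum c (n - a) + a * ((c + 1) ^ c * (n + 1) ^ c)) :=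
    Nat.mul_le_mul_left _ (h2.trans (by omega))
  nlinarith

end Rank

end NormalChern

namespace NormalChern

open Module MvPolynomial

section FiniteRank

/-- A module of finite rank over a Noetherian domain with enough functionals is finite. -/
theorem finite_of_exists_functional {S : Type*} [CommRing S] [IsDomain S] [IsNoetherianRing S]
    {M : Type*} [AddCommGroup M] [Module S M] (hM : Module.rank S M < Cardinal.aleph0)
    (h : ∀ y : M, y ≠ 0 → ∃ f : M →ₗ[S] S, f y ≠ 0) : Module.Finite S M := by
  obtain ⟨n, hn⟩ := Cardinal.lt_aleph0.1 hM
  induction n using Nat.strong_induction_on generalizing M with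
  | _ n ih =>
  by_cases h0 : ∀ y : M, y = 0
  · have : Subsingleton M := ⟨fun a b => by rw [h0 a, h0 b]⟩
    infer_instance
  push Not at h0
  obtain ⟨y, hy⟩ := h0
  obtain ⟨f, hf⟩ := h y hy
  have hr : 1 ≤ Module.rank S (M ⧸ LinearMap.ker f) := by
    rw [Cardinal.one_le_iff_ne_zero, Ne, rank_eq_zero_iff]
    push Not
    refine ⟨Submodule.Quotient.mk y, fun a ha h => ?_⟩
    rw [← Submodule.Quotient.mk_smul, Submodule.Quotient.mk_eq_zero, LinearMap.mem_ker,
      map_smul, smul_eq_mul] at h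
    exact (mul_ne_zero ha hf) h
  have hadd := Submodule.rank_quotient_add_rank (LinearMap.ker f)
  rw [hn] at hadd
  have hk : Module.rank S (LinearMap.ker f) < Cardinal.aleph0 := by
    refine lt_of_le_of_lt ?_ (hn ▸ hM)
    rw [← hadd]
    exact self_le_add_left _ _
  obtain ⟨m, hm⟩ := Cardinal.lt_aleph0.1 hk
  have hmn : m < n := by
    have : (1 + m : Cardinal) ≤ n := by
      rw [← hadd, hm]
      gcongr
    norm_cast at this
    omega
  have := ih m hmn hk (fun y hy => by
    obtain ⟨g, hg⟩ := h y (by simpa using hy)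
    exact ⟨g.comp (LinearMap.ker f).subtype, hg⟩) hm
  have h1 : (LinearMap.ker f).FG := Module.Finite.iff_fg.1 this
  rw [Module.finite_def]
  refine Submodule.fg_of_fg_map_of_fg_inf_ker f (IsNoetherian.noetherian _) ?_
  rwa [top_inf_eq]

end FiniteRank

section FrobeniusTrace

/-- A nonzero additive map that is linear for the inverse of the `q`-th power map. -/
theorem exists_rootLinear_field (k : Type*) [Field k] (p : ℕ) [ExpChar k p] (n : ℕ) :
    ∃ t : k →+ k, t 1 = 1 ∧ ∀ u v, t (u ^ p ^ n * v) = u * t v := by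
  let φ := iterateFrobenius k p n
  let F := φ.fieldRange
  obtain ⟨T, hT⟩ := LinearMap.exists_leftInverse_of_injective (Algebra.linearMap F k)
    (LinearMap.ker_eq_bot.2 (algebraMap F k).injective)
  let e : k ≃+* F := RingEquiv.ofBijective φ.rangeRestrictField
    ⟨φ.rangeRestrictField.injective, φ.rangeRestrictField_bijective.2⟩
  have hT1 : T 1 = 1 := by
    have := LinearMap.congr_fun hT 1
    simpa using this
  refine ⟨e.symm.toAddMonoidHom.comp T.toAddMonoidHom, ?_, fun u v => ?_⟩
  · change e.symm (T 1) = 1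
    rw [hT1, map_one]
  · change e.symm (T _) = u * e.symm (T v)
    have : u ^ p ^ n * v = (e u) • v := by
      rw [Subfield.smul_def, smul_eq_mul]
      rfl
    rw [this, map_smul, smul_eq_mul, map_mul, RingEquiv.symm_apply_apply]

theorem exists_rootLinear (k : Type*) [Field k] (p : ℕ) [ExpChar k p] (n : ℕ) (σ : Type*) :
    ∃ t : MvPolynomial σ k →+ MvPolynomial σ k, t 1 = 1 ∧
      ∀ u v, t (u ^ p ^ n * v) = u * t v := by
  classical
  obtain ⟨t, ht1, ht⟩ := exists_rootLinear_field k p n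
  set q := p ^ n with hq
  have hq0 : 0 < q := pow_pos (expChar_pos k p) n
  let F : (σ →₀ ℕ) → k →+ MvPolynomial σ k := fun s =>
    if ∀ i, q ∣ s i then (monomial (s.mapRange (· / q) (Nat.zero_div q))).toAddMonoidHom.comp t
    else 0
  let l : MvPolynomial σ k →+ MvPolynomial σ k := (Finsupp.liftAddHom F).comp
    (basisMonomials σ k).repr.toLinearMap.toAddMonoidHom
  have hl : ∀ s a, l (monomial s a) = F s a := by
    intro s a
    have : (basisMonomials σ k).repr (monomial s a) = Finsupp.single s a := by
      rw [← mul_one a, ← smul_eq_mul, ← smul_monomial, map_smul]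
      have := (basisMonomials σ k).repr_self s
      rw [coe_basisMonomials] at this
      rw [this, Finsupp.smul_single]
    change Finsupp.liftAddHom F ((basisMonomials σ k).repr (monomial s a)) = _
    rw [this, Finsupp.liftAddHom_apply_single]
  refine ⟨l, ?_, fun u v => ?_⟩
  · change l (monomial 0 1) = 1
    rw [hl]
    simp only [F]
    rw [if_pos (by simp)]
    change monomial _ (t 1) = _
    rw [ht1]
    simp
  · have : ExpChar (MvPolynomial σ k) p := expChar_of_injective_algebraMap (C_injective σ k) p
    induction u using MvPolynomial.induction_on' with
    | add u u' hu hu' => rw [hq, add_pow_expChar_pow, add_mul, map_add, ← hq, hu, hu', add_mul]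
    | monomial u a =>
    induction v using MvPolynomial.induction_on' with
    | add v v' hv hv' => rw [mul_add, map_add, hv, hv', map_add, mul_add]
    | monomial v b =>
      rw [monomial_pow, monomial_mul, hl, hl]
      simp only [F]
      have hdiv : (∀ i, q ∣ (q • u + v) i) ↔ ∀ i, q ∣ v i := by
        refine forall_congr' fun i => ?_
        simp [Nat.dvd_add_right]
      by_cases hv : ∀ i, q ∣ v i
      · rw [if_pos (hdiv.2 hv), if_pos hv]
        change monomial _ (t _) = monomial u a * monomial _ (t b)
        rw [ht, monomial_mul]
        congr 2
        ext i
        simp [Nat.mul_add_div hq0]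
      · rw [if_neg (fun h => hv (hdiv.1 h)), if_neg hv]
        simp

end FrobeniusTrace

end NormalChern

namespace NormalChern

open Module

/-- Functionals separate the points of a domain of finite rank integral over `S`. -/
theorem exists_functional_of_isDomain {S G : Type*} [CommRing S] [IsDomain S]
    [IsIntegrallyClosed S] [CommRing G] [IsDomain G] [Algebra S G] [Algebra.IsIntegral S G]
    [FaithfulSMul S G] (p : ℕ) [ExpChar S p]
    (hS : ∀ n, ∃ t : S →+ S, t 1 = 1 ∧ ∀ u v, t (u ^ p ^ n * v) = u * t v)
    (hrank : Module.rank S G < Cardinal.aleph0) {y : G} (hy : y ≠ 0) :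
    ∃ f : G →ₗ[S] S, f y ≠ 0 := by
  let K := FractionRing S
  let L := FractionRing G
  let : Algebra K L := FractionRing.liftAlgebra S L
  have : IsScalarTower S K L := FractionRing.isScalarTower_liftAlgebra S L
  have : FiniteDimensional K L := by
    rw [FiniteDimensional, ← Module.rank_lt_aleph0_iff]
    have h := Algebra.IsAlgebraic.lift_rank_of_isFractionRing S K G L
    rw [← Cardinal.lift_lt_aleph0, h, Cardinal.lift_lt_aleph0]
    exact hrank
  have : ExpChar K p := expChar_of_injective_algebraMap (IsFractionRing.injective S K) p
  let F := separableClosure K L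
  have : ExpChar F p := expChar_of_injective_algebraMap (algebraMap K F).injective p
  have : IsPurelyInseparable F L := separableClosure.isPurelyInseparable K L
  have : IsScalarTower S F L := IsScalarTower.of_algebraMap_eq fun s => by
    rw [IsScalarTower.algebraMap_apply S K F, ← IsScalarTower.algebraMap_apply K F L,
      ← IsScalarTower.algebraMap_apply S K L]
  set n := IsPurelyInseparable.exponent F L
  let φ : L →+* F := IsPurelyInseparable.iterateFrobenius F L p (le_refl n)
  have hφ : ∀ z : L, algebraMap F L (φ z) = z ^ p ^ n := fun z =>
    IsPurelyInseparable.algebraMap_iterateFrobenius F p le_rfl z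
  have hφS : ∀ s : S, φ (algebraMap S L s) = algebraMap S F (s ^ p ^ n) := by
    intro s
    apply (algebraMap F L).injective
    rw [hφ, ← IsScalarTower.algebraMap_apply, map_pow]
  have hgint : ∀ g : G, IsIntegral S (φ (algebraMap G L g)) := by
    intro g
    rw [← isIntegral_algebraMap_iff (algebraMap F L).injective, hφ]
    exact ((Algebra.IsIntegral.isIntegral g).algebraMap).pow _
  have htr : ∀ z : F, IsIntegral S z → ∃ s, algebraMap S K s = Algebra.trace K F z := fun z hz =>
    IsIntegrallyClosed.isIntegral_iff.1 (Algebra.isIntegral_trace hz)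
  obtain ⟨c, hc, hcy⟩ : ∃ c : F, IsIntegral S c ∧
      Algebra.trace K F (c * φ (algebraMap G L y)) ≠ 0 := by
    have h0 : φ (algebraMap G L y) ≠ 0 := by
      rw [Ne, map_eq_zero, map_eq_zero_iff _ (IsFractionRing.injective G L)]
      exact hy
    obtain ⟨c, hc⟩ : ∃ c, Algebra.trace K F (c * φ (algebraMap G L y)) ≠ 0 := by
      by_contra! H
      exact h0 ((traceForm_nondegenerate K F).2 _ H)
    have halg : IsAlgebraic S c :=
      (IsFractionRing.isAlgebraic_iff S K F).2 (Algebra.IsAlgebraic.isAlgebraic c)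
    obtain ⟨s, hs0, hs⟩ := halg.exists_integral_multiple
    refine ⟨s • c, hs, ?_⟩
    rw [smul_mul_assoc, ← algebraMap_smul K, map_smul, smul_eq_mul]
    exact mul_ne_zero ((map_ne_zero_iff _ (IsFractionRing.injective S K)).2 hs0) hc
  have htr' : ∀ g : G, ∃ s, algebraMap S K s = Algebra.trace K F (c * φ (algebraMap G L g)) :=
    fun g => htr _ (hc.mul (hgint g))
  choose τ hτ using htr'
  have hinj := IsFractionRing.injective S K
  have hτ0 : τ y ≠ 0 := fun h => hcy (by rw [← hτ, h, map_zero])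
  have hτadd : ∀ g h, τ (g + h) = τ g + τ h := fun g h => hinj (by
    rw [map_add, hτ, hτ, hτ, map_add, map_add, mul_add, map_add])
  have hτsmul : ∀ (s : S) g, τ (s • g) = s ^ p ^ n * τ g := fun s g => hinj (by
    rw [map_mul, hτ, hτ, Algebra.smul_def, map_mul (algebraMap G L), map_mul φ, ← IsScalarTower.algebraMap_apply,
      hφS, mul_left_comm, ← Algebra.smul_def, ← algebraMap_smul K, map_smul, smul_eq_mul])
  obtain ⟨t, ht1, ht⟩ := hS n
  have hn : p ^ n ≠ 0 := pow_ne_zero _ (expChar_pos S p).ne'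
  refine ⟨⟨⟨fun g => t (τ y ^ (p ^ n - 1) * τ g), fun g h => ?_⟩, fun s g => ?_⟩, ?_⟩
  · rw [hτadd, mul_add, map_add]
  · change t _ = s • t _
    rw [hτsmul, mul_left_comm, ht, smul_eq_mul]
  · change t _ ≠ 0
    rw [← pow_succ, Nat.sub_add_cancel (Nat.one_le_iff_ne_zero.2 hn), ← mul_one (τ y ^ _), ht, ht1,
      mul_one]
    exact hτ0

/-- A reduced torsion-free algebra of finite rank, integral over `S`, is finite. -/
theorem finite_of_isReduced {S G : Type*} [CommRing S] [IsDomain S] [IsNoetherianRing S]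
    [IsIntegrallyClosed S] [CommRing G] [IsReduced G] [Algebra S G] [Algebra.IsIntegral S G]
    [IsTorsionFree S G] (p : ℕ) [ExpChar S p]
    (hS : ∀ n, ∃ t : S →+ S, t 1 = 1 ∧ ∀ u v, t (u ^ p ^ n * v) = u * t v)
    (hrank : Module.rank S G < Cardinal.aleph0) : Module.Finite S G := by
  refine finite_of_exists_functional hrank fun y hy => ?_
  obtain ⟨P, hP, hyP⟩ : ∃ P ∈ minimalPrimes G, y ∉ P := by
    by_contra! H
    refine hy ?_
    have : y ∈ sInf (minimalPrimes G) := by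
      rw [Submodule.mem_sInf]; exact H
    rw [show minimalPrimes G = (⊥ : Ideal G).minimalPrimes from rfl, Ideal.sInf_minimalPrimes] at this
    obtain ⟨k, hk⟩ := this
    exact (show IsNilpotent y from ⟨k, hk⟩).eq_zero
  have : P.IsPrime := hP.1.1
  have : FaithfulSMul S (G ⧸ P) := by
    rw [faithfulSMul_iff_algebraMap_injective, injective_iff_map_eq_zero]
    intro s hs
    by_contra hs0
    rw [IsScalarTower.algebraMap_apply S G (G ⧸ P), Ideal.Quotient.algebraMap_eq,
      Ideal.Quotient.eq_zero_iff_mem] at hs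
    refine Set.disjoint_left.1 (Ideal.disjoint_nonZeroDivisors_of_mem_minimalPrimes hP) hs ?_
    rw [SetLike.mem_coe, mem_nonZeroDivisors_iff_right]
    intro x hx
    rw [mul_comm, ← Algebra.smul_def] at hx
    exact (smul_eq_zero_iff_right hs0).1 hx
  have hr : Module.rank S (G ⧸ P) < Cardinal.aleph0 :=
    (LinearMap.rank_le_of_surjective (Ideal.Quotient.mkₐ S P).toLinearMap
      Ideal.Quotient.mk_surjective).trans_lt hrank
  obtain ⟨f, hf⟩ := exists_functional_of_isDomain p hS hr
    (y := Ideal.Quotient.mk P y) (by rwa [Ne, Ideal.Quotient.eq_zero_iff_mem])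
  exact ⟨f.comp (Ideal.Quotient.mkₐ S P).toLinearMap, hf⟩

end NormalChern

namespace NormalChern

open Module IsLocalRing MvPolynomial

theorem exists_pow_eq_sum_of_mul_pow_mem {R : Type*} [CommRing R] [IsNoetherianRing R] {r y : R}
    {I : Ideal R} (hr : ∀ z, r * z = 0 → z = 0) (h : ∀ i, r * y ^ i ∈ I ^ i) :
    ∃ (n : ℕ) (a : ℕ → R), 0 < n ∧ (∀ i < n, a i ∈ I ^ (n - i)) ∧
      y ^ n = ∑ i ∈ Finset.range n, a i * y ^ i := by
  set b : ℕ → reesAlgebra I := fun i =>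
    ⟨Polynomial.monomial i (r * y ^ i), reesAlgebra.monomial_mem.2 (h i)⟩ with hb
  let J : ℕ →o Ideal (reesAlgebra I) :=
    ⟨fun n => Ideal.span (b '' (Finset.range n : Set ℕ)), fun m n hmn =>
      Ideal.span_mono (Set.image_mono (by simpa using hmn))⟩
  obtain ⟨n, hn⟩ := monotone_stabilizes_iff_noetherian.2
    (inferInstance : IsNoetherian (reesAlgebra I) (reesAlgebra I)) J
  have h1 : b (n + 1) ∈ J (n + 1) := by
    rw [← hn (n + 1) (by omega), hn (n + 2) (by omega)]
    exact Ideal.subset_span ⟨n + 1, by simp, rfl⟩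
  obtain ⟨s, hs⟩ : ∃ s : ℕ → reesAlgebra I, ∑ i ∈ Finset.range (n + 1), s i • b i = b (n + 1) := by
    obtain ⟨s, hs⟩ := (Submodule.mem_span_image_finset_iff_exists_fun _).1 h1
    refine ⟨fun i => if h : i ∈ Finset.range (n + 1) then s ⟨i, h⟩ else 0, ?_⟩
    rw [← hs, ← Finset.sum_coe_sort]
    refine Finset.sum_congr rfl fun i _ => ?_
    exact congrArg (· • b i) (dif_pos i.2)
  refine ⟨n + 1, fun i => (s i).1.coeff (n + 1 - i), n.succ_pos, fun i _ => (s i).2 _, ?_⟩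
  have h2 := congrArg (fun p : reesAlgebra I => p.1.coeff (n + 1)) hs
  simp only [hb, AddSubmonoidClass.coe_finsetSum, Polynomial.finsetSum_coeff,
    Polynomial.coeff_monomial_same, smul_eq_mul, MulMemClass.coe_mul] at h2
  have h3 : ∑ i ∈ Finset.range (n + 1), (s i).1.coeff (n + 1 - i) * (r * y ^ i) =
      r * y ^ (n + 1) := by
    rw [← h2]
    refine Finset.sum_congr rfl fun i hi => ?_
    have hi' := Finset.mem_range.1 hi
    have : n + 1 = (n + 1 - i) + i := by omega
    conv_rhs => rw [this, Polynomial.coeff_mul_monomial]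
  refine sub_eq_zero.1 (hr _ ?_)
  rw [mul_sub, ← h3, Finset.mul_sum, sub_eq_zero]
  exact Finset.sum_congr rfl fun i _ => by ring

theorem rank_lt_aleph0_of_torsion {P G : Type*} [CommRing P] [IsDomain P] [AddCommGroup G]
    [Module P G] {N : Submodule P G} (hN : Module.rank P N < Cardinal.aleph0) {H : Set G}
    (hH : AddSubmonoid.closure H = ⊤) (h : ∀ g ∈ H, ∃ a : P, a ≠ 0 ∧ a • g ∈ N) :
    Module.rank P G < Cardinal.aleph0 := by
  have h0 : Module.rank P (G ⧸ N) = 0 := by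
    rw [rank_eq_zero_iff]
    intro g
    obtain ⟨g, rfl⟩ := N.mkQ_surjective g
    have hg : g ∈ AddSubmonoid.closure H := by rw [hH]; trivial
    have htors : ∃ a : P, a ≠ 0 ∧ a • g ∈ N := by
      refine AddSubmonoid.closure_induction (motive := fun g _ => ∃ a : P, a ≠ 0 ∧ a • g ∈ N)
        h ⟨1, one_ne_zero, by simp⟩ ?_ hg
      rintro g h _ _ ⟨a, ha, hag⟩ ⟨b, hb, hbh⟩
      refine ⟨a * b, mul_ne_zero ha hb, ?_⟩
      rw [smul_add]
      refine add_mem ?_ ?_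
      · rw [mul_comm, mul_smul]; exact N.smul_mem b hag
      · rw [mul_smul]; exact N.smul_mem a hbh
    obtain ⟨a, ha, hag⟩ := htors
    exact ⟨a, ha, by rwa [← map_smul, Submodule.mkQ_apply, Submodule.Quotient.mk_eq_zero]⟩
  rw [← rank_quotient_add_rank_of_isDomain N, h0, zero_add]
  exact hN

section Rank

variable {R : Type*} [CommRing R] [IsLocalRing R] {c : ℕ} {x : Fin (c + 1) → R}
  [hN : Fact (∃ N, maximalIdeal R ^ N ≤ Ideal.span (Set.range x))]

theorem rank_valGr_lt (S : SimpleChain (Ideal.span (Set.range x))) :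
    Module.rank (MvPolynomial (Fin (c + 1)) (ResidueField R)) (ValGr x) < Cardinal.aleph0 := by
  set P := MvPolynomial (Fin (c + 1)) (ResidueField R)
  let v : {p : ℝ × R // p.2 ∈ valLe x p.1} → ValGr x := fun p => cls p.1.1 p.1.2 p.2
  obtain ⟨s, hs, hmax⟩ := exists_maximal_linearIndepOn P v
  have hfin : s.Finite := by
    by_contra hinf
    obtain ⟨t, hts, htc⟩ := Set.Infinite.exists_subset_card_eq hinf ((goodSteps S).card + 1)
    have h1 : LinearIndependent P fun i : t => v i := hs.mono hts
    have h2 := card_le_of_linearIndependent (S := S) (fun i : t => i.1.2) h1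
    rw [Fintype.card_coe, htc] at h2
    omega
  have hH : ∀ i, ∃ a : P, a ≠ 0 ∧ a • v i ∈ Submodule.span P (v '' s) := by
    intro i
    by_cases hi : i ∈ s
    · have h1 : v i ∈ Submodule.span P (v '' s) :=
        Submodule.subset_span (Set.mem_image_of_mem v hi)
      exact ⟨1, one_ne_zero, (one_smul P (v i)).symm ▸ h1⟩
    · exact hmax i hi
  refine rank_lt_aleph0_of_torsion (N := Submodule.span P (v '' s))
    ((rank_span_le _).trans_lt (Set.Finite.lt_aleph0 (hfin.image v))) closure_cls ?_
  rintro _ ⟨t, y, hy, rfl⟩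
  exact hH ⟨(t, y), hy⟩

end Rank

end NormalChern

namespace NormalChern

open Module IsLocalRing MvPolynomial

theorem isIntegral_of_pow_eq_sum {S G : Type*} [CommRing S] [CommRing G] [Algebra S G] {z : G}
    {n : ℕ} (b : ℕ → S) (h : z ^ n = ∑ i ∈ Finset.range n, b i • z ^ i) : IsIntegral S z := by
  refine ⟨Polynomial.X ^ n - ∑ i ∈ Finset.range n, Polynomial.C (b i) * Polynomial.X ^ i,
    Polynomial.monic_X_pow_sub ?_, ?_⟩
  · refine (Polynomial.degree_sum_le _ _).trans_lt ((Finset.sup_lt_iff (WithBot.bot_lt_coe n)).2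
      fun i hi => (Polynomial.degree_C_mul_X_pow_le i (b i)).trans_lt ?_)
    exact WithBot.coe_lt_coe.2 (Finset.mem_range.1 hi)
  rw [Polynomial.eval₂_sub, Polynomial.eval₂_X_pow, Polynomial.eval₂_finsetSum, h, sub_eq_zero]
  exact Finset.sum_congr rfl fun i _ => by simp [Algebra.smul_def]

section Integral

variable {R : Type*} [CommRing R] [IsLocalRing R] {c : ℕ} {x : Fin (c + 1) → R}
  [hN : Fact (∃ N, maximalIdeal R ^ N ≤ Ideal.span (Set.range x))]

omit hN in
theorem nonneg_of_notMem_valLt {t : ℝ} {y : R} (hy' : y ∉ valLt x t) : 0 ≤ t := by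
  by_contra! h
  exact hy' (valLe_le_valLt h (valLe_zero (x := x) ▸ trivial))

omit hN in
theorem ordFun_le_of_forall_mem {y : R} {r : ℝ} (hr : 0 ≤ r) (h : ∀ n, y ∈ formFil x n) :
    ordFun x y ≤ r := by
  rcases ordFun_cases (x := x) y with ⟨h', -⟩ | ⟨n, -, -, h'⟩
  · rwa [h']
  · exact absurd (h _) h'

omit hN in
theorem ordFun_sum_le {ι : Type*} (s : Finset ι) (f : ι → R) {r : ℝ} (hr : 0 ≤ r)
    (h : ∀ i ∈ s, ordFun x (f i) ≤ r) : ordFun x (∑ i ∈ s, f i) ≤ r := by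
  classical
  induction s using Finset.induction_on with
  | empty => exact ordFun_le_of_forall_mem hr fun n => zero_mem _
  | insert a s ha ih =>
    rw [Finset.sum_insert ha]
    exact (ordFun_add_le _ _).trans (max_le (h a (Finset.mem_insert_self a s))
      (ih fun i hi => h i (Finset.mem_insert_of_mem hi)))

theorem exists_relation (S : SimpleChain (Ideal.span (Set.range x))) {t : ℝ} {y : R}
    (hy : y ∈ valLe x t) (hy' : y ∉ valLt x t) :
    ∃ (r d a b : ℕ) (f : ℕ → MvPolynomial (Fin (c + 1)) R) (D : ℝ),
      (∀ i, f i = 0 ∨ ∃ n : ℕ, n + i * t = D ∧ IsUnitForm n (f i)) ∧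
      IsUnitForm d (f r) ∧ 0 < r ∧ d + r * t = D ∧ 0 < b ∧ b * t = a ∧
      ∑ i ∈ Finset.range (r + 1), eval x (f i) * y ^ i ∈ valLt x D := by
  classical
  set g := (goodSteps S).card
  have ht := nonneg_of_notMem_valLt hy'
  have hyi : ∀ i : ℕ, y ^ i ∈ valLe x (i * t) := pow_mem_valLe hy
  have h1 : ¬ LinearIndepOn (MvPolynomial (Fin (c + 1)) (ResidueField R))
      (fun i : ℕ => cls (i * t) (y ^ i) (hyi i)) (Finset.range (g + 1)) := by
    intro h
    have h2 := card_le_of_linearIndependent (S := S)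
      (fun i : (Finset.range (g + 1) : Set ℕ) => hyi i) h
    simp at h2
    omega
  rw [linearIndepOn_finset_iff] at h1
  push Not at h1
  obtain ⟨p, hp, i0, hi0, hpi0⟩ := h1
  obtain ⟨f, hf, hf', hfw⟩ := exists_forms_of_smul_cls (Finset.range (g + 1)) p
    (fun i => i * t) (fun i => y ^ i) hyi ((p i0).totalDegree + i0 * t)
  set D := (p i0).totalDegree + i0 * t with hD
  have hw := hfw 0 (zero_mem _) (by rw [hp, cls_zero])
  rw [sub_zero] at hw
  have hfi0 : f i0 ≠ 0 := by
    intro h0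
    have h3 := hf' i0 _ hD.symm
    rw [h0, map_zero] at h3
    exact homogeneousComponent_totalDegree_ne_zero hpi0 h3.symm
  set J := (Finset.range (g + 1)).filter (fun i => f i ≠ 0) with hJ
  have hJ0 : i0 ∈ J := Finset.mem_filter.2 ⟨hi0, hfi0⟩
  have hJf : ∀ i ∈ J, ∃ n : ℕ, n + i * t = D ∧ IsUnitForm n (f i) := fun i hi =>
    (hf i).resolve_left (Finset.mem_filter.1 hi).2
  set r := J.max' ⟨i0, hJ0⟩ with hr
  have hrJ : r ∈ J := J.max'_mem _
  obtain ⟨d, hd, hfr⟩ := hJf r hrJ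
  have hrg : r + 1 ≤ g + 1 := Finset.mem_range.1 (Finset.mem_filter.1 hrJ).1
  have hw' : ∑ i ∈ Finset.range (r + 1), eval x (f i) * y ^ i ∈ valLt x D := by
    rw [← Finset.sum_subset (Finset.range_mono hrg)] at hw
    · exact hw
    · intro i hi hir
      have : f i = 0 := by
        by_contra h0
        have := J.le_max' i (Finset.mem_filter.2 ⟨hi, h0⟩)
        exact hir (Finset.mem_range.2 (Nat.lt_succ_of_le this))
      rw [this, map_zero, zero_mul]
  obtain ⟨i1, hi1, hi1r⟩ : ∃ i ∈ J, i < r := by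
    by_contra! H
    have h4 : ∑ i ∈ Finset.range (r + 1), eval x (f i) * y ^ i = eval x (f r) * y ^ r := by
      refine Finset.sum_eq_single r (fun i hi hir => ?_) (fun h => absurd (by simp) h)
      have : f i = 0 := by
        by_contra h0
        have hi' := Finset.mem_range.1 hi
        have := H i (Finset.mem_filter.2 ⟨Finset.mem_range.2 (by omega), h0⟩)
        omega
      rw [this, map_zero, zero_mul]
    rw [h4, ← hd, eval_mul_mem_valLt_iff hfr] at hw'
    rcases Nat.eq_zero_or_pos r with h0 | h0
    · rw [h0] at hw'
      have := mul_mem_valLt_left hw' hy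
      simp only [Nat.cast_zero, zero_mul, pow_zero, one_mul, zero_add] at this
      exact hy' this
    · exact hy' ((pow_mem_valLt_iff h0).1 hw')
  obtain ⟨d1, hd1, -⟩ := hJf i1 hi1
  have hbt : ((r - i1 : ℕ) : ℝ) * t = d1 - d := by
    rw [Nat.cast_sub hi1r.le]
    linarith
  have hdd : d ≤ d1 := by
    have : (0 : ℝ) ≤ d1 - d := by rw [← hbt]; positivity
    exact_mod_cast sub_nonneg.1 this
  exact ⟨r, d, d1 - d, r - i1, f, D, hf, hfr, by omega, hd, by omega, by rw [hbt, Nat.cast_sub hdd], hw'⟩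

theorem exists_ordFun_bound (S : SimpleChain (Ideal.span (Set.range x))) {t : ℝ} {y : R}
    (hy : y ∈ valLe x t) (hy' : y ∉ valLt x t) :
    ∃ a b k : ℕ, 0 < b ∧ b * t = a ∧ ∀ i, (y ^ b) ^ i ∈ formFil x (a * i - k) := by
  have ht := nonneg_of_notMem_valLt hy'
  obtain ⟨r, d, a, b, f, D, hf, hfr, hr0, hd, hb, hbt, hw⟩ := exists_relation S hy hy'
  have hD : 0 ≤ D := by rw [← hd]; positivity
  set w := ∑ i ∈ Finset.range (r + 1), eval x (f i) * y ^ i with hwdef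
  set h : ℝ := 1 / 2 with hh
  have hpos : ∀ s : ℝ, 0 < h ^ s := fun s => by positivity
  obtain ⟨L, hL⟩ := Filter.eventually_atTop.1 (eventually_ordFun_pow_le (mem_valLt.1 hw))
  set B : ℝ := h ^ (-(D * L)) * h ^ (-(t * r)) with hB
  have hanti : ∀ {u v : ℝ}, u ≤ v → h ^ v ≤ h ^ u := fun huv =>
    Real.rpow_le_rpow_of_exponent_ge (by norm_num) (by norm_num) huv
  have hmul : ∀ u v : ℝ, h ^ u * h ^ v = h ^ (u + v) := fun u v =>
    (Real.rpow_add (by norm_num) u v).symm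
  have key : ∀ i l : ℕ, ordFun x (y ^ i * w ^ l) ≤ B * h ^ (t * i + D * l) := by
    intro i
    induction i using Nat.strong_induction_on with
    | _ i ih =>
    intro l
    rcases lt_or_ge i r with hir | hir
    · have h1 : ordFun x (w ^ l) ≤ h ^ (-(D * L)) * h ^ (D * l) := by
        rcases le_total L l with hl | hl
        · refine (hL l hl).trans ?_
          rw [hmul, ← Real.rpow_mul_natCast (by norm_num)]
          exact hanti (by nlinarith [mul_nonneg hD (Nat.cast_nonneg (α := ℝ) L)])
        · refine (ordFun_le_one _).trans ?_
          rw [hmul, ← Real.rpow_zero h]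
          have : (l : ℝ) ≤ L := by exact_mod_cast hl
          exact hanti (by nlinarith)
      have h2 : ordFun x (y ^ i) ≤ h ^ (-(t * r)) * h ^ (t * i) := by
        refine (ordFun_le_one _).trans ?_
        rw [hmul, ← Real.rpow_zero h]
        have : (i : ℝ) ≤ r := by exact_mod_cast hir.le
        exact hanti (by nlinarith)
      refine (ordFun_mul_le _ _).trans ((mul_le_mul h2 h1 (ordFun_nonneg _)
        (by positivity)).trans_eq ?_)
      rw [hB, ← hmul]
      ring
    · obtain ⟨j, rfl⟩ := Nat.exists_eq_add_of_le' hir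
      set T := B * h ^ (t * j + D * l + D) with hT
      have h0 : 0 ≤ T := by positivity
      have h1 : ordFun x (y ^ j * w ^ (l + 1)) ≤ T := by
        refine (ih j (by omega) (l + 1)).trans_eq ?_
        rw [hT]
        push_cast
        ring_nf
      have h2 : ∀ i ∈ Finset.range r, ordFun x (-(eval x (f i) * (y ^ (j + i) * w ^ l))) ≤ T := by
        intro i hi
        rw [ordFun_neg]
        rcases hf i with h3 | ⟨n, hn, hfn⟩
        · rw [h3, map_zero, zero_mul]
          exact ordFun_le_of_forall_mem h0 fun n => zero_mem _
        · rw [ordFun_eval_mul hfn]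
          refine (mul_le_mul_of_nonneg_left (ih (j + i) (by have := Finset.mem_range.1 hi; omega) l)
            (by positivity)).trans_eq ?_
          rw [← Real.rpow_natCast (1 / 2) n, ← hh, mul_left_comm, hmul, hT, ← hn]
          push_cast
          ring_nf
      have h3 : eval x (f r) * (y ^ (j + r) * w ^ l) = y ^ j * w ^ (l + 1) +
          ∑ i ∈ Finset.range r, -(eval x (f i) * (y ^ (j + i) * w ^ l)) := by
        have h4 : eval x (f r) * y ^ r = w - ∑ i ∈ Finset.range r, eval x (f i) * y ^ i := by
          rw [hwdef, Finset.sum_range_succ]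
          ring
        clear_value w
        calc eval x (f r) * (y ^ (j + r) * w ^ l) = (eval x (f r) * y ^ r) * (y ^ j * w ^ l) := by
              ring
          _ = _ := by
            rw [h4, sub_mul, sub_eq_add_neg, Finset.sum_mul, ← Finset.sum_neg_distrib]
            congr 1
            · ring
            · exact Finset.sum_congr rfl fun i _ => by ring
      have h4 : ordFun x (eval x (f r) * (y ^ (j + r) * w ^ l)) ≤ T := by
        rw [h3]
        exact (ordFun_add_le _ _).trans (max_le h1 (ordFun_sum_le _ _ h0 h2))
      rw [ordFun_eval_mul hfr] at h4
      refine le_of_mul_le_mul_left (h4.trans_eq ?_) (by positivity : (0 : ℝ) < (1 / 2) ^ d)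
      rw [← Real.rpow_natCast (1 / 2) d, ← hh, mul_left_comm, hmul, hT, ← hd]
      push_cast
      ring_nf
  obtain ⟨k, hk⟩ := exists_pow_lt_of_lt_one (y := h) (by positivity : 0 < B⁻¹) (by norm_num)
  refine ⟨a, b, k, hb, hbt, fun i => ?_⟩
  rcases le_total (a * i) k with hik | hik
  · rw [Nat.sub_eq_zero_of_le hik, formFil_zero]
    trivial
  rw [← ordFun_le_iff]
  have h1 := key (b * i) 0
  rw [pow_zero, mul_one, pow_mul] at h1
  refine h1.trans ?_
  have h2 : t * (b * i : ℕ) + D * (0 : ℕ) = (a * i - k : ℕ) + (k : ℕ) := by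
    rw [Nat.cast_sub hik]
    push_cast
    rw [← hbt]
    ring
  rw [h2, ← hmul, Real.rpow_natCast, Real.rpow_natCast, mul_left_comm, ← hh]
  refine mul_le_of_le_one_right (by positivity) ?_
  have h3 := mul_le_mul_of_nonneg_left hk.le (by positivity : 0 ≤ B)
  rwa [mul_inv_cancel₀ (by positivity)] at h3

end Integral

end NormalChern

namespace NormalChern

open Module IsLocalRing MvPolynomial

section Integral

variable {R : Type*} [CommRing R] [IsNoetherianRing R] [IsLocalRing R] {c : ℕ}
  {x : Fin (c + 1) → R}

omit [IsNoetherianRing R] in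
theorem isUnitForm_X_pow (i : Fin (c + 1)) (k : ℕ) :
    IsUnitForm k (X i ^ k : MvPolynomial (Fin (c + 1)) R) := by
  refine ⟨isHomogeneous_X_pow i k, ?_⟩
  rw [map_pow, map_X]
  exact pow_ne_zero k (X_ne_zero i)

theorem MaxGrowth.exists_pow_eq_sum [IsAdicComplete (maximalIdeal R) R] (hx : MaxGrowth x) {N : ℕ}
    (hN : maximalIdeal R ^ N ≤ Ideal.span (Set.range x)) {z : R} {a k : ℕ}
    (h : ∀ i, z ^ i ∈ formFil x (a * i - k)) :
    ∃ (n : ℕ) (b : ℕ → R), 0 < n ∧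
      (∀ i < n, b i ∈ (Ideal.span (Set.range x) ^ a) ^ (n - i)) ∧
      z ^ n = ∑ i ∈ Finset.range n, b i * z ^ i := by
  obtain ⟨k', hk'⟩ := hx.exists_formFil_le hN
  have hX := isUnitForm_X_pow (R := R) (0 : Fin (c + 1)) (k + k')
  have hev : eval x (X 0 ^ (k + k')) = x 0 ^ (k + k') := by simp
  refine exists_pow_eq_sum_of_mul_pow_mem (r := x 0 ^ (k + k')) (fun z hz => ?_) (fun i => ?_)
  · exact hx.eq_zero_of_mul_eq_zero hN hX (hev ▸ hz)
  · rw [← pow_mul]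
    have h0 : x 0 ∈ Ideal.span (Set.range x) := Ideal.subset_span ⟨0, rfl⟩
    have h1 : z ^ i ∈ Ideal.span (Set.range x) ^ (a * i - (k + k')) := by
      rcases le_total (a * i) (k + k') with hle | hle
      · rw [Nat.sub_eq_zero_of_le hle, pow_zero, Ideal.one_eq_top]; trivial
      · exact hk' _ (formFil_antitone (by omega) (h i))
    exact Ideal.pow_le_pow_right (show a * i ≤ k + k' + (a * i - (k + k')) by omega)
      (pow_add (Ideal.span (Set.range x)) _ _ ▸
        Ideal.mul_mem_mul (Ideal.pow_mem_pow h0 (k + k')) h1)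

variable [hN : Fact (∃ N, maximalIdeal R ^ N ≤ Ideal.span (Set.range x))]

theorem MaxGrowth.isIntegral_cls [IsAdicComplete (maximalIdeal R) R] (hx : MaxGrowth x)
    (S : SimpleChain (Ideal.span (Set.range x))) {t : ℝ} {y : R} (hy : y ∈ valLe x t) :
    IsIntegral (MvPolynomial (Fin (c + 1)) (ResidueField R)) (cls t y hy) := by
  by_cases hy' : y ∈ valLt x t
  · rw [cls_eq_zero_iff.2 hy']
    exact isIntegral_zero
  obtain ⟨N, hN'⟩ := hN.out
  obtain ⟨a, b, k, hb, hbt, h⟩ := exists_ordFun_bound S hy hy'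
  obtain ⟨n, p, hn, hp, hz⟩ := hx.exists_pow_eq_sum hN' h
  refine IsIntegral.of_pow hb ?_
  have hex : ∀ i, ∃ P : MvPolynomial (Fin (c + 1)) R, P.IsHomogeneous (a * (n - i)) ∧
      (i < n → eval x P = p i) := by
    intro i
    by_cases hi : i < n
    · have := hp i hi
      rw [← pow_mul, Ideal.mem_span_pow_iff_exists_isHomogeneous] at this
      obtain ⟨P, hP, hPe⟩ := this
      exact ⟨P, hP, fun _ => hPe⟩
    · exact ⟨0, isHomogeneous_zero _ _ _, fun h => absurd h hi⟩
  choose P hP hPe using hex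
  have hyb : y ^ b ∈ valLe x a := hbt ▸ pow_mem_valLe hy b
  have h1 : cls t y hy ^ b = cls a (y ^ b) hyb := by
    rw [cls_pow]
    exact cls_congr hbt rfl _
  rw [h1]
  refine isIntegral_of_pow_eq_sum (n := n) (fun i => map (residue R) (P i)) ?_
  have hmem : ∀ i, i ∈ Finset.range n → eval x (P i) * (y ^ b) ^ i ∈ valLe x (n * a) := by
    intro i hi
    have hi' := Finset.mem_range.1 hi
    have h2 := mul_mem_valLe (eval_mem_valLe (x := x) (hP i)) (pow_mem_valLe hyb i)
    have h3 : ((a * (n - i) : ℕ) : ℝ) + i * a = n * a := by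
      rw [Nat.cast_mul, Nat.cast_sub hi'.le]
      ring
    rwa [h3] at h2
  have h3 : ∀ i ∈ Finset.range n, map (residue R) (P i) • cls a (y ^ b) hyb ^ i =
      if h : i ∈ Finset.range n then cls (n * a) (eval x (P i) * (y ^ b) ^ i) (hmem i h) else 0 := by
    intro i hi
    have hi' := Finset.mem_range.1 hi
    rw [dif_pos hi, cls_pow, form_smul_cls (hP i)]
    refine cls_congr ?_ rfl _
    rw [Nat.cast_mul, Nat.cast_sub hi'.le]
    ring
  rw [Finset.sum_congr rfl h3, cls_pow, ← Finset.sum_coe_sort]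
  have h4 := cls_sum (Finset.univ : Finset (Finset.range n))
    (fun i => eval x (P i) * (y ^ b) ^ (i : ℕ)) (fun i => hmem i i.2)
  have h5 : ∑ i : Finset.range n, eval x (P i) * (y ^ b) ^ (i : ℕ) = (y ^ b) ^ n := by
    rw [hz, Finset.sum_coe_sort (Finset.range n) (fun i => eval x (P i) * (y ^ b) ^ i)]
    exact Finset.sum_congr rfl fun i hi => by rw [hPe i (Finset.mem_range.1 hi)]
  rw [cls_congr rfl h5.symm, h4]
  exact Finset.sum_congr rfl fun i _ => by rw [dif_pos i.2]

theorem MaxGrowth.isIntegral_valGr [IsAdicComplete (maximalIdeal R) R] (hx : MaxGrowth x)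
    (S : SimpleChain (Ideal.span (Set.range x))) :
    Algebra.IsIntegral (MvPolynomial (Fin (c + 1)) (ResidueField R)) (ValGr x) := by
  refine ⟨fun g => ?_⟩
  have hg : g ∈ AddSubmonoid.closure {g : ValGr x | ∃ t y, ∃ hy : y ∈ valLe x t, g = cls t y hy} := by
    rw [closure_cls]; trivial
  refine AddSubmonoid.closure_induction (motive := fun g _ =>
    IsIntegral (MvPolynomial (Fin (c + 1)) (ResidueField R)) g) ?_ isIntegral_zero
    (fun g h _ _ => IsIntegral.add) hg
  rintro _ ⟨t, y, hy, rfl⟩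
  exact hx.isIntegral_cls S hy

theorem MaxGrowth.finite_valGr [IsAdicComplete (maximalIdeal R) R] (hx : MaxGrowth x)
    (S : SimpleChain (Ideal.span (Set.range x))) :
    Module.Finite (MvPolynomial (Fin (c + 1)) (ResidueField R)) (ValGr x) := by
  have := hx.isIntegral_valGr S
  obtain ⟨p, hp⟩ := ExpChar.exists (ResidueField R)
  have : ExpChar (MvPolynomial (Fin (c + 1)) (ResidueField R)) p :=
    expChar_of_injective_ringHom (C_injective _ _) p
  exact finite_of_isReduced p (fun n => exists_rootLinear (ResidueField R) p n (Fin (c + 1)))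
    (rank_valGr_lt S)

end Integral

end NormalChern

namespace NormalChern

open Module IsLocalRing MvPolynomial

section Generators

variable {R : Type*} [CommRing R] [IsNoetherianRing R] [IsLocalRing R]
  [IsAdicComplete (maximalIdeal R) R] {c : ℕ} {x : Fin (c + 1) → R}
  [hN : Fact (∃ N, maximalIdeal R ^ N ≤ Ideal.span (Set.range x))]

/-- Finitely many elements generate the filtration by values modulo higher values. -/
theorem MaxGrowth.exists_generators (hx : MaxGrowth x) :
    ∃ (m : ℕ) (τ : Fin m → ℝ) (y : Fin m → R), (∀ i, y i ∈ valLe x (τ i)) ∧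
      ∀ D, ∀ w ∈ valLe x D, ∃ f : Fin m → MvPolynomial (Fin (c + 1)) R,
        (∀ i, f i = 0 ∨ ∃ n : ℕ, n + τ i = D ∧ IsUnitForm n (f i)) ∧
        w - ∑ i, eval x (f i) * y i ∈ valLt x D := by
  obtain ⟨N, hN'⟩ := hN.out
  obtain ⟨S⟩ := exists_simpleChain hN'
  have hfin := hx.finite_valGr S
  set P := MvPolynomial (Fin (c + 1)) (ResidueField R)
  set H : Set (ValGr x) := {g : ValGr x | ∃ t y, ∃ hy : y ∈ valLe x t, g = cls t y hy} with hH
  have htop : Submodule.span P H = ⊤ := by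
    refine top_le_iff.1 fun g _ => ?_
    have hg : g ∈ AddSubmonoid.closure H := by rw [hH, closure_cls]; trivial
    exact AddSubmonoid.closure_induction (motive := fun g _ => g ∈ Submodule.span P H)
      (fun g hg => Submodule.subset_span hg) (zero_mem _) (fun g h _ _ => add_mem) hg
  obtain ⟨s, hs, hspan⟩ := (Submodule.fg_span_iff_fg_span_finset_subset (R := P) H).1
    (htop ▸ hfin.fg_top)
  have hsH : ∀ i : Fin s.card, (s.equivFin.symm i : ValGr x) ∈ H := fun i =>
    hs (s.equivFin.symm i).2
  choose τ y hy hcls using hsH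
  refine ⟨s.card, τ, y, hy, fun D w hw => ?_⟩
  have hw' : cls D w hw ∈ Submodule.span P (Set.range fun i => cls (τ i) (y i) (hy i)) := by
    have h1 : (Set.range fun i => cls (τ i) (y i) (hy i)) = (s : Set (ValGr x)) := by
      ext g
      constructor
      · rintro ⟨i, rfl⟩
        change cls (τ i) (y i) (hy i) ∈ _
        rw [← hcls i]
        exact (s.equivFin.symm i).2
      · intro hg
        refine ⟨s.equivFin ⟨g, hg⟩, ?_⟩
        change cls _ _ _ = g
        rw [← hcls, Equiv.symm_apply_apply]
    rw [h1, ← hspan, htop]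
    trivial
  obtain ⟨a, ha⟩ := (Submodule.mem_span_range_iff_exists_fun P).1 hw'
  obtain ⟨f, hf, -, h⟩ := exists_forms_of_smul_cls Finset.univ a τ y hy D
  refine ⟨f, hf, ?_⟩
  rw [← neg_sub]
  exact neg_mem (h w hw ha)

theorem MaxGrowth.exists_values (hx : MaxGrowth x) :
    ∃ F : Finset ℝ, ∀ t y, y ∈ valLe x t → y ∉ valLt x t → ∃ τ ∈ F, ∃ n : ℕ, n + τ = t := by
  obtain ⟨m, τ, z, hz, h⟩ := hx.exists_generators
  refine ⟨Finset.univ.image τ, fun t y hy hy' => ?_⟩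
  obtain ⟨f, hf, hw⟩ := h t y hy
  by_contra! H
  have h0 : ∀ i, f i = 0 := fun i => (hf i).resolve_right fun ⟨n, hn, _⟩ =>
    H (τ i) (Finset.mem_image_of_mem τ (Finset.mem_univ i)) n hn
  refine hy' ?_
  rwa [Finset.sum_eq_zero fun i _ => by rw [h0 i, map_zero, zero_mul], sub_zero] at hw

/-- The filtration by values improves in finitely many steps up to a given bound. -/
theorem MaxGrowth.valLe_le_sup (hx : MaxGrowth x) {I : Ideal R} {t : ℝ}
    (h : ∀ s, t ≤ s → valLe x s ≤ I ⊔ valLt x s) (M : ℝ) : valLe x t ≤ I ⊔ valLe x M := by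
  classical
  obtain ⟨F, hF⟩ := hx.exists_values
  obtain ⟨K, hK⟩ : ∃ K : ℕ, ∀ τ ∈ F, M - τ < K := by
    obtain ⟨B, hB⟩ := (F.image (fun τ => M - τ)).bddAbove
    obtain ⟨K, hK⟩ := exists_nat_gt B
    exact ⟨K, fun τ hτ => (hB (Finset.mem_coe.2 (Finset.mem_image_of_mem _ hτ))).trans_lt hK⟩
  set L : Finset ℝ := (F ×ˢ Finset.range K).image (fun p => p.2 + p.1) with hL
  have key : ∀ n : ℕ, ∀ s, t ≤ s → (L.filter (s ≤ ·)).card = n → valLe x s ≤ I ⊔ valLe x M := by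
    intro n
    induction n using Nat.strong_induction_on with
    | _ n ih =>
    intro s hs hn w hw
    by_cases h0 : nu x w = 0
    · exact Ideal.mem_sup_right (by rw [mem_valLe, h0]; positivity)
    obtain ⟨v, hv0, hv⟩ := exists_value h0
    have hwv : w ∈ valLe x v := hv.le
    have hwv' : w ∉ valLt x v := fun h => (ne_of_lt (mem_valLt.1 h)) hv
    have hsv : s ≤ v := by
      by_contra! hlt
      exact hwv' (valLe_le_valLt hlt hw)
    by_cases hvM : M ≤ v
    · exact Ideal.mem_sup_right (valLe_antitone hvM hwv)
    obtain ⟨τ, hτ, k, hk⟩ := hF v w hwv hwv'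
    have hvL : v ∈ L.filter (s ≤ ·) := by
      refine Finset.mem_filter.2 ⟨Finset.mem_image.2 ⟨(τ, k), ?_, hk⟩, hsv⟩
      refine Finset.mem_product.2 ⟨hτ, Finset.mem_range.2 ?_⟩
      have := hK τ hτ
      have h1 : (k : ℝ) < K := by push Not at hvM; linarith
      exact_mod_cast h1
    obtain ⟨u, hu, w', hw', rfl⟩ := Submodule.mem_sup.1 (h v (hs.trans hsv) hwv)
    refine add_mem (Ideal.mem_sup_left hu) ?_
    by_cases h0' : nu x w' = 0
    · exact Ideal.mem_sup_right (by rw [mem_valLe, h0']; positivity)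
    obtain ⟨v', hv0', hv'⟩ := exists_value h0'
    have hvv' : v < v' := by
      by_contra! hle
      have h1 : w' ∉ valLt x v' := fun h => (ne_of_lt (mem_valLt.1 h)) hv'
      rcases hle.eq_or_lt with rfl | hlt
      · exact h1 hw'
      · exact h1 (valLe_le_valLt hlt (valLt_le_valLe v hw'))
    refine ih _ ?_ v' ((hs.trans hsv).trans hvv'.le) rfl hv'.le
    rw [← hn]
    refine Finset.card_lt_card (Finset.ssubset_iff_subset_ne.2 ⟨fun u hu => ?_, fun h => ?_⟩)
    · rw [Finset.mem_filter] at hu ⊢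
      exact ⟨hu.1, (hsv.trans hvv'.le).trans hu.2⟩
    · rw [← h, Finset.mem_filter] at hvL
      exact absurd hvL.2 (not_le.2 hvv')
  exact key _ t le_rfl rfl

theorem MaxGrowth.valLe_le [IsReduced R] (hx : MaxGrowth x)
    (hQ : Ideal.span (Set.range x) ≤ maximalIdeal R) {I : Ideal R} {t : ℝ}
    (h : ∀ s, t ≤ s → valLe x s ≤ I ⊔ valLt x s) : valLe x t ≤ I := by
  obtain ⟨N, hN'⟩ := hN.out
  intro y hy
  refine mem_of_forall_mem_sup_pow (J := maximalIdeal R) le_rfl fun M => ?_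
  obtain ⟨n, hn⟩ := exists_le_maximalIdeal_pow (a := fun n : ℕ => valLe x n)
    (fun m n hmn => valLe_antitone (by exact_mod_cast hmn)) (fun y hy => by
      refine hx.eq_zero_of_nu_eq_zero hQ hN' (le_antisymm ?_ (nu_nonneg y))
      refine le_of_forall_pos_le_add fun ε hε => ?_
      obtain ⟨n, hn⟩ := exists_pow_lt_of_lt_one hε (by norm_num : (1 / 2 : ℝ) < 1)
      have := hy n
      rw [mem_valLe, Real.rpow_natCast] at this
      linarith) M
  exact sup_le_sup_left hn I (hx.valLe_le_sup h n hy)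

theorem MaxGrowth.exists_valLe_le_pow [IsReduced R] (hx : MaxGrowth x)
    (hQ : Ideal.span (Set.range x) ≤ maximalIdeal R) :
    ∃ T : ℕ, ∀ n : ℕ, valLe x (T + n) ≤ Ideal.span (Set.range x) ^ n := by
  obtain ⟨m, τ, z, hz, h⟩ := hx.exists_generators
  obtain ⟨B, hB⟩ := (Finset.univ.image τ).bddAbove
  obtain ⟨T, hT⟩ := exists_nat_gt B
  have hτ : ∀ i, τ i < T := fun i =>
    (hB (Finset.mem_coe.2 (Finset.mem_image_of_mem τ (Finset.mem_univ i)))).trans_lt hT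
  have hstep : ∀ n : ℕ, valLe x (T + (n + 1 : ℕ)) ≤
      Ideal.span (Set.range x) * valLe x (T + n) := by
    intro n
    refine hx.valLe_le hQ fun s hs w hw => ?_
    obtain ⟨f, hf, hw'⟩ := h s w hw
    rw [← add_sub_cancel (∑ i, eval x (f i) * z i) w]
    refine add_mem (Ideal.mem_sup_left (sum_mem fun i _ => ?_)) (Ideal.mem_sup_right hw')
    rcases hf i with h0 | ⟨k, hk, hfk⟩
    · rw [h0, map_zero, zero_mul]
      exact zero_mem _
    · have hk0 : 0 < (k : ℝ) := by
        have := hτ i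
        push_cast at hs
        have : (0 : ℝ) ≤ n := Nat.cast_nonneg n
        linarith
      obtain ⟨j, rfl⟩ := Nat.exists_eq_add_of_lt (by exact_mod_cast hk0 : 0 < k)
      have h1 := eval_mem_pow x hfk.1
      rw [zero_add, pow_succ'] at h1
      have h2 : eval x (f i) * z i ∈ Ideal.span (Set.range x) * valLe x (j + τ i) := by
        refine Submodule.mul_induction_on h1 (fun a ha b hb => ?_) fun a b ha hb => ?_
        · rw [mul_assoc]
          exact Ideal.mul_mem_mul ha (mul_mem_valLe (pow_le_valLe j hb) (hz i))
        · rw [add_mul]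
          exact add_mem ha hb
      refine Ideal.mul_mono_right (valLe_antitone ?_) h2
      push_cast at hk hs
      linarith
  refine ⟨T, fun n => ?_⟩
  induction n with
  | zero => rw [pow_zero, Ideal.one_eq_top]; exact le_top
  | succ n ih =>
    rw [pow_succ']
    exact (hstep n).trans (Ideal.mul_mono_right ih)

theorem MaxGrowth.exists_pow_eq_sum_of_mem_valLe [IsReduced R] (hx : MaxGrowth x)
    (hQ : Ideal.span (Set.range x) ≤ maximalIdeal R) {n : ℕ} {y : R} (hy : y ∈ valLe x n) :
    ∃ (m : ℕ) (b : ℕ → R), 0 < m ∧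
      (∀ i < m, b i ∈ (Ideal.span (Set.range x) ^ n) ^ (m - i)) ∧
      y ^ m = ∑ i ∈ Finset.range m, b i * y ^ i := by
  obtain ⟨N, hN'⟩ := hN.out
  obtain ⟨T, hT⟩ := hx.exists_valLe_le_pow hQ
  refine hx.exists_pow_eq_sum hN' (k := T) fun i => pow_le_formFil _ ?_
  rcases le_total (n * i) T with h | h
  · rw [Nat.sub_eq_zero_of_le h, pow_zero, Ideal.one_eq_top]; trivial
  refine hT _ ?_
  rw [Nat.cast_sub h, add_sub_cancel, mul_comm, Nat.cast_mul]
  exact pow_mem_valLe hy i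

end Generators

end NormalChern

namespace NormalChern

theorem formDim_mul_le {k c : ℕ} (h : k < c) (n : ℕ) :
    formDim k n * (n + 1) ≤ (k + 1) ^ k * (n + 1) ^ c := by
  calc formDim k n * (n + 1) ≤ (k + 1) ^ k * (n + 1) ^ k * (n + 1) :=
        Nat.mul_le_mul_right _ (formDim_le k n)
    _ = (k + 1) ^ k * (n + 1) ^ (k + 1) := by ring
    _ ≤ _ := Nat.mul_le_mul_left _ (Nat.pow_le_pow_right n.succ_pos h)

theorem exists_formDim_add_le {k c : ℕ} (h : k ≤ c + 1) (T : ℕ) :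
    ∃ B, ∀ n, formDim k (n + T) ≤ formDim k n + B * (n + 1) ^ c := by
  rcases k with _ | k
  · exact ⟨0, fun n => by simp [formDim]⟩
  have hS : ∀ n, formDim (k + 1) n = formSum k (n + 1) := fun n => by
    rw [formSum_eq, formDim]
    congr 1
    ring
  refine ⟨T * ((k + 1) ^ k * (T + 2) ^ k), fun n => ?_⟩
  rw [hS, hS]
  refine (formSum_le_add k (n + T + 1) T).trans ?_
  rw [show n + T + 1 - T = n + 1 by omega, mul_assoc]
  refine Nat.add_le_add_left (Nat.mul_le_mul_left _ ((formDim_le _ _).trans ?_)) _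
  rw [mul_assoc]
  refine Nat.mul_le_mul_left _ ?_
  calc (n + T + 1 + 1) ^ k ≤ ((T + 2) * (n + 1)) ^ k := Nat.pow_le_pow_left (by nlinarith) k
    _ = (T + 2) ^ k * (n + 1) ^ k := mul_pow _ _ _
    _ ≤ _ := Nat.mul_le_mul_left _ (Nat.pow_le_pow_right n.succ_pos (by omega))

/-- If two polynomials in binomial form are close to each other and agree in the second
coefficient, then their difference grows slowly. -/
theorem exists_sub_lt_formDim {c N T : ℕ} {e e' : ℕ → ℤ} {P P' : ℕ → ℤ}
    (hP : ∀ n, P n = ∑ i ∈ Finset.range (c + 2), (-1 : ℤ) ^ i * e i * formDim (c + 1 - i) n)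
    (hP' : ∀ n, P' n = ∑ i ∈ Finset.range (c + 2), (-1 : ℤ) ^ i * e' i * formDim (c + 1 - i) n)
    (h1 : e' 1 = e 1) (hle : ∀ n ≥ N, P' n ≤ P n) (hle' : ∀ n ≥ N, P n ≤ P' (n + T)) (n₀ : ℕ) :
    ∃ l ≥ N, P (n₀ + l) - P' (n₀ + l) < formDim c l := by
  set a : ℕ → ℤ := fun i => (-1) ^ i * (e i - e' i) with ha
  set r : ℕ → ℤ := fun n => ∑ i ∈ Finset.range c, a (i + 2) * formDim (c - 1 - i) n with hr
  have hdiff : ∀ n, P n - P' n = a 0 * formDim (c + 1) n + r n := by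
    intro n
    have h2 : P n - P' n = ∑ i ∈ Finset.range (c + 2), a i * formDim (c + 1 - i) n := by
      rw [hP, hP', ← Finset.sum_sub_distrib]
      exact Finset.sum_congr rfl fun i _ => by rw [ha]; ring
    rw [h2, Finset.sum_range_succ', Finset.sum_range_succ']
    have h3 : a (0 + 1) = 0 := by simp [ha, h1]
    rw [h3, zero_mul, add_zero, add_comm]
    congr 1
    exact Finset.sum_congr rfl fun i _ => by rw [show c + 1 - (i + 1 + 1) = c - 1 - i by omega]
  obtain ⟨B, hB0, hB⟩ : ∃ B : ℤ, 0 ≤ B ∧ ∀ n : ℕ, |r n| * (n + 1) ≤ B * (n + 1) ^ c := by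
    refine ⟨∑ i ∈ Finset.range c, |a (i + 2)| * ((c - 1 - i : ℕ) + 1) ^ (c - 1 - i), by positivity,
      fun n => ?_⟩
    refine (mul_le_mul_of_nonneg_right (Finset.abs_sum_le_sum_abs _ _) (by positivity)).trans ?_
    rw [Finset.sum_mul, Finset.sum_mul]
    refine Finset.sum_le_sum fun i hi => ?_
    rw [abs_mul, Nat.abs_cast, mul_assoc, mul_assoc]
    refine mul_le_mul_of_nonneg_left ?_ (abs_nonneg _)
    have hi' := Finset.mem_range.1 hi
    exact_mod_cast formDim_mul_le (show c - 1 - i < c by omega) n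
  obtain ⟨B', hB0', hB'⟩ : ∃ B' : ℤ, 0 ≤ B' ∧ ∀ n : ℕ, P' (n + T) - P' n ≤ B' * (n + 1) ^ c := by
    choose b hb using fun i : ℕ => exists_formDim_add_le (c := c) (Nat.sub_le (c + 1) i) T
    refine ⟨∑ i ∈ Finset.range (c + 2), |e' i| * b i, by positivity, fun n => ?_⟩
    rw [hP', hP', ← Finset.sum_sub_distrib, Finset.sum_mul]
    refine Finset.sum_le_sum fun i _ => ?_
    rw [← mul_sub]
    refine (le_abs_self _).trans ?_
    rw [abs_mul, abs_mul, abs_pow, abs_neg, abs_one, one_pow, one_mul, mul_assoc]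
    refine mul_le_mul_of_nonneg_left ?_ (abs_nonneg _)
    have h2 : (formDim (c + 1 - i) n : ℤ) ≤ formDim (c + 1 - i) (n + T) := by
      exact_mod_cast formDim_mono _ (Nat.le_add_right n T)
    rw [abs_of_nonneg (sub_nonneg.2 h2), sub_le_iff_le_add']
    exact_mod_cast hb i n
  have ha0 : a 0 = 0 := by
    by_contra h0
    have h2 : 1 ≤ |a 0| := Int.one_le_abs h0
    set K : ℤ := (c + 1).factorial * (B' + B) with hK
    have hK0 : 0 ≤ K := by positivity
    set n : ℕ := N + K.toNat with hn
    have hnK : K ≤ n := by rw [hn]; push_cast; rw [Int.toNat_of_nonneg hK0]; omega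
    have h3 := hle n (by omega)
    have h4 := (hle' n (by omega)).trans (sub_le_iff_le_add'.1 (hB' n))
    have h5 : |a 0 * formDim (c + 1) n| ≤ (B' + B) * (n + 1) ^ c := by
      have h6 : |r n| ≤ B * (n + 1) ^ c := le_trans (le_mul_of_one_le_right (abs_nonneg _)
        (by linarith [Nat.cast_nonneg (α := ℤ) n])) (hB n)
      have h7 := hdiff n
      rw [abs_le] at h6 ⊢
      have h8 : 0 ≤ B' * ((n : ℤ) + 1) ^ c := by positivity
      constructor <;> nlinarith
    rw [abs_mul, Nat.abs_cast] at h5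
    have h6 : ((n : ℤ) + 1) ^ (c + 1) ≤ (c + 1).factorial * formDim (c + 1) n := by
      exact_mod_cast pow_le_formDim (c + 1) n
    have h7 : ((n : ℤ) + 1) ^ c * (n + 1) ≤ (n + 1) ^ c * K := by
      calc ((n : ℤ) + 1) ^ c * (n + 1) = (n + 1) ^ (c + 1) := by ring
        _ ≤ (c + 1).factorial * formDim (c + 1) n := h6
        _ ≤ (c + 1).factorial * (|a 0| * formDim (c + 1) n) := by
          refine mul_le_mul_of_nonneg_left ?_ (by positivity)
          exact le_mul_of_one_le_left (by positivity) h2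
        _ ≤ (c + 1).factorial * ((B' + B) * (n + 1) ^ c) :=
          mul_le_mul_of_nonneg_left h5 (by positivity)
        _ = _ := by rw [hK]; ring
    have h8 := le_of_mul_le_mul_left h7 (by positivity)
    omega
  by_contra! H
  set K : ℤ := c.factorial * (B * (n₀ + 1) ^ c) with hK
  have hK0 : 0 ≤ K := by positivity
  set l : ℕ := N + K.toNat with hl
  have hlK : K ≤ l := by rw [hl]; push_cast; rw [Int.toNat_of_nonneg hK0]; omega
  have h3 := H l (by omega)
  rw [hdiff, ha0, zero_mul, zero_add] at h3
  have h4 : ((l : ℤ) + 1) ^ c ≤ c.factorial * formDim c l := by exact_mod_cast pow_le_formDim c l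
  have h5 : ((l : ℤ) + 1) ^ c * ((n₀ + l : ℕ) + 1) ≤ ((l : ℤ) + 1) ^ c * K := by
    calc ((l : ℤ) + 1) ^ c * ((n₀ + l : ℕ) + 1)
        ≤ c.factorial * |r (n₀ + l)| * ((n₀ + l : ℕ) + 1) := by
          refine mul_le_mul_of_nonneg_right (h4.trans ?_) (by positivity)
          exact mul_le_mul_of_nonneg_left (h3.trans (le_abs_self _)) (by positivity)
      _ = c.factorial * (|r (n₀ + l)| * ((n₀ + l : ℕ) + 1)) := by ring
      _ ≤ c.factorial * (B * ((n₀ + l : ℕ) + 1) ^ c) :=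
        mul_le_mul_of_nonneg_left (hB _) (by positivity)
      _ ≤ c.factorial * (B * (((n₀ + 1) * (l + 1)) ^ c)) := by
        refine mul_le_mul_of_nonneg_left (mul_le_mul_of_nonneg_left
          (pow_le_pow_left₀ (by positivity) ?_ c) hB0) (by positivity)
        push_cast
        nlinarith [Nat.cast_nonneg (α := ℤ) n₀, Nat.cast_nonneg (α := ℤ) l]
      _ = _ := by rw [hK, mul_pow]; ring
  have h6 := le_of_mul_le_mul_left h5 (by positivity)
  push_cast at h6
  have : (0 : ℤ) ≤ n₀ := Nat.cast_nonneg _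
  linarith

end NormalChern

namespace NormalChern

open Module IsLocalRing MvPolynomial

theorem exists_algebraMap_eq_of_smul_eq {S G : Type*} [CommRing S] [IsDomain S]
    [IsIntegrallyClosed S] [CommRing G] [Nontrivial G] [Algebra S G] [IsTorsionFree S G] {g h : S}
    {u : G} (hg : g ≠ 0) (hu : IsIntegral S u) (h : g • u = algebraMap S G h) :
    ∃ q, u = algebraMap S G q := by
  rename_i h'
  obtain ⟨p, hp, hpu⟩ := hu
  have hinj : Function.Injective (algebraMap S G) := by
    refine (injective_iff_map_eq_zero _).2 fun s hs => ?_
    rw [Algebra.algebraMap_eq_smul_one] at hs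
    exact (smul_eq_zero.1 hs).resolve_right one_ne_zero
  have h1 : Polynomial.eval h' (p.scaleRoots g) = 0 := by
    refine hinj ?_
    rw [map_zero, ← Polynomial.eval₂_hom, ← h, Algebra.smul_def,
      Polynomial.scaleRoots_eval₂_mul, hpu, mul_zero]
  set K := FractionRing S
  have hg' : algebraMap S K g ≠ 0 := by
    rwa [Ne, IsFractionRing.to_map_eq_zero_iff]
  have h2 : IsIntegral S (algebraMap S K h' / algebraMap S K g) := by
    refine ⟨p, hp, ?_⟩
    have h3 := Polynomial.scaleRoots_eval₂_mul (p := p) (algebraMap S K)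
      (algebraMap S K h' / algebraMap S K g) g
    rw [mul_div_cancel₀ _ hg', Polynomial.eval₂_hom, h1, map_zero] at h3
    exact (mul_eq_zero.1 h3.symm).resolve_left (pow_ne_zero _ hg')
  obtain ⟨q, hq⟩ := IsIntegrallyClosed.isIntegral_iff.1 h2
  refine ⟨q, ?_⟩
  rw [eq_div_iff hg', ← map_mul] at hq
  have h4 : q * g = h' := IsFractionRing.injective S K hq
  rw [← h4, mul_comm, map_mul, ← Algebra.smul_def] at h
  exact smul_right_injective G hg h

section Values

variable {R : Type*} [CommRing R] [IsNoetherianRing R] [IsLocalRing R]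
  [IsAdicComplete (maximalIdeal R) R] [IsReduced R] {c : ℕ} {x : Fin (c + 1) → R}
  [hN : Fact (∃ N, maximalIdeal R ^ N ≤ Ideal.span (Set.range x))]

omit [IsAdicComplete (maximalIdeal R) R] in
theorem MaxGrowth.one_notMem_valLt (hx : MaxGrowth x)
    (hQ : Ideal.span (Set.range x) ≤ maximalIdeal R) : (1 : R) ∉ valLt x 0 := by
  obtain ⟨N, hN'⟩ := hN.out
  intro h
  rw [mem_valLt, Real.rpow_zero] at h
  have h1 : nu x 1 ≠ 0 := fun h0 => one_ne_zero (hx.eq_zero_of_nu_eq_zero hQ hN' h0)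
  have h2 := nu_pow (x := x) 1 (n := 2) (by norm_num)
  rw [one_pow, sq] at h2
  have h3 : nu x 1 = 1 := (mul_right_cancel₀ h1 ((one_mul _).trans h2)).symm
  exact absurd h (by rw [h3]; exact lt_irrefl _)

omit [IsAdicComplete (maximalIdeal R) R] in
theorem MaxGrowth.nontrivial_valGr (hx : MaxGrowth x)
    (hQ : Ideal.span (Set.range x) ≤ maximalIdeal R) : Nontrivial (ValGr x) := by
  refine ⟨1, 0, fun h => hx.one_notMem_valLt hQ ?_⟩
  rw [← cls_one] at h
  exact cls_eq_zero_iff.1 h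

omit [IsAdicComplete (maximalIdeal R) R] in
theorem MaxGrowth.algebraMap_injective (hx : MaxGrowth x)
    (hQ : Ideal.span (Set.range x) ≤ maximalIdeal R) : Function.Injective
      (algebraMap (MvPolynomial (Fin (c + 1)) (ResidueField R)) (ValGr x)) := by
  have := hx.nontrivial_valGr hQ
  refine (injective_iff_map_eq_zero _).2 fun s hs => ?_
  rw [Algebra.algebraMap_eq_smul_one] at hs
  exact (smul_eq_zero.1 hs).resolve_right one_ne_zero

theorem MaxGrowth.cls_eq_algebraMap (hx : MaxGrowth x)
    (hQ : Ideal.span (Set.range x) ≤ maximalIdeal R)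
    (hform : ∀ n : ℕ, valLe x n ≤ formFil x n) {n : ℕ} {y : R} (hy : y ∈ valLe x n) :
    ∃ p, cls n y hy =
      algebraMap (MvPolynomial (Fin (c + 1)) (ResidueField R)) (ValGr x) p := by
  obtain ⟨N, hN'⟩ := hN.out
  obtain ⟨S⟩ := exists_simpleChain hN'
  have := hx.nontrivial_valGr hQ
  obtain ⟨s, g, hg, h⟩ := hform n hy
  rw [Ideal.mem_span_pow_iff_exists_isHomogeneous] at h
  obtain ⟨f, hf, hfe⟩ := h
  refine exists_algebraMap_eq_of_smul_eq (g := map (residue R) g) (h := map (residue R) f) hg.2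
    (hx.isIntegral_cls S hy) ?_
  rw [form_smul_cls hg.1, algebraMap_form hf]
  exact cls_congr (by push_cast; ring) hfe.symm _

theorem MaxGrowth.exists_eval_sub_mem (hx : MaxGrowth x)
    (hQ : Ideal.span (Set.range x) ≤ maximalIdeal R)
    (hform : ∀ n : ℕ, valLe x n ≤ formFil x n) {n : ℕ} {y : R} (hy : y ∈ valLe x n) :
    ∃ f : MvPolynomial (Fin (c + 1)) R, f.IsHomogeneous n ∧ eval x f - y ∈ valLt x n := by
  obtain ⟨p, hp⟩ := hx.cls_eq_algebraMap hQ hform hy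
  have h1 : (1 : R) ∈ valLe x 0 := valLe_zero (x := x) ▸ trivial
  obtain ⟨f, hf, -, h⟩ := exists_forms_of_smul_cls ({()} : Finset Unit) (fun _ => p) (fun _ => 0)
    (fun _ => (1 : R)) (fun _ => h1) n
  have h2 := h y hy (by
    rw [Finset.sum_singleton, hp, cls_one, Algebra.algebraMap_eq_smul_one])
  rw [Finset.sum_singleton, mul_one] at h2
  refine ⟨f (), ?_, h2⟩
  rcases hf () with h0 | ⟨m, hm, hfm⟩
  · rw [h0]; exact isHomogeneous_zero _ _ _
  · rw [add_zero] at hm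
    rw [← (Nat.cast_injective hm : m = n)]
    exact hfm.1

theorem MaxGrowth.mul_notMem_valLt (hx : MaxGrowth x)
    (hQ : Ideal.span (Set.range x) ≤ maximalIdeal R)
    (hform : ∀ n : ℕ, valLe x n ≤ formFil x n) {s t : ℝ} {y z : R} (hy : y ∈ valLe x s)
    (hy' : y ∉ valLt x s) (hz : z ∈ valLe x t) (hz' : z ∉ valLt x t) :
    y * z ∉ valLt x (s + t) := by
  obtain ⟨N, hN'⟩ := hN.out
  obtain ⟨S⟩ := exists_simpleChain hN'
  have key : ∀ {s : ℝ} {y : R} (hy : y ∈ valLe x s), y ∉ valLt x s → ∃ b : ℕ, 0 < b ∧ ∃ p,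
      p ≠ 0 ∧ cls s y hy ^ b =
        algebraMap (MvPolynomial (Fin (c + 1)) (ResidueField R)) (ValGr x) p := by
    intro s y hy hy'
    obtain ⟨a, b, -, hb, hbs, -⟩ := exists_ordFun_bound S hy hy'
    have hyb : y ^ b ∈ valLe x a := hbs ▸ pow_mem_valLe hy b
    obtain ⟨p, hp⟩ := hx.cls_eq_algebraMap hQ hform hyb
    have h1 : cls s y hy ^ b = cls a (y ^ b) hyb := by
      rw [cls_pow]
      exact cls_congr hbs rfl _
    refine ⟨b, hb, p, ?_, h1.trans hp⟩
    rintro rfl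
    rw [map_zero, cls_eq_zero_iff, ← hbs] at hp
    exact hy' ((pow_mem_valLt_iff hb).1 hp)
  obtain ⟨a, ha, p, hp, hpy⟩ := key hy hy'
  obtain ⟨b, hb, q, hq, hqz⟩ := key hz hz'
  intro h
  rw [← cls_eq_zero_iff (hy := mul_mem_valLe hy hz), ← cls_mul hy hz] at h
  have h1 : (cls s y hy * cls t z hz) ^ (a * b) = algebraMap _ (ValGr x) (p ^ b * q ^ a) := by
    rw [mul_pow, pow_mul, mul_comm a b, pow_mul, hpy, hqz, map_mul, map_pow, map_pow]
  rw [h, zero_pow (by positivity)] at h1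
  refine mul_ne_zero (pow_ne_zero b hp) (pow_ne_zero a hq) (hx.algebraMap_injective hQ ?_)
  rw [← h1, map_zero]

end Values

end NormalChern

namespace NormalChern

open Module IsLocalRing MvPolynomial

theorem exists_isUnit_coeff_eval_sub_mem {R : Type*} [CommRing R] [IsLocalRing R] {k : ℕ}
    (x : Fin k → R) {f : MvPolynomial (Fin k) R} (hf : f.IsHomogeneous 1)
    (h0 : map (residue R) f ≠ 0) :
    ∃ j, ∃ a : R, IsUnit a ∧ eval x f - a * x j ∈ Ideal.span (x '' {j}ᶜ) := by
  classical
  obtain ⟨e, he⟩ := ne_zero_iff.1 h0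
  rw [coeff_map] at he
  have h1 : ∀ e : Fin k →₀ ℕ, coeff e f ≠ 0 → ∃ j, e = Finsupp.single j 1 := fun e he => by
    have h2 := hf he
    have h3 : e.degree = 1 := (congrArg (fun w => w e) Finsupp.degree_eq_weight_one).trans h2
    rw [Finsupp.degree_eq_sum] at h3
    obtain ⟨j, -, hj⟩ := Finset.exists_ne_zero_of_sum_ne_zero (h3.trans_ne one_ne_zero)
    rw [← Finset.add_sum_erase _ _ (Finset.mem_univ j)] at h3
    refine ⟨j, Finsupp.ext fun i => ?_⟩
    by_cases hi : i = j
    · subst hi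
      rw [Finsupp.single_eq_same]
      omega
    · rw [Finsupp.single_eq_of_ne hi]
      exact Finset.sum_eq_zero_iff.1 (by omega) i (Finset.mem_erase.2 ⟨hi, Finset.mem_univ i⟩)
  obtain ⟨j, rfl⟩ := h1 e (fun h => he (by rw [h, map_zero]))
  refine ⟨j, coeff (Finsupp.single j 1) f, ?_, ?_⟩
  · by_contra hu
    exact he ((residue_eq_zero_iff _).2 ((mem_maximalIdeal _).2 hu))
  have h2 : Finsupp.single j 1 ∈ f.support := mem_support_iff.2 fun h => he (by rw [h, map_zero])
  rw [eval_eq', ← Finset.add_sum_erase _ _ h2]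
  have h3 : ∀ i, ∏ l, x l ^ (Finsupp.single i 1 : Fin k →₀ ℕ) l = x i := fun i => by
    rw [Finset.prod_eq_single i]
    · simp
    · intro b _ hb
      rw [Finsupp.single_eq_of_ne hb, pow_zero]
    · simp
  rw [h3, add_sub_cancel_left]
  refine Ideal.sum_mem _ fun e he' => ?_
  obtain ⟨hne, he'⟩ := Finset.mem_erase.1 he'
  obtain ⟨i, rfl⟩ := h1 e (mem_support_iff.1 he')
  rw [h3]
  refine Ideal.mul_mem_left _ _ (Ideal.subset_span ⟨i, ?_, rfl⟩)
  rintro rfl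
  exact hne rfl

section Values

variable {R : Type*} [CommRing R] [IsLocalRing R] {c : ℕ}

/-- `y` has value exactly `t` for the filtration defined by `nu x`. -/
structure HasValue (x : Fin (c + 1) → R) (t : ℝ) (y : R) : Prop where
  mem : y ∈ valLe x t
  notMem : y ∉ valLt x t

variable {x : Fin (c + 1) → R}

theorem exists_hasValue {y : R} (hy : nu x y ≠ 0) : ∃ t, HasValue x t y := by
  obtain ⟨t, -, ht⟩ := exists_value hy
  exact ⟨t, mem_valLe.2 ht.le, fun h => (mem_valLt.1 h).ne ht⟩

variable [IsNoetherianRing R] [IsAdicComplete (maximalIdeal R) R] [IsReduced R]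
  [hN : Fact (∃ N, maximalIdeal R ^ N ≤ Ideal.span (Set.range x))]

theorem HasValue.mul (hx : MaxGrowth x) (hQ : Ideal.span (Set.range x) ≤ maximalIdeal R)
    (hform : ∀ n : ℕ, valLe x n ≤ formFil x n) {s t : ℝ} {y z : R} (hy : HasValue x s y)
    (hz : HasValue x t z) : HasValue x (s + t) (y * z) :=
  ⟨mul_mem_valLe hy.1 hz.1, hx.mul_notMem_valLt hQ hform hy.1 hy.2 hz.1 hz.2⟩

omit [IsNoetherianRing R] [IsAdicComplete (maximalIdeal R) R] [IsReduced R] hN in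
theorem HasValue.pow {t : ℝ} {y : R} (hy : HasValue x t y) {n : ℕ} (hn : 1 ≤ n) :
    HasValue x (n * t) (y ^ n) :=
  ⟨pow_mem_valLe hy.1 n, fun h => hy.2 ((pow_mem_valLt_iff hn).1 h)⟩

omit [IsAdicComplete (maximalIdeal R) R] in
theorem IsUnitForm.hasValue (hx : MaxGrowth x) (hQ : Ideal.span (Set.range x) ≤ maximalIdeal R)
    {s : ℕ} {g : MvPolynomial (Fin (c + 1)) R} (hg : IsUnitForm s g) : HasValue x s (eval x g) := by
  refine ⟨eval_mem_valLe hg.1, fun h => hx.one_notMem_valLt hQ ?_⟩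
  rw [← eval_mul_mem_valLt_iff hg, mul_one, add_zero]
  exact h

theorem MaxGrowth.exists_min_value (hx : MaxGrowth x)
    (hQ : Ideal.span (Set.range x) ≤ maximalIdeal R) :
    ∃ τ y, 0 < τ ∧ τ ≤ 1 ∧ HasValue x τ y ∧ ∀ t z, 0 < t → HasValue x t z → τ ≤ t := by
  classical
  obtain ⟨F, hF⟩ := hx.exists_values
  obtain ⟨K, hK⟩ : ∃ K : ℕ, ∀ τ ∈ F, 1 - τ < K := by
    obtain ⟨B, hB⟩ := (F.image (fun τ => 1 - τ)).bddAbove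
    obtain ⟨K, hK⟩ := exists_nat_gt B
    exact ⟨K, fun τ hτ => (hB (Finset.mem_coe.2 (Finset.mem_image_of_mem _ hτ))).trans_lt hK⟩
  set G := ((F ×ˢ Finset.range K).image (fun p : ℝ × ℕ => (p.2 : ℝ) + p.1)).filter
    (fun t => 0 < t ∧ t ≤ 1 ∧ ∃ y, HasValue x t y) with hG
  have hmem : ∀ t, 0 < t → t ≤ 1 → (∃ y, HasValue x t y) → t ∈ G := by
    rintro t h0 h1 ⟨y, hy⟩
    obtain ⟨τ, hτ, n, hn⟩ := hF t y hy.1 hy.2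
    rw [hG, Finset.mem_filter]
    refine ⟨Finset.mem_image.2 ⟨(τ, n), Finset.mem_product.2 ⟨hτ, Finset.mem_range.2 ?_⟩, hn⟩,
      h0, h1, y, hy⟩
    have h2 := hK τ hτ
    have h3 : (n : ℝ) < K := by linarith
    exact_mod_cast h3
  have h1 : (1 : ℝ) ∈ G := by
    have h2 := (isUnitForm_X_pow (R := R) (c := c) 0 1).hasValue hx hQ
    rw [Nat.cast_one] at h2
    exact hmem 1 one_pos le_rfl ⟨_, h2⟩
  have hmin := G.min'_mem ⟨1, h1⟩
  have h2 := (Finset.mem_filter.1 hmin).2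
  obtain ⟨y, hy⟩ := h2.2.2
  refine ⟨_, y, h2.1, h2.2.1, hy, fun t z ht hz => ?_⟩
  rcases le_total t 1 with h | h
  · exact G.min'_le _ (hmem t ht h ⟨z, hz⟩)
  · exact h2.2.1.trans h

omit [IsNoetherianRing R] [IsAdicComplete (maximalIdeal R) R] [IsReduced R] in
theorem maximalIdeal_le_valLe {τ : ℝ} (hτ : ∀ t z, 0 < t → HasValue x t z → τ ≤ t) :
    maximalIdeal R ≤ valLe x τ := by
  obtain ⟨N, hN'⟩ := hN.out
  intro y hy
  by_cases h0 : nu x y = 0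
  · rw [mem_valLe, h0]; positivity
  obtain ⟨t, ht⟩ := exists_hasValue h0
  refine valLe_antitone (hτ t y ?_ ht) ht.1
  by_contra! h
  refine ht.2 (mem_valLt.2 ((nu_lt_one hN' hy).trans_le ?_))
  exact Real.one_le_rpow_of_pos_of_le_one_of_nonpos (by norm_num) (by norm_num) h

omit [IsAdicComplete (maximalIdeal R) R] in
theorem HasValue.mem_maximalIdeal (hx : MaxGrowth x)
    (hQ : Ideal.span (Set.range x) ≤ maximalIdeal R) {τ : ℝ} (h0 : 0 < τ) {y : R}
    (hy : HasValue x τ y) : y ∈ maximalIdeal R := by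
  rw [IsLocalRing.mem_maximalIdeal]
  rintro ⟨u, rfl⟩
  refine hx.one_notMem_valLt hQ (valLe_le_valLt h0 ?_)
  rw [← u.mul_inv]
  exact Ideal.mul_mem_right _ _ hy.1

omit [IsAdicComplete (maximalIdeal R) R] in
theorem MaxGrowth.valLt_le_valLe_add (hx : MaxGrowth x)
    (hQ : Ideal.span (Set.range x) ≤ maximalIdeal R)
    (hform : ∀ n : ℕ, valLe x n ≤ formFil x n) {τ : ℝ}
    (hτ : ∀ t z, 0 < t → HasValue x t z → τ ≤ t) (s : ℕ) : valLt x s ≤ valLe x (s + τ) := by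
  intro y hy
  obtain ⟨l, g, hg, h⟩ := hform s (valLt_le_valLe _ hy)
  obtain ⟨f, hf, hfe⟩ := (Ideal.mem_span_pow_iff_exists_isHomogeneous _ _).1 h
  have h1 : map (residue R) f = 0 := by
    refine hx.algebraMap_injective hQ ?_
    rw [map_zero, algebraMap_form hf, cls_eq_zero_iff, hfe, add_comm s l, Nat.cast_add,
      eval_mul_mem_valLt_iff hg]
    exact hy
  have h2 := eval_mem_of_map_residue_eq_zero x hf h1
  rw [← eval_mul_mem_valLe_iff hg, ← hfe]
  have h3 : ((l : ℝ) + (s + τ)) = τ + (s + l : ℕ) := by push_cast; ring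
  rw [h3]
  refine (Ideal.mul_le (K := valLe x (τ + (s + l : ℕ)))).2 (fun a ha b hb => ?_) h2
  exact mul_mem_valLe (maximalIdeal_le_valLe hτ ha) (pow_le_valLe _ hb)

/-- The values form the set of multiples of the minimal positive value. -/
theorem MaxGrowth.exists_values_eq (hx : MaxGrowth x)
    (hQ : Ideal.span (Set.range x) ≤ maximalIdeal R)
    (hform : ∀ n : ℕ, valLe x n ≤ formFil x n) {τ : ℝ} (h0 : 0 < τ) (h1 : τ ≤ 1) {y : R}
    (hy : HasValue x τ y) (hτ : ∀ t z, 0 < t → HasValue x t z → τ ≤ t) :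
    ∃ r : ℕ, 1 ≤ r ∧ r * τ = 1 ∧
      ∀ t z, HasValue x t z → ∃ n j : ℕ, j < r ∧ (n : ℝ) + j * τ = t := by
  have key : ∀ t z, HasValue x t z → ∃ i : ℕ, t + i * τ = (⌈t⌉₊ : ℕ) := by
    intro t z hz
    have ht0 : 0 ≤ t := nonneg_of_notMem_valLt hz.2
    set m := ⌈t⌉₊
    have hm : t ≤ m := Nat.le_ceil t
    set i := ⌊(m - t) / τ⌋₊
    have hi : i * τ ≤ m - t := by
      rw [← le_div_iff₀ h0]
      exact Nat.floor_le (div_nonneg (by linarith) h0.le)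
    have hi' : m - t < (i + 1) * τ := by
      rw [← div_lt_iff₀ h0]
      exact Nat.lt_floor_add_one _
    refine ⟨i, ?_⟩
    by_contra hne
    have h2 : HasValue x (t + (i + 1 : ℕ) * τ) (z * y ^ (i + 1)) :=
      hz.mul hx hQ hform (hy.pow (by omega))
    have h3 : z * y ^ (i + 1) ∈ valLt x m := valLe_le_valLt (by push_cast; linarith) h2.1
    have h4 := hx.valLt_le_valLe_add hQ hform hτ m h3
    refine h2.2 (valLe_le_valLt ?_ h4)
    have h5 : t + i * τ < m := lt_of_le_of_ne (by linarith) hne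
    push_cast
    linarith
  obtain ⟨r, hr, hrτ⟩ : ∃ r : ℕ, 1 ≤ r ∧ r * τ = 1 := by
    obtain ⟨i, hi⟩ := key τ y hy
    rw [(Nat.ceil_eq_iff one_ne_zero).2 ⟨by simpa using h0, by simpa using h1⟩] at hi
    exact ⟨i + 1, by omega, by push_cast at hi ⊢; linarith⟩
  refine ⟨r, hr, hrτ, fun t z hz => ?_⟩
  have ht0 : 0 ≤ t := nonneg_of_notMem_valLt hz.2
  obtain ⟨i, hmi⟩ := key t z hz
  set m := ⌈t⌉₊
  have h2 : t = ((m * r : ℕ) - i) * τ := by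
    push_cast
    rw [sub_mul, mul_assoc, hrτ]
    linarith
  have h3 : i ≤ m * r := by
    by_contra! h
    have : ((m * r : ℕ) : ℝ) < i := by exact_mod_cast h
    nlinarith
  rw [← Nat.cast_sub h3] at h2
  refine ⟨(m * r - i) / r, (m * r - i) % r, Nat.mod_lt _ hr, ?_⟩
  have h4 : ((m * r - i : ℕ) : ℝ) = r * ((m * r - i) / r : ℕ) + ((m * r - i) % r : ℕ) := by
    exact_mod_cast (Nat.div_add_mod _ _).symm
  rw [h2, h4, add_mul, mul_right_comm, hrτ, one_mul]

theorem MaxGrowth.exists_sub_pow_mul_mem (hx : MaxGrowth x)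
    (hQ : Ideal.span (Set.range x) ≤ maximalIdeal R)
    (hform : ∀ n : ℕ, valLe x n ≤ formFil x n) {τ : ℝ} {y : R} (hy : HasValue x τ y) {r : ℕ}
    (hr : r * τ = 1) {f : MvPolynomial (Fin (c + 1)) R} (hf : f.IsHomogeneous 1)
    (hfy : eval x f - y ^ r ∈ valLt x 1) (hprime : Prime (map (residue R) f)) {n j : ℕ}
    (hj : j < r) {z : R} (hz : z ∈ valLe x (n + j * τ)) :
    ∃ w ∈ Ideal.span (Set.range x) ^ n, z - y ^ j * w ∈ valLt x (n + j * τ) := by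
  have hval : (n : ℝ) + j * τ + (r - j : ℕ) * τ = (n + 1 : ℕ) := by
    rw [Nat.cast_sub hj.le]; push_cast; linarith
  have h1 : z * y ^ (r - j) ∈ valLe x (n + 1 : ℕ) :=
    hval ▸ mul_mem_valLe hz (pow_mem_valLe hy.1 _)
  have hval' : (r : ℝ) * (n + j * τ) = (r * n + j : ℕ) := by
    push_cast; rw [mul_add, mul_left_comm, hr]; ring
  have h2 : z ^ r ∈ valLe x (r * n + j : ℕ) := hval' ▸ pow_mem_valLe hz r
  have h3 : y ^ r ∈ valLe x 1 := hr ▸ pow_mem_valLe hy.1 r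
  obtain ⟨F, hF, hFe⟩ := hx.exists_eval_sub_mem hQ hform h1
  obtain ⟨H, hH, hHe⟩ := hx.exists_eval_sub_mem hQ hform h2
  have hF' : algebraMap _ (ValGr x) (map (residue R) F) =
      cls (n + j * τ) z hz * cls τ y hy.1 ^ (r - j) := by
    have h : cls τ y hy.1 ^ (r - j) = cls _ _ (pow_mem_valLe hy.1 (r - j)) := cls_pow hy.1 _
    rw [h]
    refine (algebraMap_form hF).trans (((cls_eq_iff (hz := h1)).2 hFe).trans ?_)
    exact (cls_congr hval.symm rfl h1).trans (cls_mul hz (pow_mem_valLe hy.1 (r - j))).symm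
  have hH' : algebraMap _ (ValGr x) (map (residue R) H) = cls (n + j * τ) z hz ^ r := by
    refine (algebraMap_form hH).trans (((cls_eq_iff (hz := h2)).2 hHe).trans ?_)
    exact (cls_congr hval'.symm rfl h2).trans (cls_pow hz r).symm
  have hf' : algebraMap _ (ValGr x) (map (residue R) f) = cls 1 (y ^ r) h3 := by
    rw [algebraMap_form hf]
    refine (cls_congr Nat.cast_one rfl _).trans (cls_eq_iff.2 hfy)
  have hf'' : cls 1 (y ^ r) h3 = cls τ y hy.1 ^ r := by
    rw [cls_pow]
    exact cls_congr hr.symm rfl _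
  have h4 : map (residue R) F ^ r = map (residue R) H * map (residue R) f ^ (r - j) := by
    refine hx.algebraMap_injective hQ ?_
    rw [map_pow, map_mul, map_pow, hF', hH', hf', hf'']
    ring
  obtain ⟨W, hW⟩ : map (residue R) f ∣ map (residue R) F := by
    refine hprime.dvd_of_dvd_pow (n := r) ?_
    rw [h4]
    exact dvd_mul_of_dvd_right (dvd_pow_self _ (by omega)) _
  obtain ⟨g, hg, -, hgw⟩ := exists_forms_of_smul_cls ({()} : Finset Unit) (fun _ => W)
    (fun _ => 1) (fun _ => y ^ r) (fun _ => h3) (n + 1 : ℕ)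
  have h5 := hgw _ h1 (by
    rw [Finset.sum_singleton, Algebra.smul_def, ← hf', ← map_mul, mul_comm, ← hW, algebraMap_form hF,
      cls_eq_iff]
    exact hFe)
  rw [Finset.sum_singleton] at h5
  have h6 : eval x (g ()) ∈ Ideal.span (Set.range x) ^ n := by
    rcases hg () with h | ⟨m, hm, hgm⟩
    · rw [h, map_zero]; exact zero_mem _
    · have h7 : m = n := by
        have : (m : ℝ) = n := by push_cast at hm; linarith
        exact_mod_cast this
      rw [← h7]
      exact eval_mem_pow x hgm.1
  refine ⟨_, h6, ?_⟩
  by_contra h7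
  have h8 : y ^ j * eval x (g ()) ∈ valLe x (n + j * τ) := by
    rw [add_comm]
    exact mul_mem_valLe (pow_mem_valLe hy.1 j) (pow_le_valLe n h6)
  have h9 := hy.pow (n := r - j) (by omega)
  refine hx.mul_notMem_valLt hQ hform (sub_mem hz h8) h7 h9.1 h9.2 ?_
  rw [hval, ← neg_mem_iff]
  convert h5 using 1
  obtain ⟨k, rfl⟩ := Nat.exists_eq_add_of_lt hj
  have h10 : j + k + 1 - j = k + 1 := by omega
  rw [h10]
  ring

theorem MaxGrowth.exists_prime_form (hx : MaxGrowth x)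
    (hQ : Ideal.span (Set.range x) ≤ maximalIdeal R)
    (hform : ∀ n : ℕ, valLe x n ≤ formFil x n) {y : R} (hy : HasValue x 1 y) :
    ∃ f : MvPolynomial (Fin (c + 1)) R, f.IsHomogeneous 1 ∧ eval x f - y ∈ valLt x 1 ∧
      map (residue R) f ≠ 0 ∧ Prime (map (residue R) f) := by
  obtain ⟨f, hf, hfy⟩ := hx.exists_eval_sub_mem hQ hform (n := 1) (y := y)
    (by rw [Nat.cast_one]; exact hy.1)
  rw [Nat.cast_one] at hfy
  have h0 : map (residue R) f ≠ 0 := by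
    intro h
    have h1 : cls (x := x) (1 : ℕ) (eval x f) (eval_mem_valLe hf) = 0 := by
      rw [← algebraMap_form hf, h, map_zero]
    rw [cls_eq_zero_iff, Nat.cast_one] at h1
    exact hy.2 (sub_sub_self (eval x f) y ▸ sub_mem h1 hfy)
  refine ⟨f, hf, hfy, h0, Irreducible.prime
    (irreducible_of_totalDegree_eq_one ((hf.map _).totalDegree h0) fun a ha => ?_)⟩
  refine isUnit_iff_ne_zero.2 fun h => h0 (MvPolynomial.ext _ _ fun i => ?_)
  rw [coeff_zero]
  exact zero_dvd_iff.1 (h ▸ ha i)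

theorem MaxGrowth.regular_of_valLe_le_formFil (hx : MaxGrowth x)
    (hQ : Ideal.span (Set.range x) ≤ maximalIdeal R)
    (hform : ∀ n : ℕ, valLe x n ≤ formFil x n) :
    (∀ n : ℕ, valLe x n ≤ Ideal.span (Set.range x) ^ n) ∧
      ∃ y ∈ maximalIdeal R, ∃ j, maximalIdeal R ≤
        Ideal.span {y} ⊔ Ideal.span (x '' {j}ᶜ) ⊔ maximalIdeal R ^ 2 := by
  obtain ⟨τ, y, h0, h1, hy, hτ⟩ := hx.exists_min_value hQ
  obtain ⟨r, hr, hrτ, hval⟩ := hx.exists_values_eq hQ hform h0 h1 hy hτ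
  have hyr : HasValue x 1 (y ^ r) := hrτ ▸ hy.pow hr
  obtain ⟨f, hf, hfy, hf0, hprime⟩ := hx.exists_prime_form hQ hform hyr
  have hym : y ∈ maximalIdeal R := hy.mem_maximalIdeal hx hQ h0
  have key : ∀ (I : Ideal R) (t : ℝ), (∀ n j : ℕ, j < r → t ≤ n + j * τ →
      ∀ w ∈ Ideal.span (Set.range x) ^ n, y ^ j * w ∈ I) → valLe x t ≤ I := by
    intro I t h
    refine hx.valLe_le hQ fun s hs z hz => ?_
    by_cases hz' : z ∈ valLt x s
    · exact Ideal.mem_sup_right hz'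
    obtain ⟨n, j, hj, rfl⟩ := hval s z ⟨hz, hz'⟩
    obtain ⟨w, hw, hzw⟩ := hx.exists_sub_pow_mul_mem hQ hform hy hrτ hf hfy hprime hj hz
    rw [← add_sub_cancel (y ^ j * w) z]
    exact add_mem (Ideal.mem_sup_left (h n j hj hs w hw)) (Ideal.mem_sup_right hzw)
  have hlt : ∀ j : ℕ, j < r → j * τ < 1 := fun j hj => by
    rw [← hrτ]
    exact mul_lt_mul_of_pos_right (by exact_mod_cast hj) h0
  refine ⟨fun n => key _ _ fun m j hj hm w hw => Ideal.mul_mem_left _ _ ?_, y, hym, ?_⟩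
  · refine Ideal.pow_le_pow_right ?_ hw
    have h2 := hlt j hj
    have h3 : (n : ℝ) < m + 1 := by linarith
    exact Nat.lt_succ_iff.1 (by exact_mod_cast h3)
  have hsq : valLt x 1 ≤ maximalIdeal R ^ 2 := by
    have h2 := hx.valLt_le_valLe_add hQ hform hτ 1
    rw [Nat.cast_one] at h2
    refine h2.trans (key _ _ fun n j hj hn w hw => ?_)
    have h3 : y ^ j * w ∈ maximalIdeal R ^ (j + n) := by
      rw [pow_add]
      exact Ideal.mul_mem_mul (Ideal.pow_mem_pow hym j) (Ideal.pow_right_mono hQ n hw)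
    refine Ideal.pow_le_pow_right ?_ h3
    by_contra! h
    have h4 := hlt j hj
    rcases (by omega : n = 0 ∨ (n = 1 ∧ j = 0)) with rfl | ⟨rfl, rfl⟩
    · push_cast at hn; linarith
    · push_cast at hn; linarith
  obtain ⟨j, a, ha, hj⟩ := exists_isUnit_coeff_eval_sub_mem x hf hf0
  refine ⟨j, ?_⟩
  set J := Ideal.span {y} ⊔ Ideal.span (x '' {j}ᶜ) ⊔ maximalIdeal R ^ 2 with hJ
  have hyJ : y ∈ J := Ideal.mem_sup_left (Ideal.mem_sup_left (Ideal.mem_span_singleton_self y))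
  have hxJ : ∀ i, x i ∈ J := by
    intro i
    by_cases hi : i = j
    · subst hi
      rw [← Ideal.unit_mul_mem_iff_mem _ ha]
      have h2 : eval x f - a * x i ∈ J := Ideal.mem_sup_left (Ideal.mem_sup_right hj)
      have h3 : eval x f - y ^ r ∈ J := Ideal.mem_sup_right (hsq hfy)
      have h4 : y ^ r ∈ J := Ideal.pow_mem_of_mem _ hyJ r hr
      have h5 := add_mem (sub_mem h3 h2) h4
      ring_nf at h5
      rwa [mul_comm] at h5 ⊢
    · exact Ideal.mem_sup_left (Ideal.mem_sup_right (Ideal.subset_span ⟨i, hi, rfl⟩))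
  refine (maximalIdeal_le_valLe hτ).trans (key _ _ fun n k hk hn w hw => ?_)
  rcases Nat.eq_zero_or_pos k with rfl | hk'
  · rcases Nat.eq_zero_or_pos n with rfl | hn'
    · push_cast at hn; linarith
    · refine Ideal.mul_mem_left _ _ (Ideal.span_le.2 ?_ (Ideal.pow_le_self hn'.ne' hw))
      rintro _ ⟨i, rfl⟩
      exact hxJ i
  · exact Ideal.mul_mem_right _ _ (Ideal.pow_mem_of_mem _ hyJ k hk')

end Values

end NormalChern

namespace NormalChern

open Module IsLocalRing MvPolynomial

/-- A ring homomorphism between local rings with the formal properties of the canonical map from a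
local ring to its completion. -/
structure IsCompletionMap {R A : Type*} [CommRing R] [IsLocalRing R] [CommRing A] [IsLocalRing A]
    (φ : R →+* A) : Prop where
  map_maximalIdeal : (maximalIdeal R).map φ = maximalIdeal A
  exists_sub_mem : ∀ (M : ℕ) (a : A), ∃ r, a - φ r ∈ maximalIdeal A ^ M
  mem_of_map_mem : ∀ (M : ℕ) (r : R), φ r ∈ maximalIdeal A ^ M → r ∈ maximalIdeal R ^ M

section

variable {R A : Type*} [CommRing R] [IsLocalRing R] [CommRing A] [IsLocalRing A] {φ : R →+* A}

theorem IsCompletionMap.map_mem (hφ : IsCompletionMap φ) {M : ℕ} {r : R}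
    (hr : r ∈ maximalIdeal R ^ M) : φ r ∈ maximalIdeal A ^ M := by
  rw [← hφ.map_maximalIdeal, ← Ideal.map_pow]
  exact Ideal.mem_map_of_mem _ hr

theorem IsCompletionMap.exists_mem_sub_mem (hφ : IsCompletionMap φ) {I : Ideal R} (M : ℕ) {a : A}
    (ha : a ∈ I.map φ) : ∃ r ∈ I, a - φ r ∈ maximalIdeal A ^ M := by
  refine Submodule.span_induction ?_ ?_ ?_ ?_ ha
  · rintro _ ⟨r, hr, rfl⟩
    exact ⟨r, hr, by rw [sub_self]; exact zero_mem _⟩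
  · exact ⟨0, zero_mem _, by rw [map_zero, sub_zero]; exact zero_mem _⟩
  · rintro a b - - ⟨r, hr, har⟩ ⟨s, hs, hbs⟩
    exact ⟨r + s, add_mem hr hs, by rw [map_add, add_sub_add_comm]; exact add_mem har hbs⟩
  · rintro a b - ⟨s, hs, hbs⟩
    obtain ⟨r, hr⟩ := hφ.exists_sub_mem M a
    refine ⟨r * s, Ideal.mul_mem_left _ _ hs, ?_⟩
    have h : a • b - φ (r * s) = a * (b - φ s) + φ s * (a - φ r) := by
      rw [map_mul, smul_eq_mul]; ring
    rw [h]
    exact add_mem (Ideal.mul_mem_left _ _ hbs) (Ideal.mul_mem_left _ _ hr)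

theorem IsCompletionMap.mem_of_mem_map [IsNoetherianRing R] (hφ : IsCompletionMap φ) {I : Ideal R}
    {r : R} (hr : φ r ∈ I.map φ) : r ∈ I := by
  refine mem_of_forall_mem_sup_pow (J := maximalIdeal R) le_rfl fun M => ?_
  obtain ⟨s, hs, h⟩ := hφ.exists_mem_sub_mem M hr
  rw [← map_sub] at h
  rw [← add_sub_cancel s r]
  exact add_mem (Ideal.mem_sup_left hs) (Ideal.mem_sup_right (hφ.mem_of_map_mem M _ h))

theorem IsCompletionMap.isLocalHom (hφ : IsCompletionMap φ) : IsLocalHom φ := by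
  refine ⟨fun r hr => ?_⟩
  by_contra h
  have h1 := hφ.map_mem (M := 1) (r := r) (by rw [pow_one]; exact (mem_maximalIdeal r).2 h)
  rw [pow_one] at h1
  exact (mem_maximalIdeal _).1 h1 hr

variable {c : ℕ} {x : Fin (c + 1) → R}

omit [IsLocalRing R] [IsLocalRing A] in
theorem map_span_range {ι : Type*} (φ : R →+* A) (x : ι → R) :
    (Ideal.span (Set.range x)).map φ = Ideal.span (Set.range (φ ∘ x)) := by
  rw [Ideal.map_span, ← Set.range_comp]

theorem IsCompletionMap.isUnitForm (hφ : IsCompletionMap φ) {s : ℕ}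
    {g : MvPolynomial (Fin (c + 1)) R} (hg : IsUnitForm s g) : IsUnitForm s (map φ g) := by
  have := hφ.isLocalHom
  refine ⟨hg.1.map _, fun h => hg.2 ?_⟩
  rw [MvPolynomial.map_map, ← ResidueField.map_comp_residue, ← MvPolynomial.map_map] at h
  exact (map_eq_zero_iff _ (MvPolynomial.map_injective _ (ResidueField.map φ).injective)).1 h

theorem IsCompletionMap.map_mem_formFil (hφ : IsCompletionMap φ) {n : ℕ} {r : R}
    (hr : r ∈ formFil x n) : φ r ∈ formFil (φ ∘ x) n := by
  obtain ⟨s, g, hg, h⟩ := hr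
  refine ⟨s, map φ g, hφ.isUnitForm hg, ?_⟩
  rw [eval_map, ← eval₂_comp, ← map_mul, ← map_span_range, ← Ideal.map_pow]
  exact Ideal.mem_map_of_mem _ h

variable [IsNoetherianRing R]

omit [IsLocalRing R] [IsNoetherianRing R] in
theorem exists_eq_sum_of_mem_iSup {m : ℕ} {I : ℕ → Ideal R} {y z : R}
    (h : z ∈ ⨆ i ∈ Finset.range m, I i * Ideal.span {y ^ i}) :
    ∃ a : ℕ → R, (∀ i, a i ∈ I i) ∧ z = ∑ i ∈ Finset.range m, a i * y ^ i := by
  obtain ⟨μ, hμ⟩ := (Submodule.mem_iSup_finset_iff_exists_sum _ _).1 h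
  choose a ha hay using fun i => Ideal.mem_mul_span_singleton.1 (μ i).2
  exact ⟨a, ha, by rw [← hμ]; exact Finset.sum_congr rfl fun i _ => (hay i).symm⟩

variable [IsNoetherianRing A] [IsAdicComplete (maximalIdeal A) A] [IsReduced A]
  [hN : Fact (∃ N, maximalIdeal A ^ N ≤ Ideal.span (Set.range (φ ∘ x)))]

theorem IsCompletionMap.idealIntegralClosure_eq (hφ : IsCompletionMap φ)
    (hx : MaxGrowth (φ ∘ x)) (hQ : Ideal.span (Set.range (φ ∘ x)) ≤ maximalIdeal A) (n : ℕ) :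
    idealIntegralClosure (Ideal.span (Set.range x) ^ n) = (valLe (φ ∘ x) n).comap φ := by
  refine le_antisymm (Ideal.span_le.2 ?_) fun y hy => Ideal.subset_span ?_
  · rintro y ⟨m, hm, a, ha, h⟩
    rw [SetLike.mem_coe, Ideal.mem_comap, mem_valLe, Real.rpow_natCast]
    refine nu_le_of_integral hm (fun j => φ (a j)) (fun j h1 h2 => ?_) ?_
    · rw [← map_span_range, ← Ideal.map_pow, ← Ideal.map_pow]
      exact Ideal.mem_map_of_mem _ (ha j h1 h2)
    · have h1 := congrArg φ h
      rw [map_add, map_zero, map_pow, map_sum] at h1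
      rw [← h1]
      simp only [map_mul, map_pow]
  · obtain ⟨m, b, hm, hb, h⟩ := hx.exists_pow_eq_sum_of_mem_valLe hQ hy
    have h1 : y ^ m ∈ ⨆ i ∈ Finset.range m,
        (Ideal.span (Set.range x) ^ n) ^ (m - i) * Ideal.span {y ^ i} := by
      refine hφ.mem_of_mem_map ?_
      rw [map_pow, h]
      refine Ideal.sum_mem _ fun i hi => ?_
      refine Ideal.map_mono (le_iSup₂_of_le i hi le_rfl) ?_
      rw [Ideal.map_mul, Ideal.map_pow, Ideal.map_pow, map_span_range]
      refine Ideal.mul_mem_mul (hb i (Finset.mem_range.1 hi)) ?_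
      rw [← map_pow]
      exact Ideal.mem_map_of_mem _ (Ideal.mem_span_singleton_self _)
    obtain ⟨a, ha, hay⟩ := exists_eq_sum_of_mem_iSup h1
    refine ⟨m, hm, fun j => - a (m - j), fun j h1 h2 => ?_, ?_⟩
    · have h3 := ha (m - j)
      rw [Nat.sub_sub_self h2] at h3
      exact neg_mem h3
    · have h2 : ∑ j ∈ Finset.Icc 1 m, a (m - j) * y ^ (m - j) = y ^ m := by
        rw [hay]
        refine Finset.sum_nbij' (fun j => m - j) (fun i => m - i) ?_ ?_ ?_ ?_ ?_
        · exact fun j hj => by rw [Finset.mem_Icc] at hj; rw [Finset.mem_range]; omega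
        · exact fun i hi => by rw [Finset.mem_range] at hi; rw [Finset.mem_Icc]; omega
        · exact fun j hj => by rw [Finset.mem_Icc] at hj; omega
        · exact fun i hi => by rw [Finset.mem_range] at hi; omega
        · exact fun _ _ => rfl
      simp only [neg_mul, Finset.sum_neg_distrib]
      rw [h2, add_neg_cancel]

omit [IsNoetherianRing R] [IsNoetherianRing A] [IsAdicComplete (maximalIdeal A) A] [IsReduced A] in
theorem IsCompletionMap.valLe_le_formFil (hφ : IsCompletionMap φ) {n : ℕ}
    (h : ∀ y, φ y ∈ valLe (φ ∘ x) n → y ∈ formFil x n) :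
    valLe (φ ∘ x) n ≤ formFil (φ ∘ x) n := by
  obtain ⟨N, hN'⟩ := hN.out
  intro a ha
  obtain ⟨r, hr⟩ := hφ.exists_sub_mem (N * n) a
  rw [pow_mul] at hr
  have hr' := Ideal.pow_right_mono hN' n hr
  rw [← sub_add_cancel a (φ r)]
  refine add_mem (pow_le_formFil n hr') (hφ.map_mem_formFil (h r ?_))
  rw [← sub_sub_self a (φ r)]
  exact sub_mem ha (pow_le_valLe n hr')

omit [IsNoetherianRing R] in
theorem mem_formFil_of_relLength_lt {W : ℕ → Ideal R} {n : ℕ}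
    (hW : ∀ l, W n * Ideal.span (Set.range x) ^ l ≤ W (n + l))
    (h : ∃ l, relLength (Ideal.span (Set.range x) ^ (n + l)) (W (n + l)) < formDim c l) {y : R}
    (hy : y ∈ W n) : y ∈ formFil x n := by
  obtain ⟨l, hl⟩ := h
  by_contra hy'
  refine hl.not_ge ((formDim_le_relLength' x (r := y) fun p hp h0 => ?_).trans
    (relLength_mono_right _ ((Ideal.mul_mono_left ?_).trans (hW l))))
  · by_contra h1
    exact hy' ⟨l, p, ⟨hp, h1⟩, by rwa [mul_comm]⟩
  · exact (Ideal.span_singleton_le_iff_mem _).2 hy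

omit [IsLocalRing R] [IsNoetherianRing R] in
theorem _root_.HasHilbertCoeffs.exists_length_eq {I : Ideal R} {e : ℕ → ℤ}
    (he : HasHilbertCoeffs I (c + 1) e) : ∃ N, ∀ n ≥ N, ∃ l : ℕ,
      Module.length R (R ⧸ I ^ (n + 1)) = l ∧
      (l : ℤ) = ∑ i ∈ Finset.range (c + 2), (-1 : ℤ) ^ i * e i * formDim (c + 1 - i) n := by
  obtain ⟨N, h⟩ := he
  refine ⟨N, fun n hn => ?_⟩
  obtain ⟨l, hl, hle⟩ := h n hn
  refine ⟨l, ?_, hle.trans (Finset.sum_congr rfl fun i hi => ?_)⟩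
  · rw [moduleLength, ← Module.coe_length] at hl
    exact_mod_cast hl
  · rw [Finset.mem_range] at hi
    rw [formDim, Nat.add_sub_assoc (by omega)]

omit [IsLocalRing R] [IsNoetherianRing R] in
theorem _root_.HasNormalHilbertCoeffs.exists_length_eq {I : Ideal R} {e : ℕ → ℤ}
    (he : HasNormalHilbertCoeffs I (c + 1) e) : ∃ N, ∀ n ≥ N, ∃ l : ℕ,
      Module.length R (R ⧸ idealIntegralClosure (I ^ (n + 1))) = l ∧
      (l : ℤ) = ∑ i ∈ Finset.range (c + 2), (-1 : ℤ) ^ i * e i * formDim (c + 1 - i) n := by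
  obtain ⟨N, h⟩ := he
  refine ⟨N, fun n hn => ?_⟩
  obtain ⟨l, hl, hle⟩ := h n hn
  refine ⟨l, ?_, hle.trans (Finset.sum_congr rfl fun i hi => ?_)⟩
  · rw [moduleLength, ← Module.coe_length] at hl
    exact_mod_cast hl
  · rw [Finset.mem_range] at hi
    rw [formDim, Nat.add_sub_assoc (by omega)]

omit [IsLocalRing R] [IsNoetherianRing R] in
theorem exists_relLength_lt {I : Ideal R} {W : ℕ → Ideal R} {e e' : ℕ → ℤ} {T : ℕ}
    (he : ∃ N, ∀ n ≥ N, ∃ l : ℕ, Module.length R (R ⧸ I ^ (n + 1)) = l ∧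
      (l : ℤ) = ∑ i ∈ Finset.range (c + 2), (-1 : ℤ) ^ i * e i * formDim (c + 1 - i) n)
    (he' : ∃ N, ∀ n ≥ N, ∃ l : ℕ, Module.length R (R ⧸ W (n + 1)) = l ∧
      (l : ℤ) = ∑ i ∈ Finset.range (c + 2), (-1 : ℤ) ^ i * e' i * formDim (c + 1 - i) n)
    (h1 : e' 1 = e 1) (hle : ∀ n, I ^ n ≤ W n) (hle' : ∀ n, W (T + n) ≤ I ^ n) (n : ℕ) :
    ∃ l, relLength (I ^ (n + 1 + l)) (W (n + 1 + l)) < formDim c l := by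
  obtain ⟨N₁, h₁⟩ := he
  obtain ⟨N₂, h₂⟩ := he'
  obtain ⟨l, hl, hlt⟩ := exists_sub_lt_formDim (c := c) (N := max N₁ N₂) (T := T)
    (fun _ => rfl) (fun _ => rfl) h1 (fun k hk => by
      obtain ⟨a, ha, hae⟩ := h₁ k (le_of_max_le_left hk)
      obtain ⟨b, hb, hbe⟩ := h₂ k (le_of_max_le_right hk)
      rw [← hae, ← hbe]
      have h := length_quotient_anti (hle (k + 1))
      rw [ha, hb] at h
      exact_mod_cast h) (fun k hk => by
      obtain ⟨a, ha, hae⟩ := h₁ k (le_of_max_le_left hk)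
      obtain ⟨b, hb, hbe⟩ := h₂ (k + T) ((le_of_max_le_right hk).trans (Nat.le_add_right _ _))
      rw [← hae, ← hbe]
      have h := length_quotient_anti (hle' (k + 1))
      rw [show T + (k + 1) = k + T + 1 by omega, ha, hb] at h
      exact_mod_cast h) n
  refine ⟨l, ?_⟩
  obtain ⟨a, ha, hae⟩ := h₁ (n + l) (by omega)
  obtain ⟨b, hb, hbe⟩ := h₂ (n + l) (by omega)
  rw [← hae, ← hbe] at hlt
  have h := length_quotient_eq_add (hle (n + l + 1))
  rw [ha, hb] at h
  rw [show n + 1 + l = n + l + 1 by omega]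
  have hfin : relLength (I ^ (n + l + 1)) (W (n + l + 1)) ≠ ⊤ := by
    intro h0
    rw [h0, top_add] at h
    exact ENat.natCast_ne_top a h
  obtain ⟨k, hk⟩ := ENat.ne_top_iff_exists.1 hfin
  rw [← hk] at h ⊢
  have h2 : a = k + b := by exact_mod_cast h
  have h3 : k < formDim c l := by
    rw [h2] at hlt
    push_cast at hlt
    have : (k : ℤ) < formDim c l := by linarith
    exact_mod_cast this
  exact_mod_cast h3

theorem IsCompletionMap.regular_and_normal (hφ : IsCompletionMap φ)
    (hx : MaxGrowth (φ ∘ x)) (hQ : Ideal.span (Set.range (φ ∘ x)) ≤ maximalIdeal A) {e e' : ℕ → ℤ}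
    (he : HasHilbertCoeffs (Ideal.span (Set.range x)) (c + 1) e)
    (he' : HasNormalHilbertCoeffs (Ideal.span (Set.range x)) (c + 1) e') (h1 : e' 1 = e 1) :
    (∃ s : Finset R, Ideal.span (s : Set R) = maximalIdeal R ∧ s.card ≤ c + 1) ∧
      ∀ n, idealIntegralClosure (Ideal.span (Set.range x) ^ n) = Ideal.span (Set.range x) ^ n := by
  classical
  set W : ℕ → Ideal R := fun n => (valLe (φ ∘ x) n).comap φ with hW
  have hWn : ∀ n, idealIntegralClosure (Ideal.span (Set.range x) ^ n) = W n :=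
    fun n => hφ.idealIntegralClosure_eq hx hQ n
  obtain ⟨T, hT⟩ := hx.exists_valLe_le_pow hQ
  have hmap : ∀ n, (Ideal.span (Set.range x) ^ n).map φ = Ideal.span (Set.range (φ ∘ x)) ^ n :=
    fun n => by rw [Ideal.map_pow, map_span_range]
  have hle : ∀ n, Ideal.span (Set.range x) ^ n ≤ W n := fun n => by
    rw [hW, ← Ideal.map_le_iff_le_comap, hmap]
    exact pow_le_valLe n
  have hform : ∀ n : ℕ, valLe (φ ∘ x) n ≤ formFil (φ ∘ x) n := by
    intro n
    rcases n with _ | n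
    · rw [formFil_zero]; exact le_top
    refine hφ.valLe_le_formFil fun y hy => ?_
    have he'' : ∃ N, ∀ n ≥ N, ∃ l : ℕ, Module.length R (R ⧸ W (n + 1)) = l ∧
        (l : ℤ) = ∑ i ∈ Finset.range (c + 2), (-1 : ℤ) ^ i * e' i * formDim (c + 1 - i) n := by
      obtain ⟨N, h⟩ := he'.exists_length_eq
      refine ⟨N, fun k hk => ?_⟩
      rw [← hWn]
      exact h k hk
    refine mem_formFil_of_relLength_lt (W := W) (fun l => ?_)
      (exists_relLength_lt (T := T) he.exists_length_eq he'' h1 hle (fun n r hr => ?_) n) hy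
    · refine Ideal.mul_le.2 fun a ha b hb => ?_
      rw [hW, Ideal.mem_comap, map_mul, Nat.cast_add]
      exact mul_mem_valLe ha (hle l hb)
    · refine hφ.mem_of_mem_map ?_
      rw [hmap]
      refine hT n ?_
      have hr' := Ideal.mem_comap.1 hr
      rwa [Nat.cast_add] at hr'
  obtain ⟨hnorm, y, hy, j, hj⟩ := hx.regular_of_valLe_le_formFil hQ hform
  refine ⟨?_, fun n => le_antisymm ?_ ((hle n).trans_eq (hWn n).symm)⟩
  · obtain ⟨r, hr⟩ := hφ.exists_sub_mem 2 y
    have hrm : r ∈ maximalIdeal R := by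
      rw [← pow_one (maximalIdeal R)]
      refine hφ.mem_of_map_mem 1 r ?_
      rw [pow_one, ← sub_sub_self y (φ r)]
      exact sub_mem hy (Ideal.pow_le_self two_ne_zero hr)
    have hQm : Ideal.span (Set.range x) ≤ maximalIdeal R := by
      intro a ha
      rw [← pow_one (maximalIdeal R)]
      refine hφ.mem_of_map_mem 1 a ?_
      rw [pow_one]
      refine hQ ?_
      rw [← map_span_range]
      exact Ideal.mem_map_of_mem _ ha
    set s : Finset R := insert r ((Finset.univ.erase j).image x) with hs
    have hsx : Ideal.span (s : Set R) = Ideal.span {r} ⊔ Ideal.span (x '' {j}ᶜ) := by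
      rw [← Ideal.span_union, hs, Finset.coe_insert, Set.insert_eq, Finset.coe_image,
        Finset.coe_erase, Finset.coe_univ, Set.compl_eq_univ_sdiff]
    refine ⟨s, le_antisymm ?_ ?_, ?_⟩
    · rw [Ideal.span_le, hs, Finset.coe_insert, Set.insert_subset_iff]
      refine ⟨hrm, fun a ha => hQm ?_⟩
      obtain ⟨i, -, rfl⟩ := Finset.mem_image.1 ha
      exact Ideal.subset_span ⟨i, rfl⟩
    · refine Submodule.le_of_le_smul_of_le_jacobson_bot (I := maximalIdeal R)
        (maximalIdeal R).fg_of_isNoetherianRing (maximalIdeal_le_jacobson _) fun a ha => ?_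
      rw [smul_eq_mul, ← sq]
      refine hφ.mem_of_mem_map ?_
      have h2 := hj (show φ a ∈ maximalIdeal A by
        rw [← hφ.map_maximalIdeal]; exact Ideal.mem_map_of_mem _ ha)
      suffices h : Ideal.span {y} ⊔ Ideal.span ((φ ∘ x) '' {j}ᶜ) ⊔ maximalIdeal A ^ 2 ≤
          (Ideal.span (s : Set R) ⊔ maximalIdeal R ^ 2).map φ from h h2
      have h3 : maximalIdeal A ^ 2 ≤ (Ideal.span (s : Set R) ⊔ maximalIdeal R ^ 2).map φ := by
        rw [← hφ.map_maximalIdeal, ← Ideal.map_pow]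
        exact Ideal.map_mono le_sup_right
      refine sup_le (sup_le ?_ ?_) h3
      · rw [Ideal.span_singleton_le_iff_mem, ← sub_add_cancel y (φ r)]
        refine add_mem (h3 hr) (Ideal.mem_map_of_mem _ (Ideal.mem_sup_left (Ideal.subset_span ?_)))
        exact Finset.mem_coe.2 (Finset.mem_insert_self _ _)
      · rw [Ideal.span_le]
        rintro _ ⟨i, hi, rfl⟩
        refine Ideal.mem_map_of_mem _ (Ideal.mem_sup_left ?_)
        rw [hsx]
        exact Ideal.mem_sup_right (Ideal.subset_span ⟨i, hi, rfl⟩)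
    · refine (Finset.card_insert_le _ _).trans (Nat.succ_le_succ (Finset.card_image_le.trans ?_))
      rw [Finset.card_erase_of_mem (Finset.mem_univ j), Finset.card_univ, Fintype.card_fin,
        Nat.add_sub_cancel]
  · rw [hWn]
    intro r hr
    refine hφ.mem_of_mem_map ?_
    rw [hmap]
    exact hnorm n hr

end

end NormalChern

namespace NormalChern

open Module IsLocalRing

section

variable {P A : Type*} [CommRing P] [CommRing A] {J : Ideal P} {I : Ideal A} {g : P →+* A}

/-- The extension of a ring homomorphism to the completion of its source, modulo powers. -/
noncomputable def completionLiftMod (hg : J.map g = I) (n : ℕ) :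
    AdicCompletion J P →+* A ⧸ I ^ n :=
  (Ideal.quotientMap (I ^ n) g (Ideal.map_le_iff_le_comap.1
    (by rw [Ideal.map_pow, hg]) : J ^ n ≤ (I ^ n).comap g)).comp
    (AdicCompletion.evalₐ J n : AdicCompletion J P →+* P ⧸ J ^ n)

theorem completionLiftMod_mk (hg : J.map g = I) (n : ℕ) (s : AdicCompletion.AdicCauchySequence J P) :
    completionLiftMod hg n (AdicCompletion.mk J P s) = Ideal.Quotient.mk _ (g (s.val n)) := by
  simp only [completionLiftMod, RingHom.comp_apply, RingHom.coe_coe, AdicCompletion.evalₐ_mk,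
    Ideal.quotientMap_mk]

theorem isNoetherianRing_of_completion [IsAdicComplete I A] (hJ : J.FG)
    [IsNoetherianRing (AdicCompletion J P)] (hg : J.map g = I)
    (hs : ∀ a, ∃ p, a - g p ∈ I) : IsNoetherianRing A := by
  have hc : ∀ {m n : ℕ} (hle : m ≤ n), (Ideal.Quotient.factorPow I hle).comp
      (completionLiftMod hg n) = completionLiftMod hg m := by
    intro m n hle
    ext b
    obtain ⟨s, rfl⟩ := AdicCompletion.mk_surjective J P b
    rw [RingHom.comp_apply, completionLiftMod_mk, completionLiftMod_mk]
    refine (Ideal.Quotient.eq).2 ?_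
    rw [← map_sub, ← hg, ← Ideal.map_pow]
    refine Ideal.mem_map_of_mem _ ?_
    have h := (s.2 hle).symm
    rw [SModEq.sub_mem] at h
    simpa using h
  set f := IsAdicComplete.liftRingHom I (fun n => completionLiftMod hg n) hc with hf
  have hfg : f.comp (algebraMap P (AdicCompletion J P)) = g := by
    ext p
    refine IsHausdorff.eq_iff_smodEq (I := I) |>.2 fun n => ?_
    rw [SModEq.sub_mem, smul_eq_mul, Ideal.mul_top, ← Ideal.Quotient.eq, RingHom.comp_apply, hf,
      IsAdicComplete.mk_liftRingHom]
    simp [completionLiftMod, AdicCompletion.algebraMap_apply]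
  have hmap : (J.map (algebraMap P (AdicCompletion J P))).map f = I := by
    rw [Ideal.map_map, hfg, hg]
  have h1 := AdicCompletion.isAdicComplete_self J hJ
  have h2 : IsHausdorff ((J.map (algebraMap P (AdicCompletion J P))).map f) A := by
    rw [hmap]; infer_instance
  refine isNoetherianRing_of_surjective _ _ f
    (surjective_of_mk_map_comp_surjective (I := J.map (algebraMap P (AdicCompletion J P))) f ?_)
  intro b
  obtain ⟨a, rfl⟩ := Ideal.Quotient.mk_surjective b
  obtain ⟨p, hp⟩ := hs a
  refine ⟨algebraMap P _ p, ?_⟩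
  rw [RingHom.comp_apply, eq_comm, Ideal.Quotient.eq, hmap, ← RingHom.comp_apply, hfg]
  exact hp

end

section

variable (R : Type*) [CommRing R] [IsNoetherianRing R] [IsLocalRing R]

theorem mem_maximalIdeal_pow_iff (n : ℕ) (a : AdicCompletion (maximalIdeal R) R) :
    a ∈ maximalIdeal (AdicCompletion (maximalIdeal R) R) ^ n ↔
      AdicCompletion.evalₐ (maximalIdeal R) n a = 0 := by
  have h := AdicCompletion.pow_smul_top_eq_ker_eval (M := R) (n := n)
    (maximalIdeal R).fg_of_isNoetherianRing
  rw [AdicCompletion.maximalIdeal_eq_map, ← Ideal.map_pow, ← Submodule.restrictScalars_mem R,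
    ← Ideal.smul_top_eq_map, h, LinearMap.mem_ker,
    ← AdicCompletion.factor_eval_eq_evalₐ _ _ (le_of_eq (Ideal.mul_top _))]
  constructor
  · intro h
    rw [h, map_zero]
  · intro h
    rw [← AdicCompletion.factor_evalₐ_eq_eval _ _ (le_of_eq (Ideal.mul_top _).symm),
      ← AdicCompletion.factor_eval_eq_evalₐ _ _ (le_of_eq (Ideal.mul_top _)), h, map_zero]

theorem isCompletionMap_algebraMap :
    IsCompletionMap (algebraMap R (AdicCompletion (maximalIdeal R) R)) := by
  have hmk : ∀ n r, AdicCompletion.evalₐ (maximalIdeal R) n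
      (algebraMap R (AdicCompletion (maximalIdeal R) R) r) = Ideal.Quotient.mk _ r := by
    intro n r
    rw [AdicCompletion.algebraMap_apply]
    simp
  refine ⟨AdicCompletion.maximalIdeal_eq_map.symm, fun M a => ?_, fun M r hr => ?_⟩
  · obtain ⟨r, hr⟩ := Ideal.Quotient.mk_surjective (AdicCompletion.evalₐ (maximalIdeal R) M a)
    refine ⟨r, ?_⟩
    rw [mem_maximalIdeal_pow_iff, map_sub, hmk, hr, sub_self]
  · rwa [mem_maximalIdeal_pow_iff, hmk, Ideal.Quotient.eq_zero_iff_mem] at hr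

theorem isNoetherianRing_adicCompletion :
    IsNoetherianRing (AdicCompletion (maximalIdeal R) R) := by
  obtain ⟨k, y, hy⟩ := Submodule.fg_iff_exists_fin_generating_family.1
    (maximalIdeal R).fg_of_isNoetherianRing
  have h1 : IsNoetherianRing (AdicCompletion (MvPolynomial.idealOfVars (Fin k) R)
      (MvPolynomial (Fin k) R)) :=
    isNoetherianRing_of_ringEquiv (MvPowerSeries (Fin k) R)
      (MvPowerSeries.toAdicCompletionAlgEquiv (Fin k) R).toRingEquiv
  have hφ := isCompletionMap_algebraMap R
  refine isNoetherianRing_of_completion (J := MvPolynomial.idealOfVars (Fin k) R)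
    (I := maximalIdeal (AdicCompletion (maximalIdeal R) R))
    (g := (algebraMap R (AdicCompletion (maximalIdeal R) R)).comp
      (MvPolynomial.aeval y : MvPolynomial (Fin k) R →ₐ[R] R).toRingHom)
    (MvPolynomial.idealOfVars_fg _ _) ?_ fun a => ?_
  · rw [← Ideal.map_map, ← hφ.map_maximalIdeal]
    congr 1
    rw [MvPolynomial.idealOfVars, Ideal.map_span, ← Set.range_comp]
    refine Eq.trans ?_ hy
    congr 2
    ext i
    simp
  · obtain ⟨r, hr⟩ := hφ.exists_sub_mem 1 a
    refine ⟨MvPolynomial.C r, ?_⟩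
    rw [pow_one] at hr
    simpa using hr

end

end NormalChern

namespace NormalChern

open Module IsLocalRing

theorem exists_maximalIdeal_pow_le {R : Type*} [CommRing R] [IsNoetherianRing R] [IsLocalRing R]
    (I : Ideal R) [IsArtinianRing (R ⧸ I)] : ∃ N, maximalIdeal R ^ N ≤ I := by
  have h : maximalIdeal R ≤ I.radical := by
    rw [Ideal.radical_eq_sInf]
    refine le_sInf fun J hJ => ?_
    have := hJ.2
    have h1 : IsArtinianRing (R ⧸ J) :=
      (Ideal.Quotient.factor_surjective hJ.1).isArtinianRing
    rw [← IsLocalRing.eq_maximalIdeal (Ideal.Quotient.maximal_of_isField J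
      (IsArtinianRing.isField_of_isDomain (R ⧸ J)))]
  obtain ⟨N, hN⟩ := I.exists_radical_pow_le_of_fg I.radical.fg_of_isNoetherianRing
  exact ⟨N, (Ideal.pow_right_mono h N).trans hN⟩

theorem exists_maximalIdeal_pow_le_of_moduleLength {R : Type*} [CommRing R] [IsNoetherianRing R]
    [IsLocalRing R] {I : Ideal R} {l : ℕ} (hl : moduleLength R (R ⧸ I) = (l : WithBot ℕ∞)) :
    ∃ N, maximalIdeal R ^ N ≤ I := by
  rw [moduleLength, ← Module.coe_length] at hl
  have h1 : Module.length R (R ⧸ I) = l := by exact_mod_cast hl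
  have h2 : IsFiniteLength R (R ⧸ I) := by
    rw [← Module.length_ne_top_iff, h1]
    exact ENat.natCast_ne_top l
  have h3 : IsArtinian R (R ⧸ I) := (isFiniteLength_iff_isNoetherian_isArtinian.1 h2).2
  have h4 : IsArtinianRing (R ⧸ I) := isArtinian_of_tower R h3
  exact exists_maximalIdeal_pow_le I

theorem ringKrullDim_le_card {R : Type*} [CommRing R] [IsNoetherianRing R] [IsLocalRing R]
    {s : Finset R} {N : ℕ} (hs : Ideal.span (s : Set R) ≤ maximalIdeal R)
    (hN : maximalIdeal R ^ N ≤ Ideal.span (s : Set R)) : ringKrullDim R ≤ s.card := by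
  have h : (maximalIdeal R).height ≤ s.card := by
    refine Ideal.height_le_card_of_mem_minimalPrimes_span_finset ⟨⟨inferInstance, hs⟩, ?_⟩
    rintro J ⟨hJ, hJs⟩ -
    exact Ideal.IsPrime.le_of_pow_le (hN.trans hJs)
  rw [← IsLocalRing.maximalIdeal_height_eq_ringKrullDim]
  exact_mod_cast h

theorem ringKrullDim_quotient_eq_coheight {R : Type*} [CommRing R] (p : PrimeSpectrum R) :
    ringKrullDim (R ⧸ p.asIdeal) = Order.coheight p := by
  rw [ringKrullDim_quotient, Order.coheight_eq_krullDim_Ici]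
  rfl

section

variable {R A : Type*} [CommRing R] [IsLocalRing R] [CommRing A] [IsLocalRing A] {φ : R →+* A}

theorem IsCompletionMap.ringKrullDim_le [IsNoetherianRing R] [IsNoetherianRing A]
    (hφ : IsCompletionMap φ) : ringKrullDim R ≤ ringKrullDim A := by
  classical
  obtain ⟨s, hs, hcard⟩ := Ideal.exists_finset_card_eq_height_of_isNoetherianRing (maximalIdeal A)
  have h1 : IsArtinianRing (A ⧸ Ideal.span (s : Set A)) :=
    quotient_artinian_of_mem_minimalPrimes_of_isLocalRing _ hs
  obtain ⟨N, hN⟩ := exists_maximalIdeal_pow_le (Ideal.span (s : Set A))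
  choose g hg using hφ.exists_sub_mem (N + 1)
  have hmA : Ideal.span (s : Set A) ≤ maximalIdeal A := hs.1.2
  have hm : ∀ r, φ r ∈ maximalIdeal A → r ∈ maximalIdeal R := fun r hr => by
    rw [← pow_one (maximalIdeal R)]
    exact hφ.mem_of_map_mem 1 r (by rwa [pow_one])
  have hle : Ideal.span ((s.image g : Finset R) : Set R) ≤ maximalIdeal R := by
    rw [Ideal.span_le]
    intro r hr
    obtain ⟨a, ha, rfl⟩ := Finset.mem_image.1 (Finset.mem_coe.1 hr)
    refine hm _ ?_
    rw [← sub_sub_cancel a (φ (g a))]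
    exact sub_mem (hmA (Ideal.subset_span ha)) (Ideal.pow_le_self (Nat.succ_ne_zero N) (hg a))
  have hA : maximalIdeal A ^ N ≤ (Ideal.span ((s.image g : Finset R) : Set R)).map φ := by
    refine Submodule.le_of_le_smul_of_le_jacobson_bot (I := maximalIdeal A)
      (maximalIdeal A ^ N).fg_of_isNoetherianRing (maximalIdeal_le_jacobson _) (hN.trans ?_)
    rw [Ideal.span_le, smul_eq_mul, ← pow_succ']
    intro a ha
    rw [SetLike.mem_coe, ← add_sub_cancel (φ (g a)) a]
    refine add_mem (Ideal.mem_sup_left (Ideal.mem_map_of_mem _ (Ideal.subset_span ?_)))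
      (Ideal.mem_sup_right (hg a))
    exact Finset.mem_coe.2 (Finset.mem_image_of_mem g ha)
  have hR : maximalIdeal R ^ N ≤ Ideal.span ((s.image g : Finset R) : Set R) := fun r hr =>
    hφ.mem_of_mem_map (hA (hφ.map_mem hr))
  refine (ringKrullDim_le_card hle hR).trans ?_
  rw [← IsLocalRing.maximalIdeal_height_eq_ringKrullDim, ← hcard]
  exact_mod_cast Finset.card_image_le

theorem maxGrowth_of_ringKrullDim_quotient [IsNoetherianRing A] {c : ℕ} {x : Fin (c + 1) → A}
    (hdim : ((c + 1 : ℕ) : WithBot ℕ∞) ≤ ringKrullDim A)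
    (hu : ∀ p ∈ associatedPrimes A A, ringKrullDim (A ⧸ p) = ringKrullDim A)
    (hQ : Ideal.span (Set.range x) ≤ maximalIdeal A) {N : ℕ}
    (hN : maximalIdeal A ^ N ≤ Ideal.span (Set.range x)) : MaxGrowth x := by
  intro p hp C
  by_contra! h
  have hprime : p.IsPrime := hp.isPrime
  have h1 := coheight_le_of_growth hQ hN c ⟨p, hprime⟩ C h
  have h2 := ringKrullDim_quotient_eq_coheight (⟨p, hprime⟩ : PrimeSpectrum A)
  rw [hu p hp] at h2
  rw [h2] at hdim
  have h3 : ((c + 1 : ℕ) : ℕ∞) ≤ c := (WithBot.coe_le_coe.1 hdim).trans h1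
  have h4 : c + 1 ≤ c := by exact_mod_cast h3
  omega

end

end NormalChern

/-- **Goto–Hong–Mandal, Corollary 2.2**.  Let `(R,m)` be an analytically unramified unmixed
Noetherian local ring of positive dimension and `Q` a parameter ideal.  If `ē₁(Q) = e₁(Q)`,
then `R` is a regular local ring and `Q` is a normal ideal. -/
theorem regular_of_normal_chern_eq_chern
    {R : Type*} [CommRing R] [IsNoetherianRing R] [IsLocalRing R]
    (d : ℕ) (hd : 0 < d) (hdim : ringKrullDim R = d)
    (hur : IsReduced (AdicCompletion (maximalIdeal R) R))
    (hunmixed : IsUnmixedLocalRing R)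
    (Q : Ideal R) (hQ : IsParameterIdeal d Q)
    (e : ℕ → ℤ) (he : HasHilbertCoeffs Q d e)
    (ebar : ℕ → ℤ) (hebar : HasNormalHilbertCoeffs Q d ebar)
    (heq : ebar 1 = e 1) :
    (∃ s : Finset R, Ideal.span (s : Set R) = maximalIdeal R ∧ s.card = d) ∧
      ∀ n : ℕ, 1 ≤ n → idealIntegralClosure (Q ^ n) = Q ^ n := by
  obtain ⟨c, rfl⟩ : ∃ c, d = c + 1 := ⟨d - 1, by omega⟩
  obtain ⟨hQm, ⟨x, rfl⟩, l, hl⟩ := hQ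
  obtain ⟨N, hN⟩ := NormalChern.exists_maximalIdeal_pow_le_of_moduleLength hl
  have hφ := NormalChern.isCompletionMap_algebraMap R
  set φ := algebraMap R (AdicCompletion (maximalIdeal R) R)
  have hA := NormalChern.isNoetherianRing_adicCompletion R
  have hNA : maximalIdeal (AdicCompletion (maximalIdeal R) R) ^ N ≤
      Ideal.span (Set.range (φ ∘ x)) := by
    rw [← hφ.map_maximalIdeal, ← Ideal.map_pow, ← NormalChern.map_span_range]
    exact Ideal.map_mono hN
  have hQA : Ideal.span (Set.range (φ ∘ x)) ≤
      maximalIdeal (AdicCompletion (maximalIdeal R) R) := by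
    rw [← hφ.map_maximalIdeal, ← NormalChern.map_span_range]
    exact Ideal.map_mono hQm
  have hfact : Fact (∃ N, maximalIdeal (AdicCompletion (maximalIdeal R) R) ^ N ≤
      Ideal.span (Set.range (φ ∘ x))) := ⟨⟨N, hNA⟩⟩
  have hx : NormalChern.MaxGrowth (φ ∘ x) :=
    NormalChern.maxGrowth_of_ringKrullDim_quotient (hdim ▸ hφ.ringKrullDim_le) hunmixed hQA hNA
  obtain ⟨⟨s, hs, hcard⟩, hnorm⟩ := hφ.regular_and_normal hx hQA he hebar heq
  refine ⟨⟨s, hs, le_antisymm hcard ?_⟩, fun n _ => hnorm n⟩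
  have h := NormalChern.ringKrullDim_le_card (s := s) (N := 1) hs.le (by rw [pow_one, hs])
  rw [hdim] at h
  exact_mod_cast h
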